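/- Let G be a finitely generated elementary amenable group. Then the following are equivalent: (1) G is coherent; (2) G is homologically coherent; (3) the integral group ring ZG is coherent; (4) either G is virtually polycyclic, or G is a properly ascending HNN extension with virtually polycyclic vertex group. -/

import Mathlib

universe u v

/-- Elementary amenable groups: the smallest class (within a universe) containing all finite
and all abelian groups that is closed under group extensions, directed unions, and
isomorphisms. -/
inductive ElementaryAmenable : ∀ (G : Type u) [Group G], Prop
  | of_finite (G : Type u) [Group G] (h : Finite G) : ElementaryAmenable G
  | of_comm (G : Type u) [Group G] (h : ∀ a b : G, a * b = b * a) : ElementaryAmenable G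
  | of_mulEquiv (G H : Type u) [Group G] [Group H] (e : G ≃* H)
      (h : ElementaryAmenable G) : ElementaryAmenable H
  | of_extension (G : Type u) [Group G] (N : Subgroup G) (hN : N.Normal)
      (h1 : ElementaryAmenable N) (h2 : ElementaryAmenable (G ⧸ N)) : ElementaryAmenable G
  | of_directedUnion (G : Type u) [Group G] (ι : Type u) (S : ι → Subgroup G)
      (hdir : Directed (· ≤ ·) S) (hcov : ∀ g : G, ∃ i, g ∈ S i)
      (h : ∀ i, ElementaryAmenable (S i)) : ElementaryAmenable G
/-- A group is polycyclic if it has a subnormal series with cyclic factors; equivalently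
(peeling off the top factor of the series), it is trivial or has a polycyclic normal
subgroup with cyclic quotient. -/
inductive IsPolycyclic : ∀ (G : Type u) [Group G], Prop
  | of_subsingleton (G : Type u) [Group G] (h : Subsingleton G) : IsPolycyclic G
  | step (G : Type u) [Group G] (N : Subgroup G) (hN : N.Normal)
      (h1 : IsPolycyclic N) (h2 : IsCyclic (G ⧸ N)) : IsPolycyclic G

/-- A group is virtually polycyclic if it has a polycyclic subgroup of finite index. -/
def IsVirtuallyPolycyclic (G : Type u) [Group G] : Prop :=
  ∃ H : Subgroup G, H.FiniteIndex ∧ IsPolycyclic H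
/-- `G` is an ascending HNN extension with vertex group `B` and stable letter `t` if `G` is
generated by `B` together with `t`, and `t⁻¹ * B * t ⊇ B` (equivalently, `t * B * t⁻¹ ⊆ B`). -/
def IsAscendingHNN (G : Type u) [Group G] (B : Subgroup G) (t : G) : Prop :=
  Subgroup.closure ((B : Set G) ∪ {t}) = ⊤ ∧ ∀ b ∈ B, t * b * t⁻¹ ∈ B

/-- The HNN extension is properly ascending if moreover `t⁻¹ * B * t` strictly contains `B`. -/
def IsProperlyAscendingHNN (G : Type u) [Group G] (B : Subgroup G) (t : G) : Prop :=
  IsAscendingHNN G B t ∧ ∃ b ∈ B, t⁻¹ * b * t ∉ B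
/-- A group `G` is of type `FP₂` if the trivial module `ℤ` admits a projective resolution
over the integral group ring `ℤG` which is finitely generated in degrees `0`, `1` and `2`;
equivalently, there is a partial projective resolution
`P₂ → P₁ → P₀ → ℤ → 0` by finitely generated projective `ℤG`-modules. -/
def Group.IsTypeFP2 (G : Type u) [Group G] : Prop :=
  ∃ (P₀ P₁ P₂ : ModuleCat.{u} (MonoidAlgebra ℤ G))
    (d₂ : P₂ →ₗ[MonoidAlgebra ℤ G] P₁) (d₁ : P₁ →ₗ[MonoidAlgebra ℤ G] P₀)
    (ε : P₀ →ₗ[MonoidAlgebra ℤ G] (Representation.trivial ℤ (G := G) (V := ℤ)).asModule),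
    Module.Finite (MonoidAlgebra ℤ G) P₀ ∧ Module.Projective (MonoidAlgebra ℤ G) P₀ ∧
    Module.Finite (MonoidAlgebra ℤ G) P₁ ∧ Module.Projective (MonoidAlgebra ℤ G) P₁ ∧
    Module.Finite (MonoidAlgebra ℤ G) P₂ ∧ Module.Projective (MonoidAlgebra ℤ G) P₂ ∧
    Function.Surjective ε ∧ LinearMap.range d₁ = LinearMap.ker ε ∧
    LinearMap.range d₂ = LinearMap.ker d₁

/-- A group is homologically coherent if every finitely generated subgroup is of type `FP₂`. -/
def Group.IsHomologicallyCoherent (G : Type u) [Group G] : Prop :=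
  ∀ H : Subgroup G, Group.FG H → Group.IsTypeFP2 H
/-- A ring is (left) coherent if every finitely generated left ideal is finitely presented
as a left module. -/
def Ring.IsCoherent (R : Type v) [Ring R] : Prop :=
  ∀ I : Submodule R R, I.FG → Module.FinitePresentation R I
/-- A group is finitely presented: it admits a presentation with finitely many generators
and finitely many relations. -/
def Group.FinitelyPresented (G : Type u) [Group G] : Prop :=
  ∃ (n : ℕ) (rels : Set (FreeGroup (Fin n))), rels.Finite ∧
    Nonempty (PresentedGroup rels ≃* G)

/-- A group is coherent if every finitely generated subgroup is finitely presented. -/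
def Group.IsCoherent (G : Type u) [Group G] : Prop :=
  ∀ H : Subgroup G, Group.FG H → Group.FinitelyPresented H

abbrev ZG (G : Type u) [Group G] := MonoidAlgebra ℤ G

/-- group element in the group ring -/
noncomputable def gel {G : Type u} [Group G] (g : G) : ZG G := MonoidAlgebra.single g 1

theorem gel_mul {G : Type u} [Group G] (g h : G) : gel (g * h) = gel g * gel h := by
  simp [gel, MonoidAlgebra.single_mul_single]

theorem gel_one {G : Type u} [Group G] : gel (1 : G) = 1 := rfl

theorem gel_inv_mul {G : Type u} [Group G] (g : G) : gel g⁻¹ * gel g = 1 := by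
  rw [← gel_mul, inv_mul_cancel, gel_one]

theorem gel_mul_inv {G : Type u} [Group G] (g : G) : gel g * gel g⁻¹ = 1 := by
  rw [← gel_mul, mul_inv_cancel, gel_one]

theorem single_eq_zsmul {G : Type u} [Group G] (g : G) (n : ℤ) :
    (MonoidAlgebra.single g n : ZG G) = n • gel g := by
  simp [gel]

/-- induction principle for the group ring -/
theorem ZG.induct {G : Type u} [Group G] {p : ZG G → Prop} (a : ZG G) (h1 : ∀ g, p (gel g))
    (hadd : ∀ x y, p x → p y → p (x + y)) (hneg : ∀ x, p x → p (-x)) : p a := by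
  have h0 : p 0 := by
    have := hadd _ _ (h1 1) (hneg _ (h1 1))
    simpa using this
  have hn : ∀ (g : G) (n : ℕ), p (n • gel g) := by
    intro g n
    induction n with
    | zero => simpa using h0
    | succ n ih => rw [succ_nsmul]; exact hadd _ _ ih (h1 g)
  induction a using MonoidAlgebra.induction_linear with
  | zero => exact h0
  | add x y hx hy => exact hadd x y hx hy
  | single g n =>
    rw [single_eq_zsmul]
    rcases Int.eq_nat_or_neg n with ⟨k, rfl | rfl⟩
    · simpa using hn g k
    · rw [neg_smul]; apply hneg; simpa using hn g k

/-- additive extension of a function on the group -/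
noncomputable def zlift {G : Type u} [Group G] {M : Type v} [AddCommGroup M] (d : G → M) :
    ZG G →+ M :=
  (Finsupp.liftAddHom (fun g => (zmultiplesHom M) (d g))).comp
    (MonoidAlgebra.coeffAddEquiv (R := ℤ) (M := G)).toAddMonoidHom

theorem zlift_gel {G : Type u} [Group G] {M : Type v} [AddCommGroup M] (d : G → M) (g : G) :
    zlift d (gel g) = d g := by
  simp [zlift, gel]

/-- the map `v ↦ Σ v i (x i - 1)` -/
noncomputable def foxMap {G : Type u} [Group G] {ι : Type} [Fintype ι] (x : ι → G) :
    (ι → ZG G) →ₗ[ZG G] ZG G :=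
  Fintype.linearCombination (ZG G) (fun i => gel (x i) - 1)

theorem foxMap_apply {G : Type u} [Group G] {ι : Type} [Fintype ι] (x : ι → G) (v : ι → ZG G) :
    foxMap x v = ∑ i, v i * (gel (x i) - 1) := by
  simp [foxMap, Fintype.linearCombination_apply]

theorem foxMap_single {G : Type u} [Group G] {ι : Type} [Fintype ι] [DecidableEq ι]
    (x : ι → G) (i : ι) : foxMap x (Pi.single i 1) = gel (x i) - 1 := by
  simp [foxMap]

abbrev trivMod (G : Type u) [Group G] := (Representation.trivial ℤ (G := G) (V := ℤ)).asModule

theorem gel_smul_triv {G : Type u} [Group G] (g : G) (v : trivMod G) : gel g • v = v := by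
  rw [gel, Representation.single_smul]
  simp; rfl

noncomputable def augMap (G : Type u) [Group G] : ZG G →ₗ[ZG G] trivMod G :=
  LinearMap.toSpanSingleton (ZG G) (trivMod G)
    ((Representation.trivial ℤ (G := G) (V := ℤ)).asModuleEquiv.symm 1)

theorem augMap_surj (G : Type u) [Group G] : Function.Surjective (augMap G) := by
  intro v
  refine ⟨MonoidAlgebra.single 1 (Representation.asModuleEquiv _ v), ?_⟩
  rw [augMap, LinearMap.toSpanSingleton_apply, Representation.single_smul]
  simp
  rfl

theorem gel_sub_one_mem_range {G : Type u} [Group G] {ι : Type} [Fintype ι] (x : ι → G)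
    (hx : Subgroup.closure (Set.range x) = ⊤) (g : G) :
    gel g - 1 ∈ LinearMap.range (foxMap x) := by
  classical
  have hg : g ∈ Subgroup.closure (Set.range x) := by rw [hx]; trivial
  induction hg using Subgroup.closure_induction with
  | mem y hy => obtain ⟨i, rfl⟩ := hy; exact ⟨_, foxMap_single x i⟩
  | one => simp [gel_one]
  | mul a b _ _ ha hb =>
    have : gel (a * b) - 1 = gel a • (gel b - 1) + (gel a - 1) := by
      simp [gel_mul, mul_sub]
    rw [this]
    exact add_mem (Submodule.smul_mem _ _ hb) ha
  | inv a _ ha =>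
    have : gel a⁻¹ - 1 = -(gel a⁻¹ • (gel a - 1)) := by
      simp [mul_sub, gel_inv_mul]
    rw [this]
    exact neg_mem (Submodule.smul_mem _ _ ha)

theorem range_foxMap {G : Type u} [Group G] {ι : Type} [Fintype ι] (x : ι → G)
    (hx : Subgroup.closure (Set.range x) = ⊤) :
    LinearMap.range (foxMap x) = LinearMap.ker (augMap G) := by
  classical
  apply le_antisymm
  · rintro _ ⟨v, rfl⟩
    rw [LinearMap.mem_ker, foxMap_apply, map_sum]
    apply Finset.sum_eq_zero
    intro i _
    rw [← smul_eq_mul, map_smul, map_sub]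
    have : augMap G (gel (x i)) = augMap G 1 := by
      simp only [augMap, LinearMap.toSpanSingleton_apply, gel_smul_triv, one_smul]
    rw [this]; simp
  · intro a ha
    have key : ∀ a : ZG G, a - (zlift (fun _ => (1 : ℤ)) a) • (1 : ZG G) ∈
        LinearMap.range (foxMap x) := by
      intro a
      induction a using ZG.induct with
      | h1 g => rw [zlift_gel, one_smul]; exact gel_sub_one_mem_range x hx g
      | hadd y z hy hz =>
        have := add_mem hy hz
        rw [map_add, add_smul]; convert this using 1; abel
      | hneg y hy =>
        have := neg_mem hy
        rw [map_neg, neg_smul]; convert this using 1; abel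
    have h0 : ∀ a : ZG G, (Representation.asModuleEquiv _ (augMap G a)) =
        zlift (fun _ => (1 : ℤ)) a := by
      intro a
      induction a using ZG.induct with
      | h1 g =>
        simp only [augMap, LinearMap.toSpanSingleton_apply, gel_smul_triv, zlift_gel]
        simp
      | hadd y z hy hz => rw [map_add, map_add, map_add, hy, hz]
      | hneg y hy => rw [map_neg, map_neg, map_neg, hy]
    have := key a
    rw [← h0 a, LinearMap.mem_ker.1 ha] at this
    simpa using this

theorem fp2_of_relFG {G : Type u} [Group G] {n : ℕ} (x : Fin n → G)
    (hx : Subgroup.closure (Set.range x) = ⊤) (h : (LinearMap.ker (foxMap x)).FG) :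
    Group.IsTypeFP2 G := by
  obtain ⟨m, f, hf⟩ := (Submodule.fg_iff_exists_fin_linearMap _ _).1 h
  refine ⟨ModuleCat.of _ (ZG G), ModuleCat.of _ (Fin n → ZG G), ModuleCat.of _ (Fin m → ZG G),
    f, foxMap x, augMap G, ?_, ?_, ?_, ?_, ?_, ?_, augMap_surj G, range_foxMap x hx, hf⟩
  all_goals dsimp only [ModuleCat.of]; infer_instance

theorem relFG_of_fp2 {G : Type u} [Group G] {ι : Type} [Fintype ι] (x : ι → G)
    (hx : Subgroup.closure (Set.range x) = ⊤) (h : Group.IsTypeFP2 G) :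
    (LinearMap.ker (foxMap x)).FG := by
  obtain ⟨P0, P1, P2, d2, d1, ε, f0, p0, f1, p1, f2, p2, hε, h1, h2⟩ := h
  have fpk : Module.FinitePresentation (ZG G) (LinearMap.ker ε) := by
    have := Module.finitePresentation_of_projective (ZG G) P1
    have hm : ∀ y, d1 y ∈ LinearMap.ker ε := fun y => h1 ▸ ⟨y, rfl⟩
    apply Module.finitePresentation_of_surjective (d1.codRestrict (LinearMap.ker ε) hm)
    · rintro ⟨z, hz⟩
      rw [← h1] at hz
      obtain ⟨y, rfl⟩ := hz
      exact ⟨y, rfl⟩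
    · rw [LinearMap.ker_codRestrict, ← h2, LinearMap.range_eq_map]
      exact Submodule.FG.map _ f2.1
  let X : Submodule (ZG G) (ZG G × P0) :=
    LinearMap.ker ((augMap G).comp (LinearMap.fst _ _ _) - ε.comp (LinearMap.snd _ _ _))
  have hX : ∀ p : ZG G × P0, p ∈ X ↔ augMap G p.1 = ε p.2 := by
    intro p
    simp [X, sub_eq_zero]
  have fpX : Module.FinitePresentation (ZG G) X := by
    let l : X →ₗ[ZG G] ZG G := (LinearMap.fst _ _ _).comp X.subtype
    have hl : Function.Surjective l := by
      intro a
      obtain ⟨p, hp⟩ := hε (augMap G a)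
      exact ⟨⟨(a, p), (hX _).2 hp.symm⟩, rfl⟩
    let e : LinearMap.ker ε ≃ₗ[ZG G] LinearMap.ker l :=
      LinearEquiv.ofBijective
        (LinearMap.codRestrict _ (LinearMap.codRestrict X
          ((LinearMap.inr (ZG G) (ZG G) P0).comp (LinearMap.ker ε).subtype)
          (fun y => (hX _).2 (by simp [LinearMap.mem_ker.1 y.2]))) (fun y => rfl))
        ⟨fun y z h => by
          have := congrArg (fun w => w.1.1.2) h
          exact Subtype.ext this, by
          rintro ⟨⟨⟨a, p⟩, hp⟩, ha⟩
          have ha' : a = 0 := ha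
          subst ha'
          have := (hX _).1 hp
          refine ⟨⟨p, ?_⟩, rfl⟩
          simp at this
          exact this.symm⟩
    have := Module.FinitePresentation.of_equiv (R := ZG G) (M := LinearMap.ker ε) (N := LinearMap.ker l) e
    exact Module.finitePresentation_of_ker l hl
  have fpI : Module.FinitePresentation (ZG G) (LinearMap.ker (augMap G)) := by
    let f : LinearMap.ker (augMap G) →ₗ[ZG G] X := LinearMap.codRestrict X
          ((LinearMap.inl (ZG G) (ZG G) P0).comp (LinearMap.ker (augMap G)).subtype)
          (fun y => (hX _).2 (by simp [LinearMap.mem_ker.1 y.2]))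
    let g : X →ₗ[ZG G] P0 := (LinearMap.snd _ _ _).comp X.subtype
    refine Module.finitePresentation_of_projective_of_exact f g ?_ ?_ ?_
    · intro y z h
      have := congrArg (fun w => w.1.1) h
      exact Subtype.ext this
    · intro p
      obtain ⟨a, ha⟩ := augMap_surj G (ε p)
      exact ⟨⟨(a, p), (hX _).2 ha⟩, rfl⟩
    · rintro ⟨⟨a, p⟩, hp⟩
      constructor
      · intro h
        have h' : p = 0 := h
        subst h'
        have := (hX _).1 hp
        simp at this
        exact ⟨⟨a, this⟩, rfl⟩
      · rintro ⟨y, hy⟩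
        rw [← hy]; rfl
  have hr := range_foxMap x hx
  have := Module.FinitePresentation.fg_ker (N := LinearMap.ker (augMap G))
    ((foxMap x).codRestrict (LinearMap.ker (augMap G)) (fun y => hr ▸ ⟨y, rfl⟩)) (by
      rintro ⟨z, hz⟩
      rw [← hr] at hz
      obtain ⟨y, rfl⟩ := hz
      exact ⟨y, rfl⟩)
  rwa [LinearMap.ker_codRestrict] at this

/-- affine action of a free group -/
noncomputable def foxAct {G : Type u} [Group G] {n : ℕ} (x : Fin n → G) {M : Type u}
    [AddCommGroup M] [Module (ZG G) M] (m : Fin n → M) : FreeGroup (Fin n) →* Equiv.Perm M :=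
  FreeGroup.lift fun i =>
    { toFun := fun z => gel (x i) • z + m i
      invFun := fun z => gel (x i)⁻¹ • (z - m i)
      left_inv := fun z => by simp [← mul_smul, gel_inv_mul]
      right_inv := fun z => by simp [← mul_smul, gel_mul_inv] }

theorem foxAct_apply {G : Type u} [Group G] {n : ℕ} (x : Fin n → G) {M : Type u}
    [AddCommGroup M] [Module (ZG G) M] (m : Fin n → M) (w : FreeGroup (Fin n)) (z : M) :
    foxAct x m w z = gel (FreeGroup.lift x w) • z + foxAct x m w 0 := by
  induction w using FreeGroup.induction_on generalizing z with
  | C1 => simp [gel_one]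
  | of i => simp [foxAct]
  | inv_of i _ => simp [foxAct, sub_eq_add_neg]
  | mul a b ha hb =>
    rw [map_mul, Equiv.Perm.mul_apply, Equiv.Perm.mul_apply, ha, hb, ha (foxAct x m b 0),
      map_mul, gel_mul, mul_smul, smul_add, add_assoc]

theorem foxAct_mul {G : Type u} [Group G] {n : ℕ} (x : Fin n → G) {M : Type u}
    [AddCommGroup M] [Module (ZG G) M] (m : Fin n → M) (a b : FreeGroup (Fin n)) :
    foxAct x m (a * b) 0 = gel (FreeGroup.lift x a) • foxAct x m b 0 + foxAct x m a 0 := by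
  rw [map_mul, Equiv.Perm.mul_apply, foxAct_apply]

theorem foxAct_map {G : Type u} [Group G] {n : ℕ} (x : Fin n → G) {M N : Type u}
    [AddCommGroup M] [Module (ZG G) M] [AddCommGroup N] [Module (ZG G) N] (m : Fin n → M)
    (f : M →ₗ[ZG G] N) (w : FreeGroup (Fin n)) (z : M) :
    f (foxAct x m w z) = foxAct x (fun i => f (m i)) w (f z) := by
  induction w using FreeGroup.induction_on generalizing z with
  | C1 => simp
  | of i => simp [foxAct]
  | inv_of i _ => simp [foxAct]
  | mul a b ha hb => simp [ha, hb]

theorem relFG_of_rels {G : Type u} [Group G] {n : ℕ} (x : Fin n → G)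
    (hs : Function.Surjective (FreeGroup.lift x))
    (R : Set (FreeGroup (Fin n))) (hR : R.Finite)
    (hker : (FreeGroup.lift x).ker = Subgroup.normalClosure R) :
    (LinearMap.ker (foxMap x)).FG := by
  classical
  let e : Fin n → (Fin n → ZG G) := fun i => Pi.single i 1
  let D : FreeGroup (Fin n) → (Fin n → ZG G) := fun w => foxAct x e w 0
  let K : Submodule (ZG G) (Fin n → ZG G) := Submodule.span (ZG G) (D '' R)
  have hD : ∀ w, foxMap x (D w) = gel (FreeGroup.lift x w) - 1 := by
    intro w
    induction w using FreeGroup.induction_on with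
    | C1 => simp [D, gel_one]
    | of i => simp [D, foxAct, e, foxMap_single]
    | inv_of i _ =>
      simp [D, foxAct, e, foxMap_single, mul_sub, gel_inv_mul]
    | mul a b ha hb =>
      simp only [D] at ha hb ⊢
      rw [foxAct_mul, map_add, map_smul, ha, hb, map_mul, gel_mul, smul_eq_mul, mul_sub]; simp
  let M' := (Fin n → ZG G) ⧸ K
  let Φ : FreeGroup (Fin n) →* Equiv.Perm M' := foxAct x (fun i => K.mkQ (e i))
  have hΦ : ∀ w, Φ w 0 = K.mkQ (D w) := by
    intro w
    simp only [D]
    rw [foxAct_map]; simp [Φ]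
  have hR1 : ∀ r ∈ R, FreeGroup.lift x r = 1 := fun r hr => by
    have : r ∈ (FreeGroup.lift x).ker := hker ▸ Subgroup.subset_normalClosure hr
    exact this
  have hkill : ∀ w, FreeGroup.lift x w = 1 → K.mkQ (D w) = 0 := by
    intro w hw
    have h1 : Subgroup.normalClosure R ≤ Φ.ker := by
      apply Subgroup.normalClosure_le_normal
      intro r hr
      change Φ r = 1
      ext z
      change foxAct x _ r z = z
      rw [foxAct_apply, hR1 r hr, gel_one, one_smul]
      change z + Φ r 0 = z
      rw [hΦ, add_eq_left]
      rw [Submodule.mkQ_apply, Submodule.Quotient.mk_eq_zero]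
      exact Submodule.subset_span ⟨r, hr, rfl⟩
    have h2 : Φ w = 1 := h1 (hker ▸ hw)
    rw [← hΦ, h2]; rfl
  have hdep : ∀ v w, FreeGroup.lift x v = FreeGroup.lift x w → K.mkQ (D v) = K.mkQ (D w) := by
    intro v w h
    have h1 : v = w * (w⁻¹ * v) := by group
    have h2 := hkill (w⁻¹ * v) (by simp [h])
    have h3 := foxAct_mul x e w (w⁻¹ * v)
    rw [← h1] at h3
    change D v = _ • D _ + D w at h3
    rw [h3, map_add, map_smul, h2]; simp
  choose s hs' using hs
  let d : G → M' := fun g => K.mkQ (D (s g))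
  have hd : ∀ g i, d (g * x i) = d g + gel g • K.mkQ (e i) := by
    intro g i
    have h1 : d (g * x i) = K.mkQ (D (s g * FreeGroup.of i)) := hdep _ _ (by simp [hs'])
    rw [h1]
    have h3 := foxAct_mul x e (s g) (FreeGroup.of i)
    change D _ = _ • D _ + D _ at h3
    rw [h3, map_add, map_smul, hs', add_comm]
    congr 2
    simp [D, foxAct, e]
  have hψ : ∀ v, zlift d (foxMap x v) = K.mkQ v := by
    intro v
    have hv : v = ∑ i, v i • e i := by
      ext i
      simp [e, Finset.sum_apply, Pi.single_apply]
    rw [foxMap_apply]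
    conv_rhs => rw [hv]
    rw [map_sum, map_sum]
    apply Finset.sum_congr rfl
    intro i _
    generalize v i = a
    induction a using ZG.induct with
    | h1 g =>
      rw [mul_sub, ← gel_mul, map_sub, zlift_gel, mul_one, zlift_gel, hd, map_smul]; abel
    | hadd y z hy hz => rw [add_mul, map_add, hy, hz, add_smul, map_add]
    | hneg y hy => rw [neg_mul, map_neg, hy, neg_smul, map_neg]
  have : LinearMap.ker (foxMap x) = K := by
    apply le_antisymm
    · intro v hv
      have := hψ v
      rw [LinearMap.mem_ker.1 hv, map_zero] at this
      rwa [eq_comm, Submodule.mkQ_apply, Submodule.Quotient.mk_eq_zero] at this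
    · rw [Submodule.span_le]
      rintro _ ⟨r, hr, rfl⟩
      simp [hD, hR1 r hr, gel_one]
  rw [this]
  exact Submodule.fg_span (hR.image _)

theorem fp2_of_fp {G : Type u} [Group G] (h : Group.FinitelyPresented G) : Group.IsTypeFP2 G := by
  obtain ⟨n, R, hR, ⟨e⟩⟩ := h
  let x : Fin n → G := fun i => e (PresentedGroup.of i)
  have hx : FreeGroup.lift x = e.toMonoidHom.comp (PresentedGroup.mk R) := by
    ext i; simp [x, PresentedGroup.of]
  have hs : Function.Surjective (FreeGroup.lift x) := by
    rw [hx]; exact e.surjective.comp (PresentedGroup.mk_surjective R)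
  apply fp2_of_relFG x
  · rw [← FreeGroup.range_lift_eq_closure, MonoidHom.range_eq_top]; exact hs
  · apply relFG_of_rels x hs R hR
    have := MonoidHom.ker_mulEquiv_comp (PresentedGroup.mk R) e
    rw [hx]
    exact this.trans (QuotientGroup.ker_mk' _)

theorem hcoherent_of_coherent {G : Type u} [Group G] (h : Group.IsCoherent G) :
    Group.IsHomologicallyCoherent G := fun H hH => fp2_of_fp (h H hH)

section PartH
variable {G : Type u} [Group G] (H : Subgroup G)

noncomputable def zinc : ZG H →+* ZG G := MonoidAlgebra.mapDomainRingHom ℤ H.subtype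

theorem zinc_gel (h : H) : zinc H (gel h) = gel (h : G) := by
  simp [zinc, gel]

open Classical in
noncomputable def zres : ZG G →+ ZG H :=
  zlift (fun g => if h : g ∈ H then gel (⟨g, h⟩ : H) else 0)

theorem zres_gel_mem {g : G} (h : g ∈ H) : zres H (gel g) = gel (⟨g, h⟩ : H) := by
  rw [zres, zlift_gel, dif_pos h]

theorem zres_gel_notMem {g : G} (h : g ∉ H) : zres H (gel g) = 0 := by
  rw [zres, zlift_gel, dif_neg h]

theorem zres_mul (a : ZG G) (b : ZG H) : zres H (a * zinc H b) = zres H a * b := by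
  induction a using ZG.induct with
  | hadd y z hy hz => rw [add_mul, map_add, hy, hz, map_add, add_mul]
  | hneg y hy => rw [neg_mul, map_neg, hy, map_neg, neg_mul]
  | h1 g =>
    induction b using ZG.induct with
    | hadd y z hy hz => rw [map_add, mul_add, map_add, hy, hz, mul_add]
    | hneg y hy => rw [map_neg, mul_neg, map_neg, hy, mul_neg]
    | h1 h =>
      rw [zinc_gel, ← gel_mul]
      by_cases hg : g ∈ H
      · rw [zres_gel_mem H hg, zres_gel_mem H (mul_mem hg h.2), ← gel_mul]; rfl
      · rw [zres_gel_notMem H hg, zres_gel_notMem, zero_mul]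
        intro h'
        exact hg ((Subgroup.mul_mem_cancel_right H h.2).1 h')

theorem zres_zinc (b : ZG H) : zres H (zinc H b) = b := by
  have := zres_mul H 1 b
  rw [one_mul] at this
  rw [this, ← gel_one, zres_gel_mem H (one_mem H)]
  exact one_mul b

theorem zdecomp (a : ZG G) : ∃ S0 : Finset (G ⧸ H), ∀ S, S0 ⊆ S →
    a = ∑ q ∈ S, gel q.out * zinc H (zres H (gel (q.out)⁻¹ * a)) := by
  classical
  induction a using ZG.induct with
  | hadd y z hy hz =>
    obtain ⟨S1, h1⟩ := hy
    obtain ⟨S2, h2⟩ := hz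
    refine ⟨S1 ∪ S2, fun S hS => ?_⟩
    conv_lhs => rw [h1 S (Finset.union_subset_left hS), h2 S (Finset.union_subset_right hS)]
    rw [← Finset.sum_add_distrib]
    simp only [mul_add, map_add]
  | hneg y hy =>
    obtain ⟨S1, h1⟩ := hy
    refine ⟨S1, fun S hS => ?_⟩
    conv_lhs => rw [h1 S hS]
    rw [← Finset.sum_neg_distrib]
    simp only [mul_neg, map_neg]
  | h1 g =>
    refine ⟨{(g : G ⧸ H)}, fun S hS => ?_⟩
    rw [Finset.sum_eq_single (g : G ⧸ H)]
    · have hm : (Quotient.out (g : G ⧸ H))⁻¹ * g ∈ H := by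
        rw [← QuotientGroup.eq]; simp
      rw [← gel_mul, zres_gel_mem H hm, zinc_gel, ← gel_mul]; simp
    · intro q _ hq
      rw [← gel_mul, zres_gel_notMem]
      · simp
      · rw [← QuotientGroup.eq]
        intro h
        apply hq
        rw [← h]; simp
    · intro h; exact absurd (hS (by simp)) h

theorem relFG_of_ringCoherent (h : Ring.IsCoherent (ZG G)) {n : ℕ} (x : Fin n → H) :
    (LinearMap.ker (foxMap x)).FG := by
  classical
  let y : Fin n → G := fun i => x i
  have hK : (LinearMap.ker (foxMap y)).FG := by
    have h1 : (LinearMap.range (foxMap y)).FG := by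
      rw [LinearMap.range_eq_map]; exact Submodule.FG.map _ Module.Finite.fg_top
    have := h _ h1
    have := Module.FinitePresentation.fg_ker (foxMap y).rangeRestrict
      (LinearMap.surjective_rangeRestrict _)
    rwa [LinearMap.ker_rangeRestrict] at this
  let I : (Fin n → ZG H) → (Fin n → ZG G) := fun w i => zinc H (w i)
  let P : (Fin n → ZG G) → (Fin n → ZG H) := fun w i => zres H (w i)
  have hPf : ∀ v, foxMap x (P v) = zres H (foxMap y v) := by
    intro v
    rw [foxMap_apply, foxMap_apply, map_sum]
    apply Finset.sum_congr rfl
    intro i _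
    rw [← zres_mul, map_sub, zinc_gel, map_one]
  have hIf : ∀ w, foxMap y (I w) = zinc H (foxMap x w) := by
    intro v
    rw [foxMap_apply, foxMap_apply, map_sum]
    apply Finset.sum_congr rfl
    intro i _
    rw [map_mul, map_sub, zinc_gel, map_one]
  have hspan : LinearMap.ker (foxMap y) =
      Submodule.span (ZG G) (I '' (LinearMap.ker (foxMap x) : Set (Fin n → ZG H))) := by
    apply le_antisymm
    · intro v hv
      choose S hS using fun i => zdecomp H (v i)
      have hv' : v = ∑ q ∈ Finset.univ.biUnion S, gel q.out • I (P (gel (q.out)⁻¹ • v)) := by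
        ext1 i
        conv_lhs => rw [hS i (Finset.univ.biUnion S) (Finset.subset_biUnion_of_mem S (Finset.mem_univ i))]
        simp [Finset.sum_apply, I, P]
      rw [hv']
      apply sum_mem
      intro q _
      apply Submodule.smul_mem
      apply Submodule.subset_span
      refine ⟨_, ?_, rfl⟩
      rw [SetLike.mem_coe, LinearMap.mem_ker, hPf, map_smul, LinearMap.mem_ker.1 hv]
      simp
    · rw [Submodule.span_le]
      rintro _ ⟨w, hw, rfl⟩
      rw [SetLike.mem_coe, LinearMap.mem_ker, hIf, LinearMap.mem_ker.1 hw, map_zero]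
  rw [hspan, Submodule.fg_span_iff_fg_span_finset_subset] at hK
  obtain ⟨T, hT, hTs⟩ := hK
  refine ⟨T.image P, ?_⟩
  apply le_antisymm
  · rw [Submodule.span_le]
    intro w hw
    simp only [Finset.coe_image, Set.mem_image, Finset.mem_coe] at hw
    obtain ⟨t, ht, rfl⟩ := hw
    obtain ⟨w, hw, rfl⟩ := hT ht
    have : P (I w) = w := by ext1 i; simp [P, I, zres_zinc]
    rwa [this]
  · intro w hw
    have hIw : I w ∈ Submodule.span (ZG G) (T : Set (Fin n → ZG G)) := by
      rw [← hTs]; exact Submodule.subset_span ⟨w, hw, rfl⟩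
    have key : ∀ u ∈ Submodule.span (ZG G) (T : Set (Fin n → ZG G)), ∀ a : ZG G,
        P (a • u) ∈ Submodule.span (ZG H) ((T.image P : Finset _) : Set (Fin n → ZG H)) := by
      intro u hu
      induction hu using Submodule.span_induction with
      | mem t ht =>
        intro a
        obtain ⟨w, hw, rfl⟩ := hT ht
        have h1 : P (a • I w) = zres H a • P (I w) := by
          ext1 i
          simp [P, I, zres_mul, zres_zinc]
        rw [h1]
        apply Submodule.smul_mem
        apply Submodule.subset_span
        simp only [Finset.coe_image]
        exact ⟨_, ht, rfl⟩
      | zero =>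
        intro a
        have : P (a • 0) = 0 := by ext1 i; simp [P]
        rw [this]; exact zero_mem _
      | add u v _ _ hu hv =>
        intro a
        have : P (a • (u + v)) = P (a • u) + P (a • v) := by ext1 i; simp [P, mul_add]
        rw [this]; exact add_mem (hu a) (hv a)
      | smul b u _ hu =>
        intro a
        rw [← mul_smul]; exact hu _
    have := key _ hIw 1
    have h1 : P ((1 : ZG G) • I w) = w := by ext1 i; simp [P, I, zres_zinc]
    rwa [h1] at this
end PartH

theorem exists_gen_fin {G : Type u} [Group G] (h : Group.FG G) :
    ∃ (n : ℕ) (x : Fin n → G), Subgroup.closure (Set.range x) = ⊤ := by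
  obtain ⟨S, hS⟩ := h.1
  refine ⟨S.card, fun i => S.equivFin.symm i, ?_⟩
  rw [← hS]
  congr 1
  ext g
  constructor
  · rintro ⟨i, rfl⟩; exact (S.equivFin.symm i).2
  · intro hg; exact ⟨S.equivFin ⟨g, hg⟩, by simp⟩

theorem hcoherent_of_ringCoherent {G : Type u} [Group G]
    (h : Ring.IsCoherent (MonoidAlgebra ℤ G)) : Group.IsHomologicallyCoherent G := by
  intro H hH
  obtain ⟨n, x, hx⟩ := exists_gen_fin hH
  exact fp2_of_relFG x hx (relFG_of_ringCoherent H h x)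

/-- no noncommutative free subgroups -/
def NoFree (G : Type u) [Group G] : Prop :=
  ∀ (F : Type u) [Group F] [IsFreeGroup F] (f : F →* G), Function.Injective f →
    ∀ a b : F, a * b = b * a

theorem subsingleton_of_freeGroup_comm {X : Type u} (h : ∀ a b : FreeGroup X, a * b = b * a) :
    Subsingleton X := by
  classical
  refine ⟨fun x y => ?_⟩
  by_contra hxy
  have h1 := h (FreeGroup.of x) (FreeGroup.of y)
  let f : FreeGroup X →* Equiv.Perm (Fin 3) := FreeGroup.lift fun z =>
    if z = x then Equiv.swap 0 1 else Equiv.swap 1 2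
  have h2 := congrArg f h1
  simp only [map_mul, f, FreeGroup.lift_apply_of, if_true, if_neg (Ne.symm hxy)] at h2
  exact absurd h2 (by decide)

theorem freeGroup_isCyclic_of_comm {X : Type u} (h : ∀ a b : FreeGroup X, a * b = b * a) :
    IsCyclic (FreeGroup X) := by
  classical
  have hs := subsingleton_of_freeGroup_comm h
  rcases isEmpty_or_nonempty X with hX | ⟨⟨x⟩⟩
  · infer_instance
  · have : ∀ z : FreeGroup X, z ∈ Subgroup.zpowers (FreeGroup.of x) := by
      intro z
      induction z using FreeGroup.induction_on with
      | C1 => exact one_mem _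
      | of y => rw [Subsingleton.elim y x]; exact Subgroup.mem_zpowers _
      | inv_of y hy => exact inv_mem hy
      | mul a b ha hb => exact mul_mem ha hb
    exact ⟨⟨FreeGroup.of x, this⟩⟩

theorem isCyclic_of_free_comm {F : Type u} [Group F] [IsFreeGroup F]
    (h : ∀ a b : F, a * b = b * a) : IsCyclic F := by
  let e := IsFreeGroup.toFreeGroup F
  have : IsCyclic (FreeGroup (IsFreeGroup.Generators F)) := by
    apply freeGroup_isCyclic_of_comm
    intro a b
    apply e.symm.injective
    simp [h (e.symm a)]
  exact isCyclic_of_surjective e.symm e.symm.surjective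

theorem free_torsionFree (F : Type u) [Group F] [IsFreeGroup F] : IsMulTorsionFree F :=
  (IsFreeGroup.toFreeGroup F).injective.isMulTorsionFree (IsFreeGroup.toFreeGroup F).toMonoidHom

theorem exists_pow_of_commute {F : Type u} [Group F] [IsFreeGroup F] (x y : F)
    (h : x * y = y * x) : ∃ m n : ℤ, (m ≠ 0 ∨ n ≠ 0) ∧ x ^ m = y ^ n := by
  let H := Subgroup.closure ({x, y} : Set F)
  have hc : ∀ a b : H, a * b = b * a := by
    have : ∀ x' ∈ ({x, y} : Set F), ∀ y' ∈ ({x, y} : Set F), x' * y' = y' * x' := by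
      rintro a (rfl | rfl) b (rfl | rfl) <;> simp [h]
    have := Subgroup.isMulCommutative_closure this
    exact fun a b => this.1.comm a b
  have : IsCyclic H := isCyclic_of_free_comm hc
  obtain ⟨g, hg⟩ := this.exists_generator
  obtain ⟨i, hi⟩ := hg ⟨x, Subgroup.subset_closure (by simp)⟩
  obtain ⟨j, hj⟩ := hg ⟨y, Subgroup.subset_closure (by simp)⟩
  have hi' : (g : F) ^ i = x := by simpa using congrArg Subtype.val hi
  have hj' : (g : F) ^ j = y := by simpa using congrArg Subtype.val hj
  by_cases h0 : i = 0 ∧ j = 0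
  · refine ⟨1, 0, by simp, ?_⟩
    rw [← hi', h0.1]; simp
  · refine ⟨j, i, by omega, ?_⟩
    rw [← hi', ← hj', ← zpow_mul, ← zpow_mul, mul_comm]

theorem free_comm_of_normal {F : Type u} [Group F] [IsFreeGroup F] (A : Subgroup F) [A.Normal]
    (hA : ∀ a b : A, a * b = b * a) (hne : A ≠ ⊥) : ∀ a b : F, a * b = b * a := by
  classical
  have htf := free_torsionFree F
  have hcy : IsCyclic A := isCyclic_of_free_comm hA
  obtain ⟨⟨w, hwA⟩, hw⟩ := hcy.exists_generator
  have hw' : ∀ a ∈ A, ∃ k : ℤ, w ^ k = a := fun a ha => by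
    obtain ⟨k, hk⟩ := hw ⟨a, ha⟩
    exact ⟨k, by simpa using congrArg Subtype.val hk⟩
  have hw1 : w ≠ 1 := by
    rintro rfl
    apply hne
    rw [Subgroup.eq_bot_iff_forall]
    intro x hx
    obtain ⟨k, hk⟩ := hw' x hx
    simpa using hk.symm
  have zinj : ∀ {x : F}, x ≠ 1 → ∀ {k : ℤ}, x ^ k = 1 → k = 0 := by
    intro x hx k hk
    by_contra hk0
    have h1 : x ^ k.natAbs = 1 := by
      rcases Int.natAbs_eq k with h | h
      · rw [h] at hk; simpa using hk
      · rw [h] at hk; simpa using hk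
    exact hx ((pow_eq_one_iff_left (by omega)).1 h1)
  -- squares commute with w
  have hsq : ∀ s : F, w * s ^ 2 = s ^ 2 * w := by
    intro s
    obtain ⟨k, hk⟩ := hw' (s * w * s⁻¹) (‹A.Normal›.conj_mem w hwA s)
    obtain ⟨l, hl⟩ := hw' (s⁻¹ * w * s⁻¹⁻¹) (‹A.Normal›.conj_mem w hwA s⁻¹)
    have h1 : w ^ (k * l) = w := by
      rw [zpow_mul, hk, conj_zpow, hl]; group
    have h2 : k * l = 1 := by
      have : w ^ (k * l - 1) = 1 := by rw [zpow_sub_one, h1]; simp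
      have := zinj hw1 this
      omega
    have h3 : k * k = 1 := by
      rcases Int.eq_one_or_neg_one_of_mul_eq_one h2 with h | h <;> simp [h]
    have h4 : s * (s * w * s⁻¹) * s⁻¹ = w := by
      rw [← hk, ← conj_zpow, ← hk, ← zpow_mul, h3, zpow_one]
    calc w * s ^ 2 = (s * (s * w * s⁻¹) * s⁻¹) * s ^ 2 := by rw [h4]
      _ = s ^ 2 * w := by simp [pow_two, mul_assoc]
  have hs : Subsingleton (IsFreeGroup.Generators F) := by
    refine ⟨fun x y => ?_⟩
    by_contra hxy
    obtain ⟨m, n, hmn, h1⟩ := exists_pow_of_commute w ((IsFreeGroup.of x) ^ 2) (hsq _)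
    obtain ⟨m', n', hmn', h2⟩ := exists_pow_of_commute w ((IsFreeGroup.of y) ^ 2) (hsq _)
    let f : F →* Multiplicative ℤ := IsFreeGroup.lift fun z =>
      if z = x then Multiplicative.ofAdd 1 else 1
    let g : F →* Multiplicative ℤ := IsFreeGroup.lift fun z =>
      if z = y then Multiplicative.ofAdd 1 else 1
    have hfx : f (IsFreeGroup.of x) = Multiplicative.ofAdd 1 := by simp [f]
    have hfy : f (IsFreeGroup.of y) = 1 := by simp [f, Ne.symm hxy]
    have hgx : g (IsFreeGroup.of x) = 1 := by simp [g, hxy]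
    have hgy : g (IsFreeGroup.of y) = Multiplicative.ofAdd 1 := by simp [g]
    have e1 := congrArg f h1
    have e2 := congrArg f h2
    have e3 := congrArg g h1
    have e4 := congrArg g h2
    simp only [map_zpow, map_pow, hfx, hfy, hgx, hgy] at e1 e2 e3 e4
    have e1' := congrArg Multiplicative.toAdd e1
    have e2' := congrArg Multiplicative.toAdd e2
    simp at e1' e2'
    -- f w * m = 2 n ; f w * m' = 0
    have hm' : m' ≠ 0 := by
      intro h0
      rw [h0, zpow_zero] at e4
      have e4' := congrArg Multiplicative.toAdd e4
      simp at e4'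
      omega
    have hm : m ≠ 0 := by
      intro h0
      rw [h0] at e1'
      simp at e1'
      omega
    have : Multiplicative.toAdd (f w) = 0 := by
      rcases e2' with h | h
      · exact absurd h hm'
      · simpa using h
    simp [this] at e1'
    rw [e1', zpow_zero] at h1
    exact hm (zinj hw1 h1)
  have hcF : ∀ a b : FreeGroup (IsFreeGroup.Generators F), a * b = b * a := by
    rcases isEmpty_or_nonempty (IsFreeGroup.Generators F) with hX | ⟨⟨x⟩⟩
    · intro a b; exact Subsingleton.elim _ _
    · have : ∀ z : FreeGroup (IsFreeGroup.Generators F), z ∈ Subgroup.zpowers (FreeGroup.of x) := by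
        intro z
        induction z using FreeGroup.induction_on with
        | C1 => exact one_mem _
        | of y => rw [Subsingleton.elim y x]; exact Subgroup.mem_zpowers _
        | inv_of y hy => exact inv_mem hy
        | mul a b ha hb => exact mul_mem ha hb
      intro a b
      obtain ⟨i, hi⟩ := this a
      obtain ⟨j, hj⟩ := this b
      simp only at hi hj
      rw [← hi, ← hj, ← zpow_add, ← zpow_add, add_comm]
  intro a b
  apply (IsFreeGroup.toFreeGroup F).injective
  rw [map_mul, map_mul, hcF]

theorem NoFree.of_injective {G H : Type u} [Group G] [Group H] (hH : NoFree H) (f : G →* H)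
    (hf : Function.Injective f) : NoFree G := fun F _ _ g hg =>
  hH F (f.comp g) (hf.comp hg)

theorem NoFree.of_elementaryAmenable {G : Type u} [Group G] (h : ElementaryAmenable G) :
    NoFree G := by
  induction h with
  | of_finite G h =>
    intro F _ _ f hf
    have : Finite F := Finite.of_injective f hf
    have htf := free_torsionFree F
    intro a b
    have : ∀ x : F, x = 1 := by
      intro x
      have h1 : x ^ Nat.card F = 1 := pow_card_eq_one'
      exact (pow_eq_one_iff_left (Nat.card_pos.ne')).1 h1
    rw [this a, this b]
  | of_comm G h =>
    intro F _ _ f hf a b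
    apply hf; simp [h (f a)]
  | of_mulEquiv G H e h ih => exact ih.of_injective e.symm.toMonoidHom e.symm.injective
  | of_extension G N hN h1 h2 ih1 ih2 =>
    intro F _ _ f hf
    let A := N.comap f
    by_cases hA : A = ⊥
    · apply ih2 F ((QuotientGroup.mk' N).comp f)
      rw [← MonoidHom.ker_eq_bot_iff, ← MonoidHom.comap_ker, QuotientGroup.ker_mk']
      exact hA
    · apply free_comm_of_normal A _ hA
      let g : A →* N := (f.comp A.subtype).codRestrict N (fun x => x.2)
      apply ih1 A g
      intro x y hxy
      apply Subtype.ext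
      apply hf
      exact congrArg Subtype.val hxy
  | of_directedUnion G ι S hdir hcov h ih =>
    intro F _ _ f hf a b
    obtain ⟨i, hi⟩ := hcov (f a)
    obtain ⟨j, hj⟩ := hcov (f b)
    obtain ⟨k, hik, hjk⟩ := hdir i j
    let A := (S k).comap f
    let g : A →* S k := (f.comp A.subtype).codRestrict (S k) (fun x => x.2)
    have := ih k A g (by
      intro x y hxy
      apply Subtype.ext
      apply hf
      exact congrArg Subtype.val hxy) ⟨a, hik hi⟩ ⟨b, hjk hj⟩
    exact congrArg Subtype.val this

open Classical in
theorem pingpong_bs {G : Type u} [Group G] (hG : NoFree G) (B : Subgroup G) (t : G)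
    (hgen : Subgroup.closure ((B : Set G) ∪ {t}) = ⊤)
    (A' : Subgroup G) (hA' : ∀ a, a ∈ A' ↔ a ∈ B ∧ t⁻¹ * a * t ∈ B)
    (D : G → G → ℤ) (hmul : ∀ g g' h, D (g * g') h = D g h + D g' (g⁻¹ * h))
    (hDt : ∀ h, D t h = if h ∈ A' then 1 else 0) (hDB : ∀ b ∈ B, ∀ h, D b h = 0) :
    (∀ b ∈ B, t * b * t⁻¹ ∈ B) ∨ (∀ b ∈ B, t⁻¹ * b * t ∈ B) := by
  have htB : t ∉ B := by
    intro h
    have h1 := hDB t h 1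
    rw [hDt, if_pos (one_mem _)] at h1
    exact one_ne_zero h1
  have hti : ∀ h, D t⁻¹ h = if t * h ∈ A' then -1 else 0 := by
    intro h
    have h1 := hmul t t⁻¹ (t * h)
    rw [mul_inv_cancel, hDB 1 (one_mem _), hDt] at h1
    simp only [inv_mul_cancel_left] at h1
    split_ifs at h1 ⊢ <;> omega
  let Adj : G → Prop := fun h => h ∈ B ∨ h * t ∈ B
  have adj_mul : ∀ g h, g⁻¹ * h ∈ A' → Adj h → g ∈ B ∨ g * t ∈ B := by
    intro g h hgh hh
    obtain ⟨h1, h2⟩ := (hA' _).1 hgh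
    rcases hh with hh | hh
    · left
      have := B.mul_mem hh (B.inv_mem h1)
      simpa using this
    · right
      have := B.mul_mem hh (B.inv_mem h2)
      convert this using 1; group
  have tr : ∀ {g h h' : G}, g⁻¹ * h ∈ A' → g⁻¹ * h' ∈ A' → h⁻¹ * h' ∈ A' := by
    intro g h h' h1 h2
    have := A'.mul_mem (A'.inv_mem h1) h2
    convert this using 1; group
  have U : ∀ g h h', Adj h → Adj h' → D g h ≠ 0 → D g h' ≠ 0 → h⁻¹ * h' ∈ A' := by
    intro g
    have hg : g ∈ Subgroup.closure ((B : Set G) ∪ {t}) := by rw [hgen]; trivial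
    induction hg using Subgroup.closure_induction_right with
    | one => intro h h' _ _ h1; exact absurd (hDB 1 (one_mem _) h) h1
    | mul_right g _ y hy ih =>
      intro h h' ah ah' e1 e2
      rcases hy with hy | hy
      · rw [hmul, hDB y hy, add_zero] at e1 e2
        exact ih h h' ah ah' e1 e2
      · obtain rfl : y = t := hy
        rw [hmul, hDt] at e1 e2
        have hc : ∀ k, Adj k → g⁻¹ * k ∈ A' → g ∈ B := by
          intro k hk hgk
          rcases adj_mul g k hgk hk with h1 | h1
          · exact h1
          · have h2 := hDB _ h1 h
            rw [hmul, hDt] at h2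
            exact absurd h2 e1
        by_cases c1 : g⁻¹ * h ∈ A'
        · have hgB := hc h ah c1
          rw [hDB g hgB] at e2
          have c2 : g⁻¹ * h' ∈ A' := by by_contra hcc; simp [hcc] at e2
          exact tr c1 c2
        · by_cases c2 : g⁻¹ * h' ∈ A'
          · have hgB := hc h' ah' c2
            rw [hDB g hgB] at e1
            simp [c1] at e1
          · simp only [c1, c2, if_false, add_zero] at e1 e2
            exact ih h h' ah ah' e1 e2
    | mul_inv_cancel g _ y hy ih =>
      intro h h' ah ah' e1 e2
      rcases hy with hy | hy
      · rw [hmul, hDB y⁻¹ (B.inv_mem hy), add_zero] at e1 e2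
        exact ih h h' ah ah' e1 e2
      · obtain rfl : y = t := hy
        have e0 := e1
        rw [hmul, hti] at e1 e2
        have hc : ∀ k, Adj k → y * (g⁻¹ * k) ∈ A' → g ∈ B := by
          intro k hk hgk
          rcases adj_mul (g * y⁻¹) k (by simpa [mul_assoc] using hgk) hk with h1 | h1
          · exact absurd (hDB _ h1 h) e0
          · simpa using h1
        by_cases c1 : y * (g⁻¹ * h) ∈ A'
        · have hgB := hc h ah c1
          rw [hDB g hgB] at e2
          have c2 : y * (g⁻¹ * h') ∈ A' := by by_contra hcc; simp [hcc] at e2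
          apply tr (g := g * y⁻¹) <;> simpa [mul_assoc]
        · by_cases c2 : y * (g⁻¹ * h') ∈ A'
          · have hgB := hc h' ah' c2
            rw [hDB g hgB] at e1
            simp [c1] at e1
          · simp only [c1, c2, if_false, add_zero] at e1 e2
            exact ih h h' ah ah' e1 e2
  by_contra hcon
  push Not at hcon
  obtain ⟨⟨b2, hb2, hb2'⟩, ⟨b1, hb1, hb1'⟩⟩ := hcon
  obtain ⟨c, hc, hc1, hc2⟩ : ∃ c ∈ B, t * c * t⁻¹ ∉ B ∧ t⁻¹ * c * t ∉ B := by
    by_cases h1 : t * b1 * t⁻¹ ∈ B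
    · by_cases h2 : t⁻¹ * b2 * t ∈ B
      · refine ⟨b1 * b2, mul_mem hb1 hb2, fun h => hb2' ?_, fun h => hb1' ?_⟩
        · have := mul_mem (inv_mem h1) h
          convert this using 1; group
        · have := mul_mem h (inv_mem h2)
          convert this using 1; group
      · exact ⟨b2, hb2, hb2', h2⟩
    · exact ⟨b1, hb1, h1, hb1'⟩
  let ι := ULift.{u} Bool
  let k : ι → G := fun i => if i.down then c else 1
  have hk : ∀ i, k i ∈ B := by intro i; dsimp [k]; split_ifs; exacts [hc, one_mem _]
  have hDk : ∀ i g h, D ((k i)⁻¹ * g) h = D g (k i * h) := by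
    intro i g h
    rw [hmul, hDB _ (inv_mem (hk i))]; simp
  have hDk' : ∀ i g h, D (k i * g) (k i * h) = D g h := by
    intro i g h
    rw [hmul, hDB _ (hk i)]; simp
  let a : ι → G := fun i => k i * t * (k i)⁻¹
  let X : ι → Set G := fun i => {g | D g (k i) ≠ 0}
  let Y : ι → Set G := fun i => {g | D g (k i * t⁻¹) ≠ 0}
  have hXA : ∀ i, Adj (k i) := fun i => Or.inl (hk i)
  have hYA : ∀ i, Adj (k i * t⁻¹) := fun i => Or.inr (by simpa using hk i)
  have hne : ∀ i j, i ≠ j → (k i = c ∧ k j = 1) ∨ (k i = 1 ∧ k j = c) := by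
    rintro ⟨i⟩ ⟨j⟩ hij
    have : i ≠ j := fun h => hij (by rw [h])
    cases i <;> cases j <;> simp_all [k]
  have hcA : c ∉ A' := fun h => hc2 ((hA' _).1 h).2
  have hinj : Function.Injective (FreeGroup.lift a) := by
    apply FreeGroup.injective_lift_of_ping_pong a X Y
    · intro i
      refine ⟨k i * t, ?_⟩
      change D _ _ ≠ 0
      have := hDk' i t 1
      rw [mul_one] at this
      rw [this, hDt, if_pos (one_mem _)]; exact one_ne_zero
    · intro i j hij
      refine Set.disjoint_left.2 fun g h1 h2 => hcA ?_
      have := U g _ _ (hXA i) (hXA j) h1 h2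
      rcases hne i j hij with ⟨e1, e2⟩ | ⟨e1, e2⟩
      · rw [e1, e2, mul_one] at this; simpa using inv_mem this
      · rw [e1, e2] at this; simpa using this
    · intro i j hij
      refine Set.disjoint_left.2 fun g h1 h2 => hc1 ?_
      have := ((hA' _).1 (U g _ _ (hYA i) (hYA j) h1 h2)).1
      rcases hne i j hij with ⟨e1, e2⟩ | ⟨e1, e2⟩
      · rw [e1, e2] at this
        have := inv_mem this
        convert this using 1; group
      · rw [e1, e2] at this
        convert this using 1; group
    · intro i j
      refine Set.disjoint_left.2 fun g h1 h2 => htB ?_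
      have := ((hA' _).1 (U g _ _ (hXA i) (hYA j) h1 h2)).1
      have h3 := mul_mem (mul_mem (inv_mem this) (inv_mem (hk i))) (hk j)
      convert h3 using 1; group
    · rintro i _ ⟨g, hg, rfl⟩
      have hg' : D g (k i * t⁻¹) = 0 := by by_contra h; exact hg h
      change D (k i * t * (k i)⁻¹ * g) (k i) ≠ 0
      have h1 := hDk' i (t * ((k i)⁻¹ * g)) 1
      rw [mul_one] at h1
      rw [mul_assoc, mul_assoc, h1, hmul, hDk, mul_one, hg', hDt, if_pos (one_mem _)]
      simp
    · rintro i _ ⟨g, hg, rfl⟩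
      have hg' : D g (k i) = 0 := by by_contra h; exact hg h
      change D ((k i * t * (k i)⁻¹)⁻¹ * g) (k i * t⁻¹) ≠ 0
      have h0 : (k i * t * (k i)⁻¹)⁻¹ * g = k i * (t⁻¹ * ((k i)⁻¹ * g)) := by group
      rw [h0, hDk', hmul, hDk, hti]
      simp [hg']
  have hcomm := hG (FreeGroup ι) (FreeGroup.lift a) hinj
  have := subsingleton_of_freeGroup_comm hcomm
  have := congrArg ULift.down (Subsingleton.elim (⟨true⟩ : ι) ⟨false⟩)
  simp at this

section BS
variable {G : Type u} [Group G] {ι : Type} (x : ι → G) (t : G)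

/-- the group generated by conjugates of `x` by small powers of `t` -/
def BSB (n : ℕ) : Subgroup G :=
  Subgroup.closure {g | ∃ (i : ℤ) (j : ι), i.natAbs ≤ n ∧ g = t ^ i * x j * (t ^ i)⁻¹}

theorem BSB_mono {n m : ℕ} (h : n ≤ m) : BSB x t n ≤ BSB x t m := by
  apply Subgroup.closure_mono
  rintro g ⟨i, j, hi, rfl⟩
  exact ⟨i, j, hi.trans h, rfl⟩

theorem BSB_fg [Finite ι] (n : ℕ) : (BSB x t n).FG := by
  rw [BSB]
  refine Subgroup.fg_iff _ |>.2 ⟨_, rfl, ?_⟩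
  have : Set.Finite (Set.image2 (fun (i : ℤ) (j : ι) => t ^ i * x j * (t ^ i)⁻¹)
      (Set.Icc (-(n : ℤ)) n) Set.univ) := Set.Finite.image2 _ (Set.finite_Icc _ _) Set.finite_univ
  refine this.subset ?_
  rintro g ⟨i, j, hi, rfl⟩
  refine ⟨i, ⟨by omega, by omega⟩, j, trivial, rfl⟩

theorem BSB_conj (n : ℕ) (k : ℤ) {b : G} (hb : b ∈ BSB x t n) :
    t ^ k * b * (t ^ k)⁻¹ ∈ BSB x t (n + k.natAbs) := by
  have h : BSB x t n ≤ (BSB x t (n + k.natAbs)).comap (MulAut.conj (t ^ k)).toMonoidHom := by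
    rw [BSB, Subgroup.closure_le]
    rintro g ⟨i, j, hi, rfl⟩
    refine Subgroup.subset_closure ⟨k + i, j, by omega, ?_⟩
    change t ^ k * _ * (t ^ k)⁻¹ = _
    simp [zpow_add, mul_assoc]
  exact h hb

theorem BSB_exhaust (χ : G →* Multiplicative ℤ) (ht : χ t = Multiplicative.ofAdd 1)
    (hx : ∀ j, χ (x j) = 1) (hgen : Subgroup.closure (Set.range x ∪ {t}) = ⊤) (g : G) :
    ∃ n, g * (t ^ (χ g).toAdd)⁻¹ ∈ BSB x t n := by
  have hg : g ∈ Subgroup.closure (Set.range x ∪ {t}) := by rw [hgen]; trivial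
  induction hg using Subgroup.closure_induction with
  | mem y hy =>
    rcases hy with ⟨j, rfl⟩ | hy
    · refine ⟨0, Subgroup.subset_closure ⟨0, j, by simp, by simp [hx]⟩⟩
    · obtain rfl : y = t := hy
      exact ⟨0, by simp [ht, one_mem]⟩
  | one => exact ⟨0, by simp [one_mem]⟩
  | mul a b _ _ ha hb =>
    obtain ⟨n, hn⟩ := ha
    obtain ⟨m, hm⟩ := hb
    refine ⟨max n (m + (χ a).toAdd.natAbs), ?_⟩
    have h1 := BSB_mono x t (le_max_left n (m + (χ a).toAdd.natAbs)) hn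
    have h2 := BSB_mono x t (le_max_right n (m + (χ a).toAdd.natAbs))
      (BSB_conj x t m (χ a).toAdd hm)
    have := mul_mem h1 h2
    convert this using 1
    rw [map_mul, toAdd_mul, zpow_add]; group
  | inv a _ ha =>
    obtain ⟨n, hn⟩ := ha
    refine ⟨n + (-(χ a).toAdd).natAbs, ?_⟩
    have := BSB_conj x t n (-(χ a).toAdd) (inv_mem hn)
    convert this using 1
    rw [map_inv, toAdd_inv]; group

/-- edge groups -/
def BSA (n : ℕ) : Subgroup G := BSB x t n ⊓ (BSB x t n).comap (MulAut.conj t⁻¹).toMonoidHom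

theorem mem_BSA (n : ℕ) (a : G) : a ∈ BSA x t n ↔ a ∈ BSB x t n ∧ t⁻¹ * a * t ∈ BSB x t n := by
  simp [BSA]

theorem BSA_exhaust (χ : G →* Multiplicative ℤ) (ht : χ t = Multiplicative.ofAdd 1)
    (hx : ∀ j, χ (x j) = 1) (hgen : Subgroup.closure (Set.range x ∪ {t}) = ⊤) (g : G)
    (hg : χ g = 1) : ∃ n0, ∀ n, n0 ≤ n → g ∈ BSA x t n := by
  obtain ⟨n, hn⟩ := BSB_exhaust x t χ ht hx hgen g
  rw [hg, toAdd_one, zpow_zero, inv_one, mul_one] at hn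
  refine ⟨n + 1, fun m hm => (mem_BSA x t m g).2 ⟨BSB_mono x t (by omega) hn, ?_⟩⟩
  have := BSB_mono x t (show n + (-1 : ℤ).natAbs ≤ m by simpa using hm) (BSB_conj x t n (-1) hn)
  simpa using this

open Classical in
/-- coefficient of an edge -/
noncomputable def ecoef (A : Subgroup G) (h : G) : ZG G →+ ℤ :=
  zlift (fun g => if g⁻¹ * h ∈ A then 1 else 0)

open Classical in
theorem ecoef_gel (A : Subgroup G) (h g : G) :
    ecoef A h (gel g) = if g⁻¹ * h ∈ A then 1 else 0 := by rw [ecoef, zlift_gel]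

theorem ecoef_mul (A : Subgroup G) (h g : G) (a : ZG G) :
    ecoef A h (gel g * a) = ecoef A (g⁻¹ * h) a := by
  classical
  induction a using ZG.induct with
  | h1 k => rw [← gel_mul, ecoef_gel, ecoef_gel]; simp [mul_assoc]
  | hadd y z hy hz => rw [mul_add, map_add, hy, hz, map_add]
  | hneg y hy => rw [mul_neg, map_neg, hy, map_neg]

theorem ecoef_vanish (χ : G →* Multiplicative ℤ) (ht : χ t = Multiplicative.ofAdd 1)
    (hx : ∀ j, χ (x j) = 1) (hgen : Subgroup.closure (Set.range x ∪ {t}) = ⊤) (a : ZG G)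
    (ha : MonoidAlgebra.mapDomainRingHom ℤ χ a = 0) :
    ∃ n0, ∀ n, n0 ≤ n → ∀ h, ecoef (BSA x t n) h a = 0 := by
  classical
  let τ : ZG G →+ ZG G := zlift (fun g => gel (t ^ (χ g).toAdd))
  let σ : ZG (Multiplicative ℤ) →+ ZG G := zlift (fun z => gel (t ^ z.toAdd))
  have h1 : ∀ a, τ a = σ (MonoidAlgebra.mapDomainRingHom ℤ χ a) := by
    intro a
    induction a using ZG.induct with
    | h1 g =>
      have : MonoidAlgebra.mapDomainRingHom ℤ χ (gel g) = (gel (χ g) : ZG (Multiplicative ℤ)) := by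
        simp [gel]
      rw [this]; simp only [τ, σ, zlift_gel]
    | hadd y z hy hz => rw [map_add, hy, hz, map_add, map_add]
    | hneg y hy => rw [map_neg, hy, map_neg, map_neg]
  have h2 : ∀ a, ∃ n0, ∀ n, n0 ≤ n → ∀ h, ecoef (BSA x t n) h a = ecoef (BSA x t n) h (τ a) := by
    intro a
    induction a using ZG.induct with
    | h1 g =>
      have hχ : χ (g⁻¹ * t ^ (χ g).toAdd) = 1 := by
        rw [map_mul, map_zpow, ht, map_inv, inv_mul_eq_one]
        apply Multiplicative.toAdd.injective
        simp
      obtain ⟨n0, hn0⟩ := BSA_exhaust x t χ ht hx hgen _ hχ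
      refine ⟨n0, fun n hn h => ?_⟩
      have hm := hn0 n hn
      simp only [τ, zlift_gel, ecoef_gel]
      have e : g⁻¹ * h = (g⁻¹ * t ^ (χ g).toAdd) * ((t ^ (χ g).toAdd)⁻¹ * h) := by group
      rw [e, Subgroup.mul_mem_cancel_left _ hm]
    | hadd y z hy hz =>
      obtain ⟨n1, h1⟩ := hy
      obtain ⟨n2, h2⟩ := hz
      refine ⟨max n1 n2, fun n hn h => ?_⟩
      rw [map_add, map_add, map_add, h1 n (le_of_max_le_left hn), h2 n (le_of_max_le_right hn)]
    | hneg y hy =>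
      obtain ⟨n1, h1⟩ := hy
      refine ⟨n1, fun n hn h => ?_⟩
      rw [map_neg, map_neg, map_neg, h1 n hn]
  obtain ⟨n0, hn0⟩ := h2 a
  refine ⟨n0, fun n hn h => ?_⟩
  rw [hn0 n hn h, h1, ha, map_zero, map_zero]

variable [Fintype ι]

open Classical in
theorem exists_deriv (χ : G →* Multiplicative ℤ) (ht : χ t = Multiplicative.ofAdd 1)
    (hx : ∀ j, χ (x j) = 1) (hgen : Subgroup.closure (Set.range x ∪ {t}) = ⊤)
    (hfp : Group.IsTypeFP2 G) :
    ∃ n, ∃ D : G → G → ℤ, (∀ g g' h, D (g * g') h = D g h + D g' (g⁻¹ * h)) ∧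
      (∀ h, D t h = if h ∈ BSA x t n then 1 else 0) ∧ (∀ j h, D (x j) h = 0) := by
  let y : Option ι → G := fun o => o.elim t x
  have hy : Subgroup.closure (Set.range y) = ⊤ := by
    rw [← hgen]; congr 1
    ext g
    simp only [Set.mem_range, Option.exists, Set.mem_union, Set.mem_singleton_iff, y]
    constructor
    · rintro (h | h)
      · exact Or.inr h.symm
      · exact Or.inl h
    · rintro (h | h)
      · exact Or.inr h
      · exact Or.inl h.symm
  have hK := relFG_of_fp2 y hy hfp
  obtain ⟨T, hT⟩ := hK
  have hv : ∀ v ∈ LinearMap.ker (foxMap y),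
      MonoidAlgebra.mapDomainRingHom ℤ χ (v none) = 0 := by
    intro v hv
    have h1 := congrArg (MonoidAlgebra.mapDomainRingHom ℤ χ) (LinearMap.mem_ker.1 hv)
    have hgl : ∀ g, MonoidAlgebra.mapDomainRingHom ℤ χ (gel g) =
        (gel (χ g) : ZG (Multiplicative ℤ)) := fun g => by simp [gel]
    rw [foxMap_apply, map_zero, Fintype.sum_option, map_add, map_sum, Finset.sum_eq_zero,
      add_zero, map_mul, map_sub, map_one, hgl] at h1
    · rcases mul_eq_zero.1 h1 with h | h
      · exact h
      · exfalso
        rw [sub_eq_zero] at h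
        have h2 : χ t = 1 := by
          apply (MonoidAlgebra.single_left_inj (R := ℤ) one_ne_zero).1
          exact h
        rw [ht] at h2
        have := congrArg Multiplicative.toAdd h2
        simp at this
    · intro i _
      have : χ (y (some i)) = 1 := hx i
      rw [map_mul, map_sub, hgl, map_one, this, gel_one, sub_self, mul_zero]
  have hex : ∃ n, ∀ v ∈ T, ∀ h, ecoef (BSA x t n) h (v none) = 0 := by
    have h0 : ∀ v ∈ T, ∃ n0, ∀ n, n0 ≤ n → ∀ h, ecoef (BSA x t n) h (v none) = 0 := fun v hvT =>
      ecoef_vanish x t χ ht hx hgen _ (hv v (hT ▸ Submodule.subset_span hvT))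
    choose! f hf using h0
    exact ⟨T.sup f, fun v hv h => hf v hv _ (Finset.le_sup hv) h⟩
  obtain ⟨n, hn⟩ := hex
  have hkill : ∀ v ∈ LinearMap.ker (foxMap y), ∀ h, ecoef (BSA x t n) h (v none) = 0 := by
    intro v hv
    rw [← hT] at hv
    induction hv using Submodule.span_induction with
    | mem v hv => exact hn v hv
    | zero => intro h; simp
    | add u v _ _ hu hv => intro h; simp [hu, hv]
    | smul a u _ hu =>
      induction a using ZG.induct with
      | h1 g => intro h; simp only [Pi.smul_apply, smul_eq_mul, ecoef_mul, hu]
      | hadd y z hy hz => intro h; rw [add_smul, Pi.add_apply, map_add, hy, hz, add_zero]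
      | hneg y hy => intro h; rw [neg_smul, Pi.neg_apply, map_neg, hy, neg_zero]
  have hdep : ∀ v w, foxMap y v = foxMap y w → ∀ h,
      ecoef (BSA x t n) h (v none) = ecoef (BSA x t n) h (w none) := by
    intro v w hvw h
    have := hkill (v - w) (by simp [hvw]) h
    rw [Pi.sub_apply, map_sub, sub_eq_zero] at this
    exact this
  choose s hs using gel_sub_one_mem_range y hy
  refine ⟨n, fun g h => ecoef (BSA x t n) h (s g none), ?_, ?_, ?_⟩
  · intro g g' h
    dsimp only
    rw [hdep (s (g * g')) (s g + gel g • s g') ?_ h]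
    · simp only [Pi.add_apply, Pi.smul_apply, smul_eq_mul, map_add, ecoef_mul]
    · rw [map_add, map_smul, hs, hs, hs, gel_mul, smul_eq_mul, mul_sub]; simp
  · intro h
    dsimp only
    rw [hdep (s t) (Pi.single none 1) (by rw [hs, foxMap_single]; rfl) h]
    rw [Pi.single_eq_same, ← gel_one, ecoef_gel]; simp
  · intro j h
    dsimp only
    rw [hdep (s (x j)) (Pi.single (some j) 1) (by rw [hs, foxMap_single]; rfl) h]
    simp

theorem bieriStrebel_aux (hNF : NoFree G) (χ : G →* Multiplicative ℤ)
    (ht : χ t = Multiplicative.ofAdd 1)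
    (hx : ∀ j, χ (x j) = 1) (hgen : Subgroup.closure (Set.range x ∪ {t}) = ⊤)
    (hfp : Group.IsTypeFP2 G) :
    ∃ B : Subgroup G, B.FG ∧ (∀ j, x j ∈ B) ∧ B ≤ χ.ker ∧
      ((∀ b ∈ B, t * b * t⁻¹ ∈ B) ∨ (∀ b ∈ B, t⁻¹ * b * t ∈ B)) := by
  classical
  obtain ⟨n, D, hmul, hDt, hDx⟩ := exists_deriv x t χ ht hx hgen hfp
  have hD1 : ∀ h, D 1 h = 0 := by
    intro h
    have := hmul 1 1 h
    simp at this; exact this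
  have hconj : ∀ g, t * g * t⁻¹ ∈ BSA x t n → ∀ h, D (t * g * t⁻¹) h = D g (t⁻¹ * h) := by
    intro g hg h
    have h1 := hmul (t * g * t⁻¹) t h
    have h2 := hmul t g h
    have h3 : t * g * t⁻¹ * t = t * g := by group
    rw [h3, h2, hDt, hDt, Subgroup.mul_mem_cancel_left _ (inv_mem hg)] at h1
    omega
  have hxB : ∀ (i : ℤ) (j : ι), i.natAbs ≤ n → t ^ i * x j * (t ^ i)⁻¹ ∈ BSB x t n :=
    fun i j hi => Subgroup.subset_closure ⟨i, j, hi, rfl⟩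
  have hpos : ∀ (i : ℕ), i ≤ n → ∀ j h, D (t ^ (i : ℤ) * x j * (t ^ (i : ℤ))⁻¹) h = 0 := by
    intro i
    induction i with
    | zero => intro _ j h; simp [hDx]
    | succ i ih =>
      intro hi j h
      have e : t ^ ((i + 1 : ℕ) : ℤ) * x j * (t ^ ((i + 1 : ℕ) : ℤ))⁻¹ =
          t * (t ^ (i : ℤ) * x j * (t ^ (i : ℤ))⁻¹) * t⁻¹ := by
        rw [Nat.cast_succ, add_comm, zpow_one_add]; group
      have hm : t * (t ^ (i : ℤ) * x j * (t ^ (i : ℤ))⁻¹) * t⁻¹ ∈ BSA x t n := by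
        rw [mem_BSA]
        refine ⟨e ▸ hxB _ j (by omega), ?_⟩
        have := hxB i j (by omega)
        convert this using 1; group
      rw [e, hconj _ hm, ih (by omega)]
  have hneg : ∀ (i : ℕ), i ≤ n → ∀ j h, D (t ^ (-i : ℤ) * x j * (t ^ (-i : ℤ))⁻¹) h = 0 := by
    intro i
    induction i with
    | zero => intro _ j h; simp [hDx]
    | succ i ih =>
      intro hi j h
      have e : t * (t ^ (-(i + 1 : ℕ) : ℤ) * x j * (t ^ (-(i + 1 : ℕ) : ℤ))⁻¹) * t⁻¹ =
          t ^ (-i : ℤ) * x j * (t ^ (-i : ℤ))⁻¹ := by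
        rw [Nat.cast_succ]; group
      have hm : t * (t ^ (-(i + 1 : ℕ) : ℤ) * x j * (t ^ (-(i + 1 : ℕ) : ℤ))⁻¹) * t⁻¹
          ∈ BSA x t n := by
        rw [mem_BSA]
        refine ⟨e ▸ hxB _ j (by omega), ?_⟩
        have := hxB (-(i + 1 : ℕ)) j (by omega)
        convert this using 1; group
      have h1 := hconj _ hm (t * h)
      rw [e, ih (by omega)] at h1
      simpa using h1.symm
  have hDB : ∀ b ∈ BSB x t n, ∀ h, D b h = 0 := by
    intro b hb
    rw [BSB] at hb
    induction hb using Subgroup.closure_induction with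
    | mem b hb =>
      obtain ⟨i, j, hi, rfl⟩ := hb
      rcases Int.natAbs_eq i with h | h
      · rw [h]; exact hpos _ hi j
      · rw [h]; exact hneg _ hi j
    | one => exact hD1
    | mul a b _ _ ha hb => intro h; rw [hmul, ha, hb, add_zero]
    | inv a _ ha =>
      intro h
      have := hmul a a⁻¹ (a * h)
      rw [mul_inv_cancel, hD1, ha] at this
      simpa using this.symm
  have hxB0 : ∀ j, x j ∈ BSB x t n := fun j => by simpa using hxB 0 j (by simp)
  refine ⟨BSB x t n, BSB_fg x t n, hxB0, ?_, ?_⟩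
  · rw [BSB, Subgroup.closure_le]
    rintro _ ⟨i, j, _, rfl⟩
    simp [MonoidHom.mem_ker, hx]
  · apply pingpong_bs hNF (BSB x t n) t _ (BSA x t n) (mem_BSA x t n) D hmul hDt hDB
    rw [eq_top_iff, ← hgen]
    apply Subgroup.closure_mono
    apply Set.union_subset_union_left
    rintro _ ⟨j, rfl⟩
    exact hxB0 j
end BS

/-- Bieri--Strebel, with a prescribed finitely generated piece in the base. -/
theorem bieriStrebel {G : Type u} [Group G] (hfg : Group.FG G) (hNF : NoFree G)
    (hfp : Group.IsTypeFP2 G) (χ : G →* Multiplicative ℤ) (t : G)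
    (ht : χ t = Multiplicative.ofAdd 1) (C : Subgroup G) (hC : C.FG) (hCk : C ≤ χ.ker) :
    ∃ B : Subgroup G, B.FG ∧ C ≤ B ∧ B ≤ χ.ker ∧
      Subgroup.closure ((B : Set G) ∪ {t}) = ⊤ ∧
      ((∀ b ∈ B, t * b * t⁻¹ ∈ B) ∨ (∀ b ∈ B, t⁻¹ * b * t ∈ B)) := by
  obtain ⟨n, y, hy⟩ := exists_gen_fin hfg
  obtain ⟨S, hS⟩ := hC
  let z : S → G := fun c => c
  let x0 : Fin n → G := fun i => y i * (t ^ (χ (y i)).toAdd)⁻¹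
  let eS := S.equivFin
  let x : Fin n ⊕ Fin S.card → G := Sum.elim x0 (fun i => (eS.symm i : G))
  have hSC : ∀ c ∈ S, c ∈ C := fun c hc => hS ▸ Subgroup.subset_closure hc
  have hx : ∀ j, χ (x j) = 1 := by
    rintro (i | c)
    · simp only [x, x0, Sum.elim_inl, map_mul, map_inv, map_zpow, ht]
      rw [mul_inv_eq_one]
      apply Multiplicative.toAdd.injective
      simp
    · exact hCk (hSC _ (eS.symm c).2)
  have hgen : Subgroup.closure (Set.range x ∪ {t}) = ⊤ := by
    rw [eq_top_iff, ← hy, Subgroup.closure_le]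
    rintro _ ⟨i, rfl⟩
    have h1 : x (Sum.inl i) ∈ Subgroup.closure (Set.range x ∪ {t}) :=
      Subgroup.subset_closure (Or.inl ⟨_, rfl⟩)
    have h2 : t ∈ Subgroup.closure (Set.range x ∪ {t}) := Subgroup.subset_closure (Or.inr rfl)
    have := mul_mem h1 (zpow_mem h2 (χ (y i)).toAdd)
    simpa [x, x0] using this
  obtain ⟨B, hBfg, hxB, hBk, h⟩ := bieriStrebel_aux x t hNF χ ht hx hgen hfp
  refine ⟨B, hBfg, ?_, hBk, ?_, h⟩
  · rw [← hS, Subgroup.closure_le]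
    intro c hc
    have := hxB (Sum.inr (eS ⟨c, hc⟩))
    simpa [x] using this
  · rw [eq_top_iff, ← hgen]
    apply Subgroup.closure_mono
    apply Set.union_subset_union_left
    rintro _ ⟨j, rfl⟩
    exact hxB j

theorem cyc_comap {H G : Type u} [Group H] [Group G] (f : H →* G) (N : Subgroup G) [N.Normal]
    (hc : IsCyclic (G ⧸ N)) : IsCyclic (H ⧸ N.comap f) := by
  refine isCyclic_of_injective (QuotientGroup.map (N.comap f) N f le_rfl) ?_
  rw [injective_iff_map_eq_one]
  intro a
  induction a using QuotientGroup.induction_on with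
  | H a =>
    intro h
    rw [QuotientGroup.map_mk, QuotientGroup.eq_one_iff] at h
    rw [QuotientGroup.eq_one_iff]
    exact h

theorem IsPolycyclic.of_injective {G : Type u} [Group G] (hG : IsPolycyclic G) :
    ∀ {H : Type u} [Group H] (f : H →* G), Function.Injective f → IsPolycyclic H := by
  induction hG with
  | of_subsingleton G h =>
    intro H _ f hf
    exact .of_subsingleton _ hf.subsingleton
  | step G N hN h1 h2 ih =>
    intro H _ f hf
    refine .step H (N.comap f) inferInstance ?_ (cyc_comap f N h2)
    refine ih ((f.comp (N.comap f).subtype).codRestrict N (fun x => x.2)) ?_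
    intro a b hab
    apply Subtype.ext
    apply hf
    exact congrArg Subtype.val hab

theorem cover_iff {G : Type u} [Group G] (H K : Subgroup G) :
    H.relIndex K ≠ 0 ↔ ∃ F : Set G, F.Finite ∧ ∀ k ∈ K, ∃ f ∈ F, f⁻¹ * k ∈ H := by
  constructor
  · intro h
    have : Finite (K ⧸ H.subgroupOf K) := by
      have : (H.subgroupOf K).FiniteIndex := ⟨h⟩
      infer_instance
    refine ⟨Set.range (fun q : K ⧸ H.subgroupOf K => (q.out : G)), Set.finite_range _, ?_⟩
    intro k hk
    refine ⟨_, ⟨((⟨k, hk⟩ : K) : K ⧸ H.subgroupOf K), rfl⟩, ?_⟩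
    have := QuotientGroup.mk_out_eq_mul (H.subgroupOf K) ⟨k, hk⟩
    obtain ⟨h', e⟩ := this
    simp only [e]
    have hh := h'.2
    rw [Subgroup.mem_subgroupOf] at hh
    simpa using H.inv_mem hh
  · rintro ⟨F, hF, h⟩
    choose f hf1 hf2 using h
    have := hF.to_subtype
    have : Finite (K ⧸ H.subgroupOf K) := by
      refine Finite.of_injective (β := F) (fun q => ⟨f q.out q.out.2, hf1 _ _⟩) ?_
      intro p q hpq
      have e : f p.out p.out.2 = f q.out q.out.2 := congrArg Subtype.val hpq
      rw [← QuotientGroup.out_eq' p, ← QuotientGroup.out_eq' q, QuotientGroup.eq,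
        Subgroup.mem_subgroupOf]
      have h1 := hf2 p.out p.out.2
      have h2 := hf2 q.out q.out.2
      rw [e] at h1
      have := H.mul_mem (H.inv_mem h1) h2
      simpa [mul_assoc] using this
    have := Subgroup.finiteIndex_of_finite_quotient (H := H.subgroupOf K)
    exact this.index_ne_zero

theorem cover_top {G : Type u} [Group G] (H : Subgroup G) :
    H.FiniteIndex ↔ ∃ F : Set G, F.Finite ∧ ∀ k, ∃ f ∈ F, f⁻¹ * k ∈ H := by
  have := cover_iff H ⊤
  rw [Subgroup.relIndex_top_right] at this
  simp only [Subgroup.mem_top, forall_const] at this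
  rw [← this, Subgroup.finiteIndex_iff]

theorem fg_of_ext {G : Type u} [Group G] (N : Subgroup G) [N.Normal] (h1 : Group.FG N)
    (h2 : Group.FG (G ⧸ N)) : Group.FG G := by
  obtain ⟨A, hA⟩ := Group.fg_iff_subgroup_fg N |>.1 h1
  obtain ⟨B, hB, hBf⟩ := Group.fg_iff.1 h2
  refine Group.fg_iff.2 ⟨A ∪ Quotient.out '' B, ?_, A.finite_toSet.union (hBf.image _)⟩
  rw [eq_top_iff]
  have hN : N ≤ Subgroup.closure (A ∪ Quotient.out '' B) := by
    exact hA.symm.le.trans (Subgroup.closure_mono Set.subset_union_left)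
  intro g _
  have : (g : G ⧸ N) ∈ (Subgroup.closure (A ∪ Quotient.out '' B)).map (QuotientGroup.mk' N) := by
    have : (⊤ : Subgroup (G ⧸ N)) ≤
        (Subgroup.closure (A ∪ Quotient.out '' B)).map (QuotientGroup.mk' N) := by
      rw [← hB, Subgroup.closure_le]
      intro b hb
      exact ⟨_, Subgroup.subset_closure (Or.inr ⟨b, hb, rfl⟩), by simp⟩
    exact this trivial
  obtain ⟨c, hc, e⟩ := this
  have : c⁻¹ * g ∈ N := QuotientGroup.eq.1 e
  simpa using Subgroup.mul_mem _ hc (hN this)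

theorem IsPolycyclic.fg {G : Type u} [Group G] (hG : IsPolycyclic G) : Group.FG G := by
  induction hG with
  | of_subsingleton G h => infer_instance
  | step G N hN h1 h2 ih =>
    obtain ⟨q, hq⟩ := h2.exists_generator
    refine fg_of_ext N ih (Group.fg_iff.2 ⟨{q}, ?_, Set.finite_singleton q⟩)
    rw [← Subgroup.zpowers_eq_closure]
    exact (Subgroup.eq_top_iff' _).2 hq

theorem IsVirtuallyPolycyclic.fg {G : Type u} [Group G] (hG : IsVirtuallyPolycyclic G) :
    Group.FG G := by
  obtain ⟨H, hH, hp⟩ := hG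
  have : Group.FG H.normalCore := (hp.of_injective (Subgroup.inclusion H.normalCore_le)
    (Subgroup.inclusion_injective _)).fg
  exact fg_of_ext H.normalCore this inferInstance

theorem IsVirtuallyPolycyclic.of_injective {G H : Type u} [Group G] [Group H]
    (hG : IsVirtuallyPolycyclic G) (f : H →* G) (hf : Function.Injective f) :
    IsVirtuallyPolycyclic H := by
  obtain ⟨P, hP, hp⟩ := hG
  refine ⟨P.comap f, ⟨?_⟩,

    hp.of_injective ((f.comp (P.comap f).subtype).codRestrict P (fun x => x.2)) ?_⟩
  · rw [Subgroup.index_comap]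
    exact fun h => hP.index_ne_zero (by
      rw [← Subgroup.relIndex_top_right]; exact Subgroup.relIndex_eq_zero_of_le_right le_top h)
  intro a b hab
  apply Subtype.ext
  apply hf
  exact congrArg Subtype.val hab

theorem vp_mono {G : Type u} [Group G] {A B : Subgroup G} (h : A ≤ B)
    (hB : IsVirtuallyPolycyclic B) : IsVirtuallyPolycyclic A :=
  hB.of_injective (Subgroup.inclusion h) (Subgroup.inclusion_injective _)

theorem vp_fg {G : Type u} [Group G] {B : Subgroup G} (hB : IsVirtuallyPolycyclic B) : B.FG :=
  (Group.fg_iff_subgroup_fg _).1 hB.fg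

theorem vp_of_finiteIndex {G : Type u} [Group G] (B : Subgroup G) [hf : B.FiniteIndex]
    (hB : IsVirtuallyPolycyclic B) : IsVirtuallyPolycyclic G := by
  obtain ⟨P, hP, hp⟩ := hB
  refine ⟨P.map B.subtype, ⟨?_⟩, ?_⟩
  · rw [Subgroup.index_map_subtype]
    exact mul_ne_zero hP.index_ne_zero hf.index_ne_zero
  · exact hp.of_injective (P.equivMapOfInjective B.subtype B.subtype_injective).symm.toMonoidHom
      (MulEquiv.injective _)

theorem cyc_gen {G : Type u} [Group G] (N : Subgroup G) [N.Normal] (h : IsCyclic (G ⧸ N)) :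
    ∃ t : G, ∀ g, ∃ n : ℤ, g * (t ^ n)⁻¹ ∈ N := by
  obtain ⟨q, hq⟩ := h.exists_generator
  obtain ⟨t, rfl⟩ := QuotientGroup.mk_surjective q
  refine ⟨t, fun g => ?_⟩
  obtain ⟨n, hn⟩ := hq g
  refine ⟨n, ?_⟩
  rw [← QuotientGroup.eq_one_iff, QuotientGroup.mk_mul, QuotientGroup.mk_inv,
    QuotientGroup.mk_zpow]
  simp only at hn
  rw [hn]; simp

theorem cyc_quot {G : Type u} [Group G] (N : Subgroup G) [N.Normal] (t : G)
    (h : ∀ g, ∃ n : ℤ, g * (t ^ n)⁻¹ ∈ N) : IsCyclic (G ⧸ N) := by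
  refine ⟨(t : G ⧸ N), fun q => ?_⟩
  obtain ⟨g, rfl⟩ := QuotientGroup.mk_surjective q
  obtain ⟨n, hn⟩ := h g
  refine ⟨n, ?_⟩
  rw [← QuotientGroup.eq_one_iff, QuotientGroup.mk_mul, QuotientGroup.mk_inv,
    QuotientGroup.mk_zpow] at hn
  exact (mul_inv_eq_one.1 hn).symm

theorem vp_char_core {N : Type u} [Group N] (hN : IsVirtuallyPolycyclic N) :
    ∃ P : Subgroup N, P.FiniteIndex ∧ IsPolycyclic P ∧ P.Characteristic := by
  have hfg := hN.fg
  obtain ⟨P, hP, hp⟩ := hN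
  have : Finite (N ⧸ P) := inferInstance
  let E := Equiv.Perm (N ⧸ P)
  obtain ⟨S, hS, hSf⟩ := Group.fg_iff.1 hfg
  have := hSf.to_subtype
  have : Finite (N →* E) := by
    refine Finite.of_injective (β := S → E) (fun f s => f s) ?_
    intro f g hfg
    refine MonoidHom.eq_of_eqOn_dense hS (fun s hs => ?_)
    exact congrFun hfg ⟨s, hs⟩
  let P0 : Subgroup N := ⨅ f : N →* E, f.ker
  have hle : P0 ≤ P := by
    intro x hx
    have h1 : x ∈ (MulAction.toPermHom N (N ⧸ P)).ker := (Subgroup.mem_iInf.1 hx) _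
    rw [MonoidHom.mem_ker] at h1
    have h2 := congrArg (fun e : E => e ((1 : N) : N ⧸ P)) h1
    have h3 : ((x * 1 : N) : N ⧸ P) = ((1 : N) : N ⧸ P) := h2
    rw [mul_one] at h3
    have := QuotientGroup.eq.1 h3.symm
    simpa using this
  refine ⟨P0, ?_, hp.of_injective (Subgroup.inclusion hle) (Subgroup.inclusion_injective _), ?_⟩
  · refine Subgroup.finiteIndex_iInf ?_
    intro f
    infer_instance
  · rw [Subgroup.characteristic_iff_le_comap]
    intro φ x hx
    rw [Subgroup.mem_comap, Subgroup.mem_iInf]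
    intro f
    exact (Subgroup.mem_iInf.1 hx) (f.comp φ.toMonoidHom)

theorem vp_cyc_ext {G : Type u} [Group G] (N : Subgroup G) [hN : N.Normal]
    (h1 : IsVirtuallyPolycyclic N) (h2 : IsCyclic (G ⧸ N)) : IsVirtuallyPolycyclic G := by
  obtain ⟨P, hPf, hp, hch⟩ := vp_char_core h1
  let Q : Subgroup G := P.map N.subtype
  have hQ : Q.Normal := inferInstanceAs (P.map N.subtype).Normal
  have hQp : IsPolycyclic Q :=
    hp.of_injective (P.equivMapOfInjective N.subtype N.subtype_injective).symm.toMonoidHom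
      (MulEquiv.injective _)
  obtain ⟨t, ht⟩ := cyc_gen N h2
  let M : Subgroup G := Q ⊔ Subgroup.zpowers t
  have hQM : Q ≤ M := le_sup_left
  refine ⟨M, ?_, ?_⟩
  · rw [cover_top]
    obtain ⟨F, hF, hc⟩ := (cover_top P).1 hPf
    refine ⟨Subtype.val '' F, hF.image _, fun g => ?_⟩
    obtain ⟨n, hn⟩ := ht g
    obtain ⟨f, hf, hfP⟩ := hc ⟨_, hn⟩
    refine ⟨f, ⟨f, hf, rfl⟩, ?_⟩
    have a1 : (f : G)⁻¹ * (g * (t ^ n)⁻¹) ∈ M := hQM ⟨_, hfP, by simp⟩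
    have a2 : t ^ n ∈ M := (le_sup_right : _ ≤ M) ⟨n, rfl⟩
    simpa [mul_assoc] using M.mul_mem a1 a2
  · refine .step M (Q.subgroupOf M) inferInstance ?_ ?_
    · exact hQp.of_injective (Subgroup.subgroupOfEquivOfLe hQM).toMonoidHom (MulEquiv.injective _)
    · refine cyc_quot _ ⟨t, (le_sup_right : _ ≤ M) (Subgroup.mem_zpowers t)⟩ ?_
      rintro ⟨g, hg⟩
      obtain ⟨q, hq, z, ⟨n, rfl⟩, rfl⟩ := Subgroup.mem_sup_of_normal_left.1 hg
      refine ⟨n, ?_⟩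
      rw [Subgroup.mem_subgroupOf]
      simpa using hq

theorem vp_induction {P : ∀ (G : Type u) [Group G], Prop}
    (h0 : ∀ (G : Type u) [Group G], Subsingleton G → P G)
    (hc : ∀ (G : Type u) [Group G] (N : Subgroup G) [N.Normal], P N → IsCyclic (G ⧸ N) → P G)
    (hf : ∀ (G : Type u) [Group G] (N : Subgroup G) [N.Normal], P N → Finite (G ⧸ N) → P G)
    {G : Type u} [Group G] (hG : IsVirtuallyPolycyclic G) : P G := by
  have hp : ∀ (G : Type u) [Group G], IsPolycyclic G → P G := by
    intro G _ h
    induction h with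
    | of_subsingleton G h => exact h0 G h
    | step G N hN h1 h2 ih => exact hc G N ih h2
  obtain ⟨H, hH, hHp⟩ := hG
  exact hf G H.normalCore (hp _ (hHp.of_injective (Subgroup.inclusion H.normalCore_le)
    (Subgroup.inclusion_injective _))) inferInstance

theorem vp_subgroup_fg {G : Type u} [Group G] (hG : IsVirtuallyPolycyclic G) (A : Subgroup G) :
    A.FG :=
  vp_fg (hG.of_injective A.subtype A.subtype_injective)

def DCfi (G : Type u) [Group G] : Prop :=
  ∀ H : ℕ → Subgroup G, Antitone H → ∃ N, ∀ i ≥ N, (H (i + 1)).relIndex (H i) ≠ 0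

theorem relIndex_ext {G : Type u} [Group G] (N : Subgroup G) [N.Normal] {A' A : Subgroup G}
    (hle : A' ≤ A) (h1 : (A'.subgroupOf N).relIndex (A.subgroupOf N) ≠ 0)
    (h2 : (A'.map (QuotientGroup.mk' N)).relIndex (A.map (QuotientGroup.mk' N)) ≠ 0) :
    A'.relIndex A ≠ 0 := by
  classical
  obtain ⟨F1, hF1, c1⟩ := (cover_iff _ _).1 h2
  obtain ⟨F2, hF2, c2⟩ := (cover_iff _ _).1 h1
  let κ : G ⧸ N → G := fun q => if h : ∃ k ∈ A, (k : G ⧸ N) = q then h.choose else 1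
  refine (cover_iff _ _).2 ⟨Set.image2 (fun q (n : N) => κ q * (n : G)) F1 F2, hF1.image2 _ hF2, ?_⟩
  intro h hh
  obtain ⟨f, hf, a', ha', e⟩ := c1 (h : G ⧸ N) ⟨h, hh, rfl⟩
  have e1 : ((h * a'⁻¹ : G) : G ⧸ N) = f := by
    have e' : (a' : G ⧸ N) = f⁻¹ * (h : G ⧸ N) := e
    rw [QuotientGroup.mk_mul, QuotientGroup.mk_inv, e']; group
  have hex : ∃ k ∈ A, (k : G ⧸ N) = f := ⟨_, A.mul_mem hh (A.inv_mem (hle ha')), e1⟩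
  have hk : κ f ∈ A ∧ (κ f : G ⧸ N) = f := by
    simp only [κ, dif_pos hex]; exact hex.choose_spec
  have m1 : (κ f)⁻¹ * (h * a'⁻¹) ∈ N := by
    rw [← QuotientGroup.eq, hk.2, e1]
  have m2 : (κ f)⁻¹ * (h * a'⁻¹) ∈ A :=
    A.mul_mem (A.inv_mem hk.1) (A.mul_mem hh (A.inv_mem (hle ha')))
  obtain ⟨f2, hf2, m3⟩ := c2 ⟨_, m1⟩ (by rw [Subgroup.mem_subgroupOf]; exact m2)
  refine ⟨_, Set.mem_image2_of_mem hf hf2, ?_⟩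
  rw [Subgroup.mem_subgroupOf] at m3
  have := A'.mul_mem m3 ha'
  simpa [mul_assoc] using this

theorem dcfi_ext {G : Type u} [Group G] (N : Subgroup G) [N.Normal] (h1 : DCfi N)
    (h2 : DCfi (G ⧸ N)) : DCfi G := by
  intro H hH
  obtain ⟨n1, e1⟩ := h1 (fun i => (H i).subgroupOf N) (fun i j hij x hx => hH hij hx)
  obtain ⟨n2, e2⟩ := h2 (fun i => (H i).map (QuotientGroup.mk' N))
    (fun i j hij => Subgroup.map_mono (hH hij))
  exact ⟨max n1 n2, fun i hi => relIndex_ext N (hH (Nat.le_succ i))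
    (e1 i (le_trans (le_max_left _ _) hi)) (e2 i (le_trans (le_max_right _ _) hi))⟩

theorem dcfi_finite {G : Type u} [Group G] [Finite G] : DCfi G := by
  intro H _
  exact ⟨0, fun i _ => (Subgroup.finiteIndex_of_finite (H := (H (i+1)).subgroupOf (H i))).index_ne_zero⟩

theorem cyc_fi {G : Type u} [Group G] (hc : IsCyclic G) (A : Subgroup G) (hA : A ≠ ⊥) :
    A.FiniteIndex := by
  obtain ⟨q, hq⟩ := hc.exists_generator
  obtain ⟨x, hx, hx1⟩ := (Subgroup.ne_bot_iff_exists_ne_one.1 hA).elim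
    (fun a h => (⟨a, a.2, fun h' => h (Subtype.ext h')⟩ : ∃ x, x ∈ A ∧ x ≠ 1))
  obtain ⟨n, rfl⟩ := hq x
  have hn : n ≠ 0 := by rintro rfl; exact hx1 (by simp)
  refine (cover_top A).2 ⟨(fun m : ℤ => q ^ m) '' Set.Ico 0 |n|, (Set.finite_Ico _ _).image _, ?_⟩
  intro k
  obtain ⟨m, rfl⟩ := hq k
  refine ⟨q ^ (m % n), ⟨m % n, ⟨Int.emod_nonneg _ hn, Int.emod_lt_abs _ hn⟩, rfl⟩, ?_⟩
  have : (q ^ (m % n))⁻¹ * q ^ m = (q ^ n) ^ (m / n) := by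
    rw [← zpow_neg, ← zpow_add, ← zpow_mul]
    congr 1
    have := Int.emod_add_mul_ediv m n
    linarith
  change (q ^ (m % n))⁻¹ * q ^ m ∈ A
  rw [this]
  exact A.zpow_mem hx _

theorem dcfi_cyc {G : Type u} [Group G] (hc : IsCyclic G) : DCfi G := by
  intro H hH
  by_cases h : ∃ N, H N = ⊥
  · obtain ⟨N, hN⟩ := h
    refine ⟨N, fun i hi => ?_⟩
    have : H i = ⊥ := by rw [eq_bot_iff, ← hN]; exact hH hi
    rw [this]; simp
  · push Not at h
    refine ⟨0, fun i _ => ?_⟩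
    have := cyc_fi hc _ (h (i+1))
    exact (Subgroup.instFiniteIndex_subgroupOf (H (i+1)) (H i)).index_ne_zero

theorem vp_dcfi {G : Type u} [Group G] (hG : IsVirtuallyPolycyclic G) : DCfi G := by
  refine vp_induction (P := fun G _ => DCfi G) ?_ ?_ ?_ hG
  · intro G _ _
    exact dcfi_finite
  · intro G _ N _ h1 h2
    exact dcfi_ext N h1 (dcfi_cyc h2)
  · intro G _ N _ h1 h2
    exact dcfi_ext N h1 dcfi_finite

def cj {G : Type u} [Group G] (g : G) (C : Subgroup G) : Subgroup G :=
  C.map (MulAut.conj g).toMonoidHom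

section cj
variable {G : Type u} [Group G]

theorem mem_cj {g x : G} {C : Subgroup G} : x ∈ cj g C ↔ g⁻¹ * x * g ∈ C := by
  unfold cj
  constructor
  · rintro ⟨y, hy, rfl⟩
    simpa [mul_assoc] using hy
  · intro h
    exact ⟨_, h, by simp [mul_assoc]⟩

theorem cj_mem {g x : G} {C : Subgroup G} (h : x ∈ C) : g * x * g⁻¹ ∈ cj g C := by
  rw [mem_cj]; simpa [mul_assoc] using h

theorem cj_cj (g h : G) (C : Subgroup G) : cj g (cj h C) = cj (g * h) C := by
  ext x; simp [mem_cj, mul_assoc]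

@[simp] theorem cj_one (C : Subgroup G) : cj 1 C = C := by ext x; simp [mem_cj]

theorem cj_mono (g : G) {A B : Subgroup G} (h : A ≤ B) : cj g A ≤ cj g B := by
  intro x hx; rw [mem_cj] at *; exact h hx

theorem cj_le_iff {g : G} {A B : Subgroup G} : cj g A ≤ B ↔ A ≤ cj g⁻¹ B := by
  constructor
  · intro h; have := cj_mono g⁻¹ h; rwa [cj_cj, inv_mul_cancel, cj_one] at this
  · intro h; have := cj_mono g h; rwa [cj_cj, mul_inv_cancel, cj_one] at this

theorem relIndex_cj (g : G) (A B : Subgroup G) : (cj g A).relIndex (cj g B) = A.relIndex B :=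
  Subgroup.relIndex_map_map_of_injective _ _ (MulEquiv.injective (MulAut.conj g))

theorem cj_self {g : G} {C : Subgroup G} (h : g ∈ C) : cj g C = C := by
  ext x
  rw [mem_cj]
  constructor
  · intro hx
    have := C.mul_mem (C.mul_mem h hx) (C.inv_mem h)
    simpa [mul_assoc] using this
  · intro hx
    exact C.mul_mem (C.mul_mem (C.inv_mem h) hx) h

theorem cj_normal (g : G) (C : Subgroup G) [hC : C.Normal] : cj g C = C := by
  ext x
  rw [mem_cj]
  constructor
  · intro hx
    have := hC.conj_mem _ hx g
    simpa [mul_assoc] using this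
  · intro hx
    simpa using hC.conj_mem _ hx g⁻¹

theorem vp_cj (g : G) {C : Subgroup G} (hC : IsVirtuallyPolycyclic C) :
    IsVirtuallyPolycyclic (cj g C) :=
  hC.of_injective (C.equivMapOfInjective (MulAut.conj g).toMonoidHom
    (MulEquiv.injective (MulAut.conj g))).symm.toMonoidHom (MulEquiv.injective _)

theorem cj_pow_le {g : G} {C : Subgroup G} (h : cj g C ≤ C) (n : ℕ) : cj (g ^ n) C ≤ C := by
  induction n with
  | zero => simp
  | succ n ih => rw [pow_succ, ← cj_cj]; exact (cj_mono _ h).trans ih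

theorem cj_anti {g : G} {C : Subgroup G} (h : cj g C ≤ C) {i j : ℕ} (hij : i ≤ j) :
    cj (g ^ j) C ≤ cj (g ^ i) C := by
  obtain ⟨k, rfl⟩ := Nat.exists_eq_add_of_le hij
  rw [pow_add, ← cj_cj]
  exact cj_mono _ (cj_pow_le h k)

theorem cj_inv_mono {g : G} {C : Subgroup G} (h : cj g C ≤ C) {i j : ℕ} (hij : i ≤ j) :
    cj (g⁻¹ ^ i) C ≤ cj (g⁻¹ ^ j) C := by
  obtain ⟨k, rfl⟩ := Nat.exists_eq_add_of_le hij
  rw [pow_add, ← cj_cj]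
  apply cj_mono
  have := cj_mono (g⁻¹ ^ k) (cj_pow_le h k)
  rwa [cj_cj, inv_pow, inv_mul_cancel, cj_one, ← inv_pow] at this

/-- Lemma R. -/
theorem lemmaR {C : Subgroup G} (hC : IsVirtuallyPolycyclic C) {g : G} (h : cj g C ≤ C) :
    (cj g C).relIndex C ≠ 0 := by
  obtain ⟨N, hN⟩ := vp_dcfi hC (fun i => (cj (g ^ i) C).subgroupOf C)
    (fun i j hij x hx => cj_anti h hij hx)
  have := hN N le_rfl
  rw [Subgroup.relIndex_subgroupOf (cj_pow_le h N), pow_succ, ← cj_cj, relIndex_cj] at this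
  exact this

theorem lemmaR' {C : Subgroup G} (hC : IsVirtuallyPolycyclic C) {g : G} (h : C ≤ cj g C) :
    C.relIndex (cj g C) ≠ 0 := by
  have h' : cj g⁻¹ C ≤ C := by rwa [cj_le_iff, inv_inv]
  have := lemmaR hC h'
  rwa [← relIndex_cj g, cj_cj, mul_inv_cancel, cj_one] at this

theorem fg_le_of_chain {S : ℕ → Subgroup G} (hS : Monotone S) {K : Subgroup G} (hK : K.FG)
    (h : ∀ x ∈ K, ∃ i, x ∈ S i) : ∃ n, K ≤ S n := by
  classical
  obtain ⟨A, rfl⟩ := hK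
  suffices ∃ n, ∀ x ∈ A, x ∈ S n by
    obtain ⟨n, hn⟩ := this
    exact ⟨n, (Subgroup.closure_le _).2 hn⟩
  have h' : ∀ x ∈ A, ∃ i, x ∈ S i := fun x hx => h x (Subgroup.subset_closure hx)
  clear h
  induction A using Finset.induction_on with
  | empty => exact ⟨0, by simp⟩
  | insert a s ha ih =>
    obtain ⟨n, hn⟩ := ih (fun x hx => h' x (Finset.mem_insert_of_mem hx))
    obtain ⟨m, hm⟩ := h' a (Finset.mem_insert_self _ _)
    refine ⟨max n m, fun x hx => ?_⟩
    rcases Finset.mem_insert.1 hx with rfl | hx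
    · exact hS (le_max_right _ _) hm
    · exact hS (le_max_left _ _) (hn x hx)

theorem noeth_conj {E : Subgroup G} (hE : IsVirtuallyPolycyclic E) {L : Subgroup G} (hL : L ≤ E)
    {x : G} (hx : x ∈ E) (h : cj x L ≤ L) : L ≤ cj x L := by
  have hm : Monotone (fun i : ℕ => cj (x⁻¹ ^ i) L) := fun i j hij => cj_inv_mono h hij
  have hfg : (⨆ i : ℕ, cj (x⁻¹ ^ i) L).FG := by
    refine vp_fg (vp_mono (iSup_le fun i => ?_) hE)
    rw [← cj_self (E.pow_mem (E.inv_mem hx) i)]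
    exact cj_mono _ hL
  obtain ⟨n, hn⟩ := fg_le_of_chain hm hfg
    (fun y hy => (Subgroup.mem_iSup_of_directed hm.directed_le).1 hy)
  have h1 : cj (x⁻¹ ^ (n + 1)) L ≤ cj (x⁻¹ ^ n) L :=
    (le_iSup (fun i : ℕ => cj (x⁻¹ ^ i) L) (n + 1)).trans hn
  rw [pow_succ, ← cj_cj] at h1
  have h2 := cj_mono (x⁻¹ ^ n)⁻¹ h1
  simp only [cj_cj, ← mul_assoc, inv_mul_cancel, one_mul, cj_one] at h2
  rwa [cj_le_iff, inv_inv] at h2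

end cj

section modular
variable {G : Type u} [Group G]

/-- Ratio of indices. -/
noncomputable def qi (A B : Subgroup G) : ℚ := (B.relIndex A : ℚ) / (A.relIndex B : ℚ)

theorem qi_eq {A B I : Subgroup G} (hA : I ≤ A) (hB : I ≤ B) (h1 : I.relIndex A ≠ 0)
    (h2 : I.relIndex B ≠ 0) : qi A B = (I.relIndex A : ℚ) / (I.relIndex B : ℚ) := by
  have e1 := Subgroup.relIndex_mul_relIndex I (A ⊓ B) A (le_inf hA hB) inf_le_left
  have e2 := Subgroup.relIndex_mul_relIndex I (A ⊓ B) B (le_inf hA hB) inf_le_right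
  rw [Subgroup.inf_relIndex_left] at e1
  rw [Subgroup.inf_relIndex_right] at e2
  rw [← e1] at h1 ⊢
  rw [← e2] at h2 ⊢
  have := left_ne_zero_of_mul h1
  have := right_ne_zero_of_mul h1
  have := right_ne_zero_of_mul h2
  unfold qi
  push_cast
  field_simp

theorem qi_mul {A B C : Subgroup G} (h1 : A.relIndex B ≠ 0) (h2 : B.relIndex A ≠ 0)
    (h3 : B.relIndex C ≠ 0) (h4 : C.relIndex B ≠ 0) : qi A C = qi A B * qi B C := by
  have hAC := Subgroup.relIndex_ne_zero_trans h1 h3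
  have hCA := Subgroup.relIndex_ne_zero_trans h4 h2
  have iA : (A ⊓ B ⊓ C).relIndex A ≠ 0 :=
    Subgroup.relIndex_inf_ne_zero (Subgroup.relIndex_inf_ne_zero (by simp) h2) hCA
  have iB : (A ⊓ B ⊓ C).relIndex B ≠ 0 :=
    Subgroup.relIndex_inf_ne_zero (Subgroup.relIndex_inf_ne_zero h1 (by simp)) h4
  have iC : (A ⊓ B ⊓ C).relIndex C ≠ 0 :=
    Subgroup.relIndex_inf_ne_zero (Subgroup.relIndex_inf_ne_zero hAC h3) (by simp)
  have lA : A ⊓ B ⊓ C ≤ A := inf_le_left.trans inf_le_left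
  have lB : A ⊓ B ⊓ C ≤ B := inf_le_left.trans inf_le_right
  have lC : A ⊓ B ⊓ C ≤ C := inf_le_right
  rw [qi_eq lA lC iA iC, qi_eq lA lB iA iB, qi_eq lB lC iB iC]
  field_simp

theorem qi_cj (g : G) (A B : Subgroup G) : qi (cj g A) (cj g B) = qi A B := by
  simp [qi, relIndex_cj]

def Cm (C : Subgroup G) (g : G) : Prop :=
  C.relIndex (cj g C) ≠ 0 ∧ (cj g C).relIndex C ≠ 0

theorem Cm_mul {C : Subgroup G} {g h : G} (hg : Cm C g) (hh : Cm C h) : Cm C (g * h) := by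
  have h1 : (cj g C).relIndex (cj (g * h) C) ≠ 0 := by
    rw [← cj_cj, relIndex_cj]; exact hh.1
  have h2 : (cj (g * h) C).relIndex (cj g C) ≠ 0 := by
    rw [← cj_cj, relIndex_cj]; exact hh.2
  exact ⟨Subgroup.relIndex_ne_zero_trans hg.1 h1, Subgroup.relIndex_ne_zero_trans h2 hg.2⟩

theorem Cm_self {C : Subgroup G} {g : G} (h : g ∈ C) : Cm C g := by
  simp [Cm, cj_self h]

theorem Cm_inv {C : Subgroup G} {g : G} (h : Cm C g) : Cm C g⁻¹ := by
  have e : C = cj g⁻¹ (cj g C) := by simp [cj_cj]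
  constructor
  · nth_rewrite 1 [e]; rw [relIndex_cj]; exact h.2
  · nth_rewrite 2 [e]; rw [relIndex_cj]; exact h.1

/-- The commensurator. -/
def CM (C : Subgroup G) : Subgroup G where
  carrier := {g | Cm C g}
  mul_mem' := Cm_mul
  one_mem' := Cm_self C.one_mem
  inv_mem' := Cm_inv

theorem mem_CM {C : Subgroup G} {g : G} : g ∈ CM C ↔ Cm C g := Iff.rfl

/-- The modular function. -/
noncomputable def Dl (C : Subgroup G) (g : G) : ℚ := qi C (cj g C)

theorem Dl_mul {C : Subgroup G} {g h : G} (hg : g ∈ CM C) (hh : h ∈ CM C) :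
    Dl C (g * h) = Dl C g * Dl C h := by
  unfold Dl
  rw [mem_CM] at *
  rw [qi_mul hg.1 hg.2 (C := cj (g * h) C), ← cj_cj, qi_cj]
  · rw [← cj_cj, relIndex_cj]; exact hh.1
  · rw [← cj_cj, relIndex_cj]; exact hh.2

theorem Dl_self {C : Subgroup G} {g : G} (h : g ∈ C) : Dl C g = 1 := by
  simp [Dl, cj_self h, qi]

theorem Dl_pos {C : Subgroup G} {g : G} (h : g ∈ CM C) : 0 < Dl C g := by
  unfold Dl qi
  have h1 := Nat.pos_of_ne_zero h.1
  have h2 := Nat.pos_of_ne_zero h.2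
  positivity

theorem Dl_inv {C : Subgroup G} {g : G} (h : g ∈ CM C) : Dl C g⁻¹ = (Dl C g)⁻¹ := by
  have h1 := Dl_mul h ((CM C).inv_mem h)
  rw [mul_inv_cancel, Dl_self C.one_mem] at h1
  exact eq_inv_of_mul_eq_one_right h1.symm

theorem Dl_pow {C : Subgroup G} {g : G} (h : g ∈ CM C) (n : ℕ) : Dl C (g ^ n) = Dl C g ^ n := by
  induction n with
  | zero => simpa using Dl_self C.one_mem
  | succ n ih => rw [pow_succ, pow_succ, Dl_mul ((CM C).pow_mem h n) h, ih]

theorem Dl_zpow {C : Subgroup G} {g : G} (h : g ∈ CM C) (n : ℤ) :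
    Dl C (g ^ n) = Dl C g ^ n := by
  cases n with
  | ofNat n => simpa using Dl_pow h n
  | negSucc n =>
    rw [zpow_negSucc, zpow_negSucc, Dl_inv ((CM C).pow_mem h _), Dl_pow h]

theorem Dl_conj {C : Subgroup G} {g h : G} (hg : g ∈ CM C) (hh : h ∈ CM C) :
    Dl C (g * h * g⁻¹) = Dl C h := by
  have := (Dl_pos hg).ne'
  rw [Dl_mul ((CM C).mul_mem hg hh) ((CM C).inv_mem hg), Dl_mul hg hh, Dl_inv hg]
  field_simp

theorem Dl_cj {C : Subgroup G} {g y : G} (hg : g ∈ CM C) (hy : y ∈ cj g C) :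
    y ∈ CM C ∧ Dl C y = 1 := by
  rw [mem_cj] at hy
  have e : y = g * (g⁻¹ * y * g) * g⁻¹ := by group
  have hc : (g⁻¹ * y * g) ∈ CM C := Cm_self hy
  constructor
  · rw [e]; exact (CM C).mul_mem ((CM C).mul_mem hg hc) ((CM C).inv_mem hg)
  · rw [e, Dl_conj hg hc, Dl_self hy]

theorem Dl_le {C : Subgroup G} {g : G} (h : cj g C ≤ C) :
    Dl C g = ((cj g C).relIndex C : ℚ) := by
  unfold Dl qi
  rw [Subgroup.relIndex_eq_one.2 h]; simp

/-- independence of the modular function from the commensurability class -/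
theorem Dl_comm {C E : Subgroup G} (h1 : C.relIndex E ≠ 0) (h2 : E.relIndex C ≠ 0) {g : G}
    (hg : g ∈ CM C) : g ∈ CM E ∧ Dl E g = Dl C g := by
  have hg' : Cm C g := hg
  have h1' : (cj g C).relIndex (cj g E) ≠ 0 := by rwa [relIndex_cj]
  have h2' : (cj g E).relIndex (cj g C) ≠ 0 := by rwa [relIndex_cj]
  have a1 := Subgroup.relIndex_ne_zero_trans hg'.1 h1'
  have a2 := Subgroup.relIndex_ne_zero_trans h2' hg'.2
  refine ⟨⟨Subgroup.relIndex_ne_zero_trans h2 a1, Subgroup.relIndex_ne_zero_trans a2 h1⟩, ?_⟩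
  unfold Dl
  rw [qi_mul h2 h1 a1 a2, qi_mul hg'.1 hg'.2 h1' h2', qi_cj]
  have : qi E C * qi C E = 1 := by
    rw [← qi_mul h2 h1 h1 h2]; simp [qi]
  rw [mul_comm (qi C (cj g C)), ← mul_assoc, this, one_mul]

def BB (C : Subgroup G) (s : G) : Subgroup G := Subgroup.closure ((C : Set G) ∪ {s})

theorem le_BB (C : Subgroup G) (s : G) : C ≤ BB C s :=
  fun _ h => Subgroup.subset_closure (Or.inl h)

theorem mem_BB (C : Subgroup G) (s : G) : s ∈ BB C s := Subgroup.subset_closure (Or.inr rfl)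

theorem BB_le {C M : Subgroup G} {s : G} (h : C ≤ M) (hs : s ∈ M) : BB C s ≤ M := by
  rw [BB, Subgroup.closure_le]
  rintro x (hx | rfl)
  · exact h hx
  · exact hs

def KK (C : Subgroup G) (s : G) : Subgroup G := ⨆ i : ℕ, cj (s⁻¹ ^ i) C

variable {C : Subgroup G} {s : G}

theorem mem_KK (h : cj s C ≤ C) {x : G} : x ∈ KK C s ↔ ∃ i : ℕ, x ∈ cj (s⁻¹ ^ i) C := by
  have hm : Monotone (fun i : ℕ => cj (s⁻¹ ^ i) C) := fun i j hij => cj_inv_mono h hij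
  exact Subgroup.mem_iSup_of_directed hm.directed_le

theorem le_KK : C ≤ KK C s := by
  have := le_iSup (fun i : ℕ => cj (s⁻¹ ^ i) C) 0
  simp only [pow_zero, cj_one] at this
  exact this

theorem cj_le_KK (i : ℕ) : cj (s⁻¹ ^ i) C ≤ KK C s := le_iSup (fun i : ℕ => cj (s⁻¹ ^ i) C) i

theorem KK_fg_le (h : cj s C ≤ C) {A : Subgroup G} (hA : A.FG) (hle : A ≤ KK C s) :
    ∃ n : ℕ, A ≤ cj (s⁻¹ ^ n) C :=
  fg_le_of_chain (S := fun i => cj (s⁻¹ ^ i) C) (fun i j hij => cj_inv_mono h hij) hA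
    (fun x hx => (mem_KK h).1 (hle hx))

theorem KK_normalizes (h : cj s C ≤ C) (n : ℤ) {x : G} (hx : x ∈ KK C s) :
    s ^ n * x * (s ^ n)⁻¹ ∈ KK C s := by
  have hs : s ∈ Subgroup.normalizer (KK C s : Set G) := by
    rw [Subgroup.mem_normalizer_iff]
    intro y
    simp only [SetLike.mem_coe, mem_KK h]
    constructor
    · rintro ⟨i, hi⟩
      refine ⟨i, cj_mono _ h ?_⟩
      have : s * y * s⁻¹ ∈ cj s (cj (s⁻¹ ^ i) C) := cj_mem hi
      rw [cj_cj] at this ⊢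
      convert this using 2
      exact ((Commute.refl s).inv_right.pow_right i).eq.symm
    · rintro ⟨i, hi⟩
      refine ⟨i + 1, ?_⟩
      rw [mem_cj] at hi ⊢
      rw [pow_succ']
      convert hi using 1
      simp [mul_assoc]
  have := (Subgroup.mem_normalizer_iff.1 (Subgroup.zpow_mem _ hs n)) x
  exact this.1 hx

theorem asc_nf (h : cj s C ≤ C) {y : G} (hy : y ∈ BB C s) :
    ∃ n : ℤ, ∃ k ∈ KK C s, y = k * s ^ n := by
  unfold BB at hy
  induction hy using Subgroup.closure_induction with
  | mem x hx =>
    rcases hx with hx | rfl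
    · exact ⟨0, x, le_KK hx, by simp⟩
    · exact ⟨1, 1, Subgroup.one_mem _, by simp⟩
  | one => exact ⟨0, 1, Subgroup.one_mem _, by simp⟩
  | mul a b _ _ ha hb =>
    obtain ⟨n, k, hk, rfl⟩ := ha
    obtain ⟨m, l, hl, rfl⟩ := hb
    exact ⟨n + m, _, Subgroup.mul_mem _ hk (KK_normalizes h n hl), by rw [zpow_add]; group⟩
  | inv a _ ha =>
    obtain ⟨n, k, hk, rfl⟩ := ha
    exact ⟨-n, _, KK_normalizes h (-n) (Subgroup.inv_mem _ hk), by group⟩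

theorem KK_le_BB : KK C s ≤ BB C s := by
  refine iSup_le fun i x hx => ?_
  rw [mem_cj] at hx
  have h1 : s⁻¹ ^ i ∈ BB C s := Subgroup.pow_mem _ (Subgroup.inv_mem _ (mem_BB C s)) i
  have := Subgroup.mul_mem _ (Subgroup.mul_mem _ h1 (le_BB C s hx)) (Subgroup.inv_mem _ h1)
  simpa [mul_assoc] using this

theorem asc_CM (hC : IsVirtuallyPolycyclic C) (h : cj s C ≤ C) : s ∈ CM C :=
  ⟨by rw [Subgroup.relIndex_eq_one.2 h]; simp, lemmaR hC h⟩

theorem BB_le_CM (hC : IsVirtuallyPolycyclic C) (h : cj s C ≤ C) : BB C s ≤ CM C :=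
  BB_le (fun _ hx => Cm_self hx) (asc_CM hC h)

theorem Dl_KK (hC : IsVirtuallyPolycyclic C) (h : cj s C ≤ C) {x : G} (hx : x ∈ KK C s) :
    Dl C x = 1 := by
  obtain ⟨i, hi⟩ := (mem_KK h).1 hx
  exact (Dl_cj ((CM C).pow_mem ((CM C).inv_mem (asc_CM hC h)) i) hi).2

theorem asc_Dl_gt (hC : IsVirtuallyPolycyclic C) (h : cj s C ≤ C) (hp : ¬ C ≤ cj s C) :
    1 < Dl C s := by
  rw [Dl_le h]
  have h1 := lemmaR hC h
  have h2 : (cj s C).relIndex C ≠ 1 := fun h' => hp (Subgroup.relIndex_eq_one.1 h')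
  exact_mod_cast (by omega : 1 < (cj s C).relIndex C)

theorem zpow_inj1 {a : ℚ} (ha : 1 < a) {m n : ℤ} (h : a ^ m = a ^ n) : m = n :=
  zpow_right_injective₀ (by linarith) ha.ne' h

theorem Dl_BB (hC : IsVirtuallyPolycyclic C) (h : cj s C ≤ C) {y : G} (hy : y ∈ BB C s) :
    ∃ n : ℤ, Dl C y = Dl C s ^ n ∧ (n = 0 → y ∈ KK C s) := by
  obtain ⟨n, k, hk, rfl⟩ := asc_nf h hy
  refine ⟨n, ?_, ?_⟩
  · rw [Dl_mul (BB_le_CM hC h (KK_le_BB hk)) ((CM C).zpow_mem (asc_CM hC h) n), Dl_KK hC h hk,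
      one_mul, Dl_zpow (asc_CM hC h)]
  · rintro rfl; simpa using hk

theorem KK_iff (hC : IsVirtuallyPolycyclic C) (h : cj s C ≤ C) (hp : ¬ C ≤ cj s C) {y : G}
    (hy : y ∈ BB C s) : y ∈ KK C s ↔ Dl C y = 1 := by
  refine ⟨Dl_KK hC h, fun e => ?_⟩
  obtain ⟨n, hn, hn'⟩ := Dl_BB hC h hy
  refine hn' (zpow_inj1 (asc_Dl_gt hC h hp) ?_)
  rw [← hn, e]; simp

end modular

section lemU
variable {G : Type u} [Group G] {C : Subgroup G} {s : G}

theorem map_fg {H : Type u} [Group H] (f : G →* H) {A : Subgroup G} (hA : A.FG) :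
    (A.map f).FG := by
  classical
  obtain ⟨S, rfl⟩ := hA
  exact ⟨S.image f, by rw [Finset.coe_image, MonoidHom.map_closure]⟩

theorem cj_fg (g : G) {A : Subgroup G} (hA : A.FG) : (cj g A).FG := map_fg _ hA

theorem BB_fg {A : Subgroup G} (hA : A.FG) (x : G) : (BB A x).FG := by
  classical
  obtain ⟨S, hS⟩ := hA
  refine ⟨insert x S, ?_⟩
  apply le_antisymm
  · rw [Subgroup.closure_le]
    intro y hy
    rcases Finset.mem_insert.1 hy with rfl | hy
    · exact mem_BB _ _
    · exact le_BB _ _ (hS ▸ Subgroup.subset_closure hy)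
  · refine BB_le ?_ (Subgroup.subset_closure (by simp))
    exact hS.symm.le.trans (Subgroup.closure_mono (by simp))

theorem lemmaU (hC : IsVirtuallyPolycyclic C) (h : cj s C ≤ C) (hp : ¬ C ≤ cj s C) {t : G}
    (ht : ∀ y ∈ BB C s, t * y * t⁻¹ ∈ BB C s) : ∀ k ∈ KK C s, t * k * t⁻¹ ∈ KK C s := by
  classical
  by_contra hcon
  push Not at hcon
  have ha := asc_Dl_gt hC h hp
  have hBC := BB_le_CM hC h
  set a := Dl C s with ha_def
  have cm : ∀ {x y : G}, t * (x * y) * t⁻¹ = (t * x * t⁻¹) * (t * y * t⁻¹) := by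
    intros; group
  have dmul : ∀ {x y : G}, x ∈ BB C s → y ∈ BB C s →
      Dl C (t * (x * y) * t⁻¹) = Dl C (t * x * t⁻¹) * Dl C (t * y * t⁻¹) := by
    intro x y hx hy
    rw [cm, Dl_mul (hBC (ht _ hx)) (hBC (ht _ hy))]
  have dz : ∀ {x : G}, x ∈ BB C s → ∀ n : ℤ,
      Dl C (t * x ^ n * t⁻¹) = Dl C (t * x * t⁻¹) ^ n := by
    intro x hx n
    rw [← conj_zpow, Dl_zpow (hBC (ht _ hx))]
  -- minimal exponent
  have hex : ∃ p : ℕ, 0 < p ∧ ∃ k ∈ KK C s, Dl C (t * k * t⁻¹) = a ^ p := by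
    obtain ⟨k, hk, hk'⟩ := hcon
    obtain ⟨n, hn, hn'⟩ := Dl_BB hC h (ht _ (KK_le_BB hk))
    have hn0 : n ≠ 0 := fun e => hk' (hn' e)
    rcases lt_or_gt_of_ne hn0 with h0 | h0
    · refine ⟨n.natAbs, by omega, k⁻¹, Subgroup.inv_mem _ hk, ?_⟩
      have := dz (KK_le_BB hk) (-1)
      rw [zpow_neg_one] at this
      rw [this, hn, ← zpow_mul, ← zpow_natCast]
      congr 1
      omega
    · refine ⟨n.natAbs, by omega, k, hk, ?_⟩
      rw [hn, ← zpow_natCast]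
      congr 1
      omega
  obtain ⟨hp0, k0, hk0, hk0'⟩ := Nat.find_spec hex
  have hmin := fun m hm => Nat.find_min hex (m := m) hm
  set p := Nat.find hex
  have hk0B := KK_le_BB hk0
  obtain ⟨q, hq, -⟩ := Dl_BB hC h (ht _ (mem_BB C s))
  let x := s ^ p * k0 ^ (-q)
  have hsB := mem_BB C s
  have hxB : x ∈ BB C s := Subgroup.mul_mem _ (Subgroup.pow_mem _ hsB p) (Subgroup.zpow_mem _ hk0B _)
  have hxK : t * x * t⁻¹ ∈ KK C s := by
    rw [KK_iff hC h hp (ht _ hxB)]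
    have := dz hsB p
    rw [zpow_natCast] at this
    rw [dmul (Subgroup.pow_mem _ hsB p) (Subgroup.zpow_mem _ hk0B _), dz hk0B, this, hq, hk0',
      ← zpow_natCast a p, ← zpow_mul, ← zpow_mul, ← zpow_add₀ (by linarith)]
    ring_nf
    simp
  obtain ⟨i, hi⟩ := (mem_KK h).1 hk0
  set C' := cj (s⁻¹ ^ i) C with hC'
  have hsC' : cj s C' ≤ C' := by
    have := cj_mono (s⁻¹ ^ i) h
    rw [cj_cj] at this
    rw [hC', cj_cj]
    convert this using 2
    exact ((Commute.refl s).inv_right.pow_right i).eq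
  have hu : ∀ n : ℤ, k0 ^ n ∈ C' := fun n => Subgroup.zpow_mem _ hi n
  have hxC' : cj x C' ≤ C' := by
    rw [← cj_cj, cj_self (hu _)]
    exact cj_pow_le hsC' p
  have hxm : ∀ m : ℕ, cj (x⁻¹ ^ m) C' = cj (s⁻¹ ^ (p * m)) C' := by
    intro m
    induction m with
    | zero => simp
    | succ m ih =>
      rw [pow_succ', ← cj_cj, ih]
      have e : x⁻¹ = k0 ^ q * s⁻¹ ^ p := by simp [x]
      rw [e, ← cj_cj, cj_cj (s⁻¹ ^ p), ← pow_add, cj_self]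
      · congr 2; ring
      · have := cj_inv_mono hsC' (Nat.zero_le (p + p * m))
        rw [pow_zero, cj_one] at this
        exact this (hu q)
  let K2 : Subgroup G := BB C s ⊓ cj t⁻¹ (KK C s)
  have hK2 : ∀ {y}, y ∈ K2 ↔ y ∈ BB C s ∧ t * y * t⁻¹ ∈ KK C s := by
    intro y
    rw [Subgroup.mem_inf, mem_cj, inv_inv]
  have hxK2 : x ∈ K2 := hK2.2 ⟨hxB, hxK⟩
  let L := C' ⊓ K2
  have hC'vp : IsVirtuallyPolycyclic C' := vp_cj _ hC
  have hLfg : L.FG := vp_fg (vp_mono inf_le_left hC'vp)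
  have hEfg : (cj t (BB L x)).FG := cj_fg t (BB_fg hLfg x)
  have hEK : cj t (BB L x) ≤ KK C s := by
    rw [cj_le_iff]
    exact (BB_le inf_le_right hxK2).trans inf_le_right
  obtain ⟨j, hj⟩ := KK_fg_le h hEfg hEK
  rw [cj_le_iff] at hj
  have hxL : cj x L ≤ L := by
    refine le_inf ((cj_mono x inf_le_left).trans hxC') ?_
    have := cj_mono x (inf_le_right : L ≤ K2)
    rwa [cj_self hxK2] at this
  have hLx := noeth_conj (vp_cj t⁻¹ (vp_cj (s⁻¹ ^ j) hC)) ((le_BB L x).trans hj)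
    (hj (mem_BB L x)) hxL
  have hLx' : cj x⁻¹ L ≤ L := by rwa [cj_le_iff, inv_inv]
  have key : ∀ y ∈ KK C s, y ∈ K2 → y ∈ C' := by
    intro y hy hy2
    obtain ⟨m, hm⟩ := (mem_KK h).1 hy
    have h1 : y ∈ cj (x⁻¹ ^ m) C' := by
      rw [hxm, hC', cj_cj, ← pow_add]
      exact cj_inv_mono h (by nlinarith) hm
    have h2 : y ∈ cj (x⁻¹ ^ m) L := by
      rw [mem_cj] at h1 ⊢
      refine ⟨h1, ?_⟩
      have hxx := Subgroup.pow_mem _ (Subgroup.inv_mem _ hxK2) m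
      exact Subgroup.mul_mem _ (Subgroup.mul_mem _ (Subgroup.inv_mem _ hxx) hy2) hxx
    exact (cj_pow_le hLx' m h2).1
  have hKC : KK C s ≤ C' := by
    intro y hy
    obtain ⟨e, he, -⟩ := Dl_BB hC h (ht _ (KK_le_BB hy))
    have hyk : y * k0 ^ (-(e / p)) ∈ KK C s := Subgroup.mul_mem _ hy (Subgroup.zpow_mem _ hk0 _)
    have hd : Dl C (t * (y * k0 ^ (-(e / p))) * t⁻¹) = a ^ (e % p).toNat := by
      rw [dmul (KK_le_BB hy) (Subgroup.zpow_mem _ hk0B _), dz hk0B, he, hk0', ← zpow_natCast a p,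
        ← zpow_mul, ← zpow_add₀ (by linarith), ← zpow_natCast,
        Int.toNat_of_nonneg (Int.emod_nonneg _ (by omega))]
      congr 1
      have := Int.emod_add_mul_ediv e p
      linarith
    have hlt : e % p < p := Int.emod_lt_of_pos _ (by omega)
    have hr : (e % p).toNat = 0 := by
      by_contra hr
      exact hmin (e % p).toNat (by omega) ⟨by omega, _, hyk, hd⟩
    rw [hr, pow_zero] at hd
    have h1 := key _ hyk (hK2.2 ⟨KK_le_BB hyk, (KK_iff hC h hp (ht _ (KK_le_BB hyk))).2 hd⟩)
    have := Subgroup.mul_mem _ h1 (hu (e / p))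
    simpa using this
  have h1 := (cj_le_KK (C := C) (s := s) (i + 1)).trans hKC
  rw [hC', pow_succ, ← cj_cj] at h1
  have h2 := cj_mono (s⁻¹ ^ i)⁻¹ h1
  simp only [cj_cj, ← mul_assoc, inv_mul_cancel, one_mul, cj_one] at h2
  rw [cj_le_iff, inv_inv] at h2
  exact hp h2

end lemU

def Four (G : Type u) [Group G] : Prop :=
  IsVirtuallyPolycyclic G ∨ ∃ (B : Subgroup G) (t : G),
       IsProperlyAscendingHNN G B t ∧ IsVirtuallyPolycyclic B

section four
variable {G : Type u} [Group G]

theorem cj_le_of {t : G} {B : Subgroup G} (h : ∀ b ∈ B, t * b * t⁻¹ ∈ B) : cj t B ≤ B := by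
  intro x hx
  have := h _ (mem_cj.1 hx)
  simpa [mul_assoc] using this

theorem four_intro {C : Subgroup G} {s : G} (hC : IsVirtuallyPolycyclic C) (h : cj s C ≤ C)
    (hp : ¬ C ≤ cj s C) (hB : BB C s = ⊤) : Four G := by
  refine Or.inr ⟨C, s, ⟨⟨hB, fun b hb => h (cj_mem hb)⟩, ?_⟩, hC⟩
  obtain ⟨b, hb, hb'⟩ := SetLike.not_le_iff_exists.1 hp
  exact ⟨b, hb, fun h => hb' (mem_cj.2 h)⟩

theorem four_asc {B : Subgroup G} {t : G} (h : IsProperlyAscendingHNN G B t) :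
    cj t B ≤ B ∧ ¬ B ≤ cj t B ∧ BB B t = ⊤ := by
  obtain ⟨⟨h1, h2⟩, b, hb, hb'⟩ := h
  exact ⟨cj_le_of h2, fun h => hb' (mem_cj.1 (h hb)), h1⟩

theorem four_sub {H : Subgroup G} (h : Four H) : IsVirtuallyPolycyclic H ∨
    ∃ (C : Subgroup G) (s : G), IsVirtuallyPolycyclic C ∧ cj s C ≤ C ∧ ¬ C ≤ cj s C ∧
      BB C s = H := by
  rcases h with h | ⟨C, s, h, hC⟩
  · exact Or.inl h
  · obtain ⟨h1, h2, h3⟩ := four_asc h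
    have e : cj (s : G) (C.map H.subtype) = (cj s C).map H.subtype := by
      ext x
      rw [mem_cj]
      constructor
      · rintro ⟨y, hy, hy'⟩
        refine ⟨s * y * s⁻¹, cj_mem hy, ?_⟩
        simp only [map_mul, hy', map_inv]
        simp [mul_assoc]
      · rintro ⟨y, hy, rfl⟩
        exact ⟨_, mem_cj.1 hy, by simp⟩
    refine Or.inr ⟨C.map H.subtype, s, ?_, ?_, ?_, ?_⟩
    · exact hC.of_injective (C.equivMapOfInjective _ H.subtype_injective).symm.toMonoidHom
        (MulEquiv.injective _)
    · rw [e]; exact Subgroup.map_mono h1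
    · rw [e, Subgroup.map_le_map_iff_of_injective H.subtype_injective]; exact h2
    · have := congrArg (Subgroup.map H.subtype) h3
      rw [BB, MonoidHom.map_closure, ← MonoidHom.range_eq_map, Subgroup.range_subtype] at this
      rw [BB]
      convert this using 2
      rw [Set.image_union, Set.image_singleton]; rfl

theorem vp_top (h : IsVirtuallyPolycyclic (⊤ : Subgroup G)) : IsVirtuallyPolycyclic G :=
  h.of_injective Subgroup.topEquiv.symm.toMonoidHom (MulEquiv.injective _)

theorem four_top (h : Four (⊤ : Subgroup G)) : Four G := by
  rcases four_sub h with h | ⟨C, s, h1, h2, h3, h4⟩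
  · exact Or.inl (vp_top h)
  · exact four_intro h1 h2 h3 h4

theorem vp_BB {B : Subgroup G} {w : G} (hB : IsVirtuallyPolycyclic B) (h1 : cj w B ≤ B)
    (h2 : B ≤ cj w B) : IsVirtuallyPolycyclic (BB B w) := by
  have hKK : KK B w ≤ B := by
    refine iSup_le fun i => ?_
    refine cj_pow_le ?_ i
    rwa [cj_le_iff, inv_inv]
  have hn : ∀ y ∈ BB B w, ∃ n : ℤ, y * (w ^ n)⁻¹ ∈ B := by
    intro y hy
    obtain ⟨n, k, hk, rfl⟩ := asc_nf h1 hy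
    exact ⟨n, by simpa using hKK hk⟩
  have hnorm : BB B w ≤ Subgroup.normalizer (B : Set G) := by
    refine BB_le Subgroup.le_normalizer ?_
    rw [Subgroup.mem_normalizer_iff]
    intro x
    constructor
    · intro hx; exact h1 (cj_mem hx)
    · intro hx
      have := mem_cj.1 (h2 hx)
      simpa [mul_assoc] using this
  have : (B.subgroupOf (BB B w)).Normal := Subgroup.normal_subgroupOf_of_le_normalizer hnorm
  refine vp_cyc_ext (B.subgroupOf (BB B w)) ?_ (cyc_quot _ ⟨w, mem_BB B w⟩ ?_)
  · exact hB.of_injective (Subgroup.subgroupOfEquivOfLe (le_BB B w)).toMonoidHom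
      (MulEquiv.injective _)
  · rintro ⟨y, hy⟩
    obtain ⟨n, hn⟩ := hn y hy
    exact ⟨n, by rw [Subgroup.mem_subgroupOf]; simpa using hn⟩

theorem four_of_asc {B : Subgroup G} {w : G} (hB : IsVirtuallyPolycyclic B) (h1 : cj w B ≤ B)
    (h2 : BB B w = ⊤) : Four G := by
  by_cases h : B ≤ cj w B
  · have := vp_BB hB h1 h
    rw [h2] at this
    exact Or.inl (vp_top this)
  · exact four_intro hB h1 h h2

theorem bs_ambient (hc : Group.IsHomologicallyCoherent G) (hNF : NoFree G) {A : Type u} [Group A]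
    (f : G →* A) (q : A) (hq : ∀ n : ℤ, q ^ n = 1 → n = 0) (H : Subgroup G) (hH : H.FG)
    (hfH : ∀ h ∈ H, ∃ n : ℤ, f h = q ^ n) (hne : ∃ h ∈ H, f h ≠ 1)
    (C : Subgroup G) (hC : C.FG) (hCH : C ≤ H) (hCk : C ≤ f.ker) :
    ∃ (B : Subgroup G) (w : G), B.FG ∧ C ≤ B ∧ B ≤ f.ker ∧ f w ≠ 1 ∧
      (∀ h ∈ H, ∃ n : ℤ, f h = f w ^ n) ∧ BB B w = H ∧ cj w B ≤ B := by
  have hcyc : IsCyclic (H.map f) := by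
    refine isCyclic_of_injective (Subgroup.inclusion (K := Subgroup.zpowers q) ?_)
      (Subgroup.inclusion_injective _)
    rintro _ ⟨h, hh, rfl⟩
    obtain ⟨n, hn⟩ := hfH h hh
    exact ⟨n, hn.symm⟩
  obtain ⟨⟨_, w, hw, rfl⟩, hgen⟩ := hcyc.exists_generator
  have hgen' : ∀ h ∈ H, ∃ n : ℤ, f h = f w ^ n := by
    intro h hh
    obtain ⟨n, hn⟩ := hgen ⟨f h, h, hh, rfl⟩
    exact ⟨n, (congrArg Subtype.val hn).symm⟩
  have hw1 : f w ≠ 1 := by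
    intro h1
    obtain ⟨h, hh, hne⟩ := hne
    obtain ⟨n, hn⟩ := hgen' h hh
    exact hne (by rw [hn, h1, one_zpow])
  have hw2 : ∀ n : ℤ, f w ^ n = 1 → n = 0 := by
    intro n hn
    obtain ⟨m, hm⟩ := hfH w hw
    rw [hm, ← zpow_mul] at hn
    rcases mul_eq_zero.1 (hq _ hn) with h | h
    · exact absurd (by rw [hm, h, zpow_zero]) hw1
    · exact h
  have hw3 : ∀ m n : ℤ, f w ^ m = f w ^ n → m = n := by
    intro m n h
    have := hw2 (m - n) (by rw [zpow_sub, h, mul_inv_cancel])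
    omega
  choose e he using hgen'
  let χ : H →* Multiplicative ℤ := MonoidHom.mk' (fun h => Multiplicative.ofAdd (e h h.2)) (by
    intro a b
    rw [← ofAdd_add]
    congr 1
    apply hw3
    rw [← he, zpow_add, ← he, ← he]
    simp)
  have hχ : ∀ h : H, h ∈ χ.ker ↔ f h = 1 := by
    intro h
    rw [MonoidHom.mem_ker]
    change Multiplicative.ofAdd (e h h.2) = 1 ↔ _
    rw [ofAdd_eq_one, he h h.2]
    exact ⟨fun h => by rw [h, zpow_zero], hw2 _⟩
  have hHfg : Group.FG H := (Group.fg_iff_subgroup_fg H).2 hH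
  obtain ⟨B, hBfg, hCB, hBk, hBt, hasc⟩ := bieriStrebel hHfg
    (NoFree.of_injective hNF H.subtype H.subtype_injective) (hc H hHfg) χ ⟨w, hw⟩
    (by
      change Multiplicative.ofAdd (e w hw) = _
      congr 1
      apply hw3
      rw [← he w hw, zpow_one]) (C.subgroupOf H)
    (by
      obtain ⟨S, rfl⟩ := hC
      rw [Subgroup.fg_iff]
      refine ⟨H.subtype ⁻¹' S, ?_, S.finite_toSet.preimage H.subtype_injective.injOn⟩
      have hSH : (S : Set G) ⊆ Set.range H.subtype := by
        intro x hx
        exact ⟨⟨x, hCH (Subgroup.subset_closure hx)⟩, rfl⟩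
      apply Subgroup.map_injective H.subtype_injective
      rw [MonoidHom.map_closure, Set.image_preimage_eq_of_subset hSH, Subgroup.map_subgroupOf_eq_of_le hCH])
    (by
      intro h hh
      rw [hχ]
      exact hCk (Subgroup.mem_subgroupOf.1 hh))
  have hBB : BB (B.map H.subtype) w = H := by
    have := congrArg (Subgroup.map H.subtype) hBt
    rw [MonoidHom.map_closure, ← MonoidHom.range_eq_map, Subgroup.range_subtype] at this
    rw [BB]
    convert this using 2
    rw [Set.image_union, Set.image_singleton]; rfl
  have hCB' : C ≤ B.map H.subtype := fun c hc => ⟨⟨c, hCH hc⟩, hCB (Subgroup.mem_subgroupOf.2 hc), rfl⟩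
  have hBk' : B.map H.subtype ≤ f.ker := by
    rintro _ ⟨b, hb, rfl⟩
    exact (hχ b).1 (hBk hb)
  rcases hasc with ha | ha
  · refine ⟨B.map H.subtype, w, map_fg _ hBfg, hCB', hBk', hw1, fun h hh => ⟨_, he h hh⟩, hBB, ?_⟩
    apply cj_le_of
    rintro _ ⟨b, hb, rfl⟩
    exact ⟨_, ha b hb, rfl⟩
  · refine ⟨B.map H.subtype, w⁻¹, map_fg _ hBfg, hCB', hBk', by simpa using hw1,
      fun h hh => ⟨-e h hh, by rw [he h hh]; simp⟩, ?_, ?_⟩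
    · refine Eq.trans ?_ hBB
      apply le_antisymm
      · exact BB_le (le_BB _ _) (Subgroup.inv_mem _ (mem_BB _ _))
      · refine BB_le (le_BB _ _) ?_
        have := Subgroup.inv_mem _ (mem_BB (B.map H.subtype) w⁻¹)
        rwa [inv_inv] at this
    · apply cj_le_of
      rintro _ ⟨b, hb, rfl⟩
      exact ⟨_, ha b hb, by simp⟩

theorem top_fg (hfg : Group.FG G) : (⊤ : Subgroup G).FG := Group.fg_def.1 hfg

theorem LV (hfg : Group.FG G) (hc : Group.IsHomologicallyCoherent G) (hNF : NoFree G)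
    {A : Type u} [Group A]
    (f : G →* A) (q : A) (hq : ∀ n : ℤ, q ^ n = 1 → n = 0) (hf : ∀ g, ∃ n : ℤ, f g = q ^ n)
    (hk : ∀ H : Subgroup G, H.FG → H ≤ f.ker → IsVirtuallyPolycyclic H) : Four G := by
  by_cases h : ∃ g, f g ≠ 1
  · obtain ⟨g, hg⟩ := h
    obtain ⟨B, w, h1, -, h3, -, -, h4, h5⟩ := bs_ambient hc hNF f q hq ⊤ (top_fg hfg)
      (fun g _ => hf g) ⟨g, trivial, hg⟩ ⊥ ⟨∅, by simp⟩ bot_le bot_le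
    exact four_of_asc (hk B h1 h3) h5 h4
  · push Not at h
    exact Or.inl (vp_top (hk ⊤ (top_fg hfg) (fun g _ => h g)))

theorem U_CM {C : Subgroup G} {s : G} (hC : IsVirtuallyPolycyclic C) (h : cj s C ≤ C)
    (hp : ¬ C ≤ cj s C) {t : G} (ht : ∀ y ∈ BB C s, t * y * t⁻¹ ∈ BB C s) : t ∈ CM C := by
  have hU := lemmaU hC h hp ht
  have h1 : cj t C ≤ KK C s := by
    intro x hx
    have := hU _ (le_KK (mem_cj.1 hx))
    simpa [mul_assoc] using this
  obtain ⟨i, hi⟩ := KK_fg_le h (cj_fg t (vp_fg hC)) h1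
  have h2 : cj (s ^ i * t) C ≤ C := by
    rw [← cj_cj, cj_le_iff, ← inv_pow]; exact hi
  have h3 := asc_CM hC h2
  have h4 := (CM C).pow_mem (asc_CM hC h) i
  have := (CM C).mul_mem ((CM C).inv_mem h4) h3
  simpa using this

theorem LVD (hfg : Group.FG G) (hc : Group.IsHomologicallyCoherent G) (hNF : NoFree G)
    {C : Subgroup G} (hCM : ∀ g, g ∈ CM C) (k : ℕ) (hk0 : k ≠ 0) {a : ℚ} (ha : 1 < a)
    (hf : ∀ g, ∃ n : ℤ, Dl C g ^ k = a ^ n)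
    (hk : ∀ H : Subgroup G, H.FG → (∀ h ∈ H, Dl C h = 1) → IsVirtuallyPolycyclic H) : Four G := by
  have ha0 : a ≠ 0 := by linarith
  let D : G →* ℚˣ := MonoidHom.toHomUnits
    { toFun := fun g => Dl C g ^ k
      map_one' := by rw [Dl_self C.one_mem, one_pow]
      map_mul' := fun x y => by rw [Dl_mul (hCM x) (hCM y), mul_pow] }
  have hD : ∀ g, ((D g : ℚˣ) : ℚ) = Dl C g ^ k := fun g => rfl
  refine LV hfg hc hNF (MulEquiv.ulift.symm.toMonoidHom.comp D : G →* ULift.{u} ℚˣ)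
    (MulEquiv.ulift.symm (Units.mk0 a ha0)) ?_ ?_ ?_
  · intro n hn
    rw [← map_zpow, EmbeddingLike.map_eq_one_iff] at hn
    have := congrArg Units.val hn
    simp only [Units.val_zpow_eq_zpow_val, Units.val_mk0, Units.val_one] at this
    exact zpow_inj1 ha (by rw [this, zpow_zero])
  · intro g
    obtain ⟨n, hn⟩ := hf g
    refine ⟨n, ?_⟩
    rw [← map_zpow]
    change MulEquiv.ulift.symm (D g) = _
    congr 1
    apply Units.ext
    simp [hD, hn]
  · intro H hH hHk
    refine hk H hH fun h hh => ?_
    have h1 : MulEquiv.ulift.symm (D h) = 1 := hHk hh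
    rw [EmbeddingLike.map_eq_one_iff] at h1
    have h2 := congrArg Units.val h1
    rw [hD, Units.val_one] at h2
    exact (pow_eq_one_iff_of_nonneg (Dl_pos (hCM h)).le hk0).1 h2

end four

def RR (Q : Type u) [Group Q] : Prop :=
  ∀ (G : Type u) [Group G], Group.FG G → Group.IsHomologicallyCoherent G → NoFree G →
    ∀ f : G →* Q, (∀ H : Subgroup G, H ≤ f.ker → H.FG → Four H) → Four G

theorem RR_finite (Q : Type u) [Group Q] [Finite Q] : RR Q := by
  intro G _ hfg hc hNF f hk
  have hfi : f.ker.FiniteIndex := inferInstance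
  have hNfg : f.ker.FG := (Group.fg_iff_subgroup_fg _).1 inferInstance
  rcases four_sub (hk f.ker le_rfl hNfg) with hvp | ⟨C, s, hC, h, hp, hB⟩
  · exact Or.inl (vp_of_finiteIndex f.ker hvp)
  have hCM : ∀ g, g ∈ CM C := by
    intro g
    refine U_CM hC h hp ?_
    rw [hB]
    intro y hy
    exact (inferInstance : f.ker.Normal).conj_mem y hy g
  refine LVD hfg hc hNF hCM f.ker.index hfi.index_ne_zero (asc_Dl_gt hC h hp) ?_ ?_
  · intro g
    have : g ^ f.ker.index ∈ BB C s := by rw [hB]; exact Subgroup.pow_index_mem _ g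
    obtain ⟨n, hn, -⟩ := Dl_BB hC h this
    exact ⟨n, by rw [← hn, Dl_pow (hCM g)]⟩
  · intro H hH hD
    have hHfg := (Group.fg_iff_subgroup_fg H).2 hH
    have h1 : (f.ker ⊓ H).FG := by
      have : (f.ker.subgroupOf H).FG := (Group.fg_iff_subgroup_fg _).1 inferInstance
      have := map_fg H.subtype this
      rwa [Subgroup.subgroupOf_map_subtype] at this
    have h2 : f.ker ⊓ H ≤ KK C s := by
      intro x hx
      rw [KK_iff hC h hp (by rw [hB]; exact hx.1)]
      exact hD x hx.2
    obtain ⟨n, hn⟩ := KK_fg_le h h1 h2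
    have h3 := vp_mono hn (vp_cj _ hC)
    refine vp_of_finiteIndex (f.ker.subgroupOf H) ?_
    refine h3.of_injective (((f.ker.subgroupOf H).equivMapOfInjective H.subtype
      H.subtype_injective).trans (MulEquiv.subgroupCongr ?_)).toMonoidHom (MulEquiv.injective _)
    exact Subgroup.subgroupOf_map_subtype _ _

theorem den_one {a : ℕ} (ha : 0 < a) {x : ℚ} (h : ∀ n : ℕ, 0 < n → ∃ m : ℤ, (a : ℚ) * x ^ n = m) :
    x.den = 1 := by
  by_contra hd
  have hd2 : 2 ≤ x.den := by have := x.den_pos; omega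
  obtain ⟨m, hm⟩ := h a ha
  have hden : (x.den : ℚ) ≠ 0 := by exact_mod_cast x.den_ne_zero
  have e : (a : ℚ) * x.num ^ a = m * x.den ^ a := by
    rw [← hm]
    nth_rewrite 2 [← Rat.num_div_den x]
    rw [div_pow]; field_simp
  have e' : (a : ℤ) * x.num ^ a = m * (x.den : ℤ) ^ a := by exact_mod_cast e
  have hdvd : (x.den : ℤ) ^ a ∣ (a : ℤ) := by
    have : (x.den : ℤ) ^ a ∣ (a : ℤ) * x.num ^ a := ⟨m, by rw [e']; ring⟩
    refine IsCoprime.dvd_of_dvd_mul_right ?_ this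
    apply IsCoprime.pow
    rw [Int.isCoprime_iff_nat_coprime]
    exact x.reduced.symm
  have hdvd' : x.den ^ a ∣ a := by exact_mod_cast hdvd
  have h1 := Nat.le_of_dvd ha hdvd'
  have h2 : 2 ^ a ≤ x.den ^ a := Nat.pow_le_pow_left hd2 a
  have h3 : a < 2 ^ a := Nat.lt_two_pow_self
  omega

theorem number_lemma {a : ℕ} (ha : 1 < a) {b : ℚ} (hb : 0 < b)
    (h : ∀ i j : ℤ, j ≠ 0 → ∃ n : ℕ, (a : ℚ) ^ i * b ^ j = n ∨ ((a : ℚ) ^ i * b ^ j)⁻¹ = n) :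
    ∃ k : ℕ, k ≠ 0 ∧ ∃ β : ℤ, b ^ k = (a : ℚ) ^ β := by
  obtain ⟨p, hp, hpa⟩ := Nat.exists_prime_and_dvd ha.ne'
  have : Fact p.Prime := ⟨hp⟩
  have ha0 : (a : ℚ) ≠ 0 := by exact_mod_cast (by omega : a ≠ 0)
  set α := padicValNat p a with hα
  have hα0 : α ≠ 0 := by
    have := one_le_padicValNat_of_dvd (by omega) hpa
    omega
  set β := padicValRat p b with hβ
  set x : ℚ := (a : ℚ) ^ (-β) * b ^ α with hx
  have hx0 : 0 < x := by positivity
  have hvx : ∀ (y : ℚ), 0 < y → ∀ n : ℤ, padicValRat p (y ^ n) = n * padicValRat p y := by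
    intro y hy n
    simp
  have hva : padicValRat p (a : ℚ) = α := by rw [padicValRat.of_nat]
  have ha0' : (0 : ℚ) < a := by exact_mod_cast (by omega : 0 < a)
  have vx : padicValRat p x = 0 := by
    rw [hx, padicValRat.mul (by positivity) (by positivity), hvx _ ha0', ← zpow_natCast,
      hvx _ hb, hva, ← hβ]
    ring
  have key : ∀ n : ℤ, n ≠ 0 → ∃ m : ℤ, (a : ℚ) * x ^ n = m := by
    intro n hn
    have e : (a : ℚ) * x ^ n = (a : ℚ) ^ (1 - β * n) * b ^ (α * n) := by
      rw [hx, mul_zpow, ← zpow_mul, ← zpow_natCast, ← zpow_mul, sub_eq_add_neg, zpow_add₀ ha0,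
        zpow_one]
      rw [neg_mul]; ring
    have hv : padicValRat p ((a : ℚ) * x ^ n) = α := by
      rw [padicValRat.mul ha0 (by positivity), hvx _ hx0, vx, hva]; ring
    obtain ⟨m, hm | hm⟩ := h (1 - β * n) (α * n) (mul_ne_zero (by exact_mod_cast hα0) hn)
    · exact ⟨m, by rw [e, hm]; rfl⟩
    · exfalso
      rw [← e] at hm
      have h1 : padicValRat p ((a : ℚ) * x ^ n)⁻¹ = -α := by rw [padicValRat.inv, hv]
      rw [hm, padicValRat.of_nat] at h1
      omega
  have d1 : x.den = 1 := den_one (a := a) (by omega) (fun n hn => by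
    obtain ⟨m, hm⟩ := key n (by omega)
    exact ⟨m, by rw [← hm, zpow_natCast]⟩)
  have d2 : x⁻¹.den = 1 := den_one (a := a) (by omega) (fun n hn => by
    obtain ⟨m, hm⟩ := key (-n) (by omega)
    exact ⟨m, by rw [← hm, zpow_neg, zpow_natCast, inv_pow]⟩)
  have e1 : ((x.num : ℤ) : ℚ) = x := (Rat.den_eq_one_iff x).1 d1
  have e2 : ((x⁻¹.num : ℤ) : ℚ) = x⁻¹ := (Rat.den_eq_one_iff _).1 d2
  have p1 : 1 ≤ x := by
    have : 0 < x.num := Rat.num_pos.2 hx0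
    rw [← e1]; exact_mod_cast this
  have p2 : 1 ≤ x⁻¹ := by
    have : 0 < x⁻¹.num := Rat.num_pos.2 (by positivity)
    rw [← e2]; exact_mod_cast this
  have p3 : x = 1 := le_antisymm (by
    rw [← inv_inv x]; exact inv_le_one_of_one_le₀ p2) p1
  refine ⟨α, hα0, β, ?_⟩
  rw [hx, zpow_neg] at p3
  field_simp at p3
  exact p3

theorem RR_infCyclic (Q : Type u) [Group Q] (q : Q) (hgen : ∀ x : Q, ∃ n : ℤ, x = q ^ n)
    (hq : ∀ n : ℤ, q ^ n = 1 → n = 0) : RR Q := by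
  intro G _ hfg hc hNF f hk
  by_cases hne : ∃ g, f g ≠ 1
  swap
  · push Not at hne
    exact four_top (hk ⊤ (fun g _ => hne g) (top_fg hfg))
  obtain ⟨g0, hg0⟩ := hne
  obtain ⟨B, t, hBfg, -, hBk, hft, hftg, hBB, htB⟩ := bs_ambient hc hNF f q hq ⊤ (top_fg hfg)
      (fun g _ => hgen _) ⟨g0, trivial, hg0⟩ ⊥ ⟨∅, by simp⟩ bot_le bot_le
  have htor : ∀ x : Q, x ≠ 1 → ∀ n : ℤ, x ^ n = 1 → n = 0 := by
    intro x hx n hn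
    obtain ⟨m, rfl⟩ := hgen x
    rw [← zpow_mul] at hn
    rcases mul_eq_zero.1 (hq _ hn) with h | h
    · exact absurd (by rw [h, zpow_zero]) hx
    · exact h
  rcases four_sub (hk B hBk hBfg) with hvp | ⟨C, s, hC, h, hp, hB⟩
  · exact four_of_asc hvp htB hBB
  have hCB : C ≤ B := hB ▸ le_BB C s
  have hsB : s ∈ B := hB ▸ mem_BB C s
  have htCM : t ∈ CM C := by
    refine U_CM hC h hp ?_
    rw [hB]
    intro y hy
    exact htB (cj_mem hy)
  have hCM : ∀ g, g ∈ CM C := by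
    intro g
    have h1 : BB B t ≤ CM C := BB_le (hB ▸ BB_le_CM hC h) htCM
    rw [hBB] at h1
    exact h1 trivial
  have ha := asc_Dl_gt hC h hp
  set a := Dl C s with ha_def
  -- every element
  have hnf : ∀ g, ∃ n : ℤ, ∃ k ∈ KK B t, g = k * t ^ n := fun g => asc_nf htB (by rw [hBB]; trivial)
  have hKf : ∀ k ∈ KK B t, f k = 1 := by
    intro k hk
    obtain ⟨i, hi⟩ := (mem_KK htB).1 hk
    have := hBk (mem_cj.1 hi)
    rw [MonoidHom.mem_ker, map_mul, map_mul, map_inv] at this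
    rw [mul_eq_one_iff_eq_inv, mul_eq_left] at this
    · exact this
  have hker : ∀ g, f g = 1 → g ∈ KK B t := by
    intro g hg
    obtain ⟨n, k, hk, rfl⟩ := hnf g
    rw [map_mul, hKf k hk, one_mul, map_zpow] at hg
    rw [htor _ hft n hg]
    simpa using hk
  -- locally vp
  have hInf : ∀ H : Subgroup G, H.FG → H ≤ f.ker → (∀ x ∈ H, Dl C x = 1) → ∃ g, H ≤ cj g C := by
    intro H hH hHk hHD
    obtain ⟨i, hi⟩ := KK_fg_le htB hH (fun x hx => hker x (hHk hx))
    have h1 : cj (t⁻¹ ^ i)⁻¹ H ≤ KK C s := by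
      intro x hx
      have hx' := mem_cj.1 hx
      have hxB : x ∈ BB C s := by
        rw [hB]
        have h3 := mem_cj.1 (hi hx')
        convert h3 using 1
        group
      rw [KK_iff hC h hp hxB]
      have := hHD _ hx'
      rw [inv_inv, Dl_conj (hCM _) (hCM _)] at this
      exact this
    obtain ⟨j, hj⟩ := KK_fg_le h (cj_fg _ hH) h1
    rw [cj_le_iff, inv_inv, cj_cj] at hj
    exact ⟨_, hj⟩
  -- commensurability
  have hcomm : ∀ E : Subgroup G, E.FG → E ≤ f.ker → (∀ x ∈ E, Dl C x = 1) → C ≤ E →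
      IsVirtuallyPolycyclic E ∧ ∀ g, Dl E g = Dl C g := by
    intro E hE hEk hED hCE
    obtain ⟨g, hg⟩ := hInf E hE hEk hED
    refine ⟨vp_mono hg (vp_cj _ hC), fun x => ?_⟩
    refine (Dl_comm ?_ ?_ (hCM x)).2
    · intro h0
      exact (hCM g).1 (Subgroup.relIndex_eq_zero_of_le_right hg h0)
    · rw [Subgroup.relIndex_eq_one.2 hCE]; simp
  have hCk : C ≤ f.ker := hCB.trans hBk
  have hnum : ∀ w0, f w0 ≠ 1 → ∃ n : ℕ, Dl C w0 = n ∨ (Dl C w0)⁻¹ = n := by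
    intro w0 hw0
    have hHel : ∀ y ∈ BB C w0, ∃ n : ℤ, f y = f w0 ^ n ∧ Dl C y = Dl C w0 ^ n := by
      intro y hy
      unfold BB at hy
      induction hy using Subgroup.closure_induction with
      | mem x hx =>
        rcases hx with hx | rfl
        · exact ⟨0, by rw [zpow_zero]; exact hCk hx, by rw [zpow_zero]; exact Dl_self hx⟩
        · exact ⟨1, by simp, by simp⟩
      | one => exact ⟨0, by simp, by simpa using Dl_self C.one_mem⟩
      | mul x y _ _ hx hy =>
        obtain ⟨n, h1, h2⟩ := hx
        obtain ⟨m, h3, h4⟩ := hy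
        exact ⟨n + m, by rw [map_mul, h1, h3, zpow_add],
          by rw [Dl_mul (hCM _) (hCM _), h2, h4, zpow_add₀ (Dl_pos (hCM _)).ne']⟩
      | inv x _ hx =>
        obtain ⟨n, h1, h2⟩ := hx
        exact ⟨-n, by rw [map_inv, h1, zpow_neg], by rw [Dl_inv (hCM _), h2, zpow_neg]⟩
    obtain ⟨E, w, hE, hCE, hEk, hw, hgenw, hBw, hwE⟩ := bs_ambient hc hNF f q hq (BB C w0)
      (BB_fg (vp_fg hC) w0) (fun g _ => hgen _) ⟨w0, mem_BB _ _, hw0⟩ C (vp_fg hC) (le_BB _ _) hCk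
    have hwH : w ∈ BB C w0 := hBw ▸ mem_BB E w
    have hEH : E ≤ BB C w0 := hBw ▸ le_BB E w
    obtain ⟨n, hn1, hn2⟩ := hHel w hwH
    obtain ⟨m, hm⟩ := hgenw w0 (mem_BB _ _)
    have hnm : n * m - 1 = 0 := by
      apply htor _ hw0
      rw [zpow_sub, zpow_mul, ← hn1, ← hm]; simp
    have hED : ∀ x ∈ E, Dl C x = 1 := by
      intro x hx
      obtain ⟨l, hl1, hl2⟩ := hHel x (hEH hx)
      have : l = 0 := htor _ hw0 l (by rw [← hl1]; exact hEk hx)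
      rw [hl2, this, zpow_zero]
    have h1 := (hcomm E hE hEk hED hCE).2 w
    rw [Dl_le hwE, hn2] at h1
    rcases Int.eq_one_or_neg_one_of_mul_eq_one (by linarith : n * m = 1) with rfl | rfl
    · exact ⟨_, Or.inl (by rw [h1, zpow_one])⟩
    · exact ⟨_, Or.inr (by rw [h1, zpow_neg_one])⟩
  obtain ⟨k, hk0, β, hβ⟩ := number_lemma (a := (cj s C).relIndex C) (b := Dl C t)
    (by rw [ha_def, Dl_le h] at ha; exact_mod_cast ha) (Dl_pos htCM) (by
      intro i j hj
      rw [← Dl_le h, ← Dl_zpow (hCM _), ← Dl_zpow (hCM _), ← Dl_mul (hCM _) (hCM _)]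
      apply hnum
      rw [map_mul, map_zpow, map_zpow, show f s = 1 from hBk hsB, one_zpow, one_mul]
      exact fun h => hj (htor _ hft j h))
  rw [← Dl_le h, ← ha_def] at hβ
  refine LVD hfg hc hNF hCM k hk0 ha ?_ ?_
  · intro g
    obtain ⟨n, x, hx, rfl⟩ := hnf g
    obtain ⟨i, hi⟩ := (mem_KK htB).1 hx
    have hx' := mem_cj.1 hi
    rw [← hB] at hx'
    obtain ⟨m, hm, -⟩ := Dl_BB hC h hx'
    have hxe : Dl C x = a ^ m := by
      rw [← hm]
      have := Dl_conj (hCM ((t⁻¹ ^ i)⁻¹)) (hCM x)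
      rw [inv_inv] at this
      exact this.symm
    refine ⟨m * k + β * n, ?_⟩
    rw [Dl_mul (hCM _) (hCM _), mul_pow, Dl_zpow (hCM _), hxe, zpow_add₀ (by linarith),
      zpow_mul, zpow_mul, ← hβ, zpow_natCast, ← zpow_natCast (Dl C t), ← zpow_natCast (Dl C t ^ n),
      ← zpow_mul, ← zpow_mul, mul_comm n]
  · intro H hH hHD
    have hSD : ∀ x ∈ H ⊔ C, Dl C x = 1 := by
      intro x hx
      rw [← Subgroup.closure_eq H, ← Subgroup.closure_eq C, ← Subgroup.closure_union] at hx
      induction hx using Subgroup.closure_induction with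
      | mem x hx => rcases hx with hx | hx
                    · exact hHD x hx
                    · exact Dl_self hx
      | one => exact Dl_self C.one_mem
      | mul x y _ _ hx hy => rw [Dl_mul (hCM _) (hCM _), hx, hy, one_mul]
      | inv x _ hx => rw [Dl_inv (hCM _), hx, inv_one]
    have hSfg : (H ⊔ C).FG := hH.sup (vp_fg hC)
    refine vp_mono (le_sup_left : H ≤ H ⊔ C) ?_
    by_cases hf1 : ∃ x ∈ H ⊔ C, f x ≠ 1
    · obtain ⟨E, w, hE, hCE, hEk, hw, hgenw, hBw, hwE⟩ := bs_ambient hc hNF f q hq (H ⊔ C)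
        hSfg (fun g _ => hgen _) hf1 C (vp_fg hC) le_sup_right hCk
      obtain ⟨hEvp, hED⟩ := hcomm E hE hEk (fun x hx => hSD x (by
        rw [← hBw]; exact le_BB E w hx)) hCE
      have h1 := hED w
      rw [Dl_le hwE, hSD w (by rw [← hBw]; exact mem_BB E w)] at h1
      have h2 : E ≤ cj w E := Subgroup.relIndex_eq_one.1 (by exact_mod_cast h1)
      rw [← hBw]
      exact vp_BB hEvp hwE h2
    · push Not at hf1
      obtain ⟨g, hg⟩ := hInf _ hSfg hf1 hSD
      exact vp_mono hg (vp_cj _ hC)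

theorem fp2_equiv {G H : Type u} [Group G] [Group H] (e : G ≃* H) (hfg : Group.FG G)
    (h : Group.IsTypeFP2 G) : Group.IsTypeFP2 H := by
  obtain ⟨n, x, hx⟩ := exists_gen_fin hfg
  have hr := relFG_of_fp2 x hx h
  have hx' : Subgroup.closure (Set.range (fun i => e (x i))) = ⊤ := by
    have h1 := congrArg (Subgroup.map e.toMonoidHom) hx
    rw [MonoidHom.map_closure, ← Set.range_comp, Subgroup.map_top_of_surjective _ e.surjective] at h1
    exact h1
  refine fp2_of_relFG (fun i => e (x i)) hx' ?_
  let φ : ZG G ≃+* ZG H := MonoidAlgebra.mapDomainRingEquiv ℤ e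
  have hφ : ∀ g, φ (gel g) = gel (e g) := by intro g; simp [φ, gel]
  have : RingHomSurjective (φ : ZG G →+* ZG H) := ⟨φ.surjective⟩
  let L : (Fin n → ZG G) →ₛₗ[(φ : ZG G →+* ZG H)] (Fin n → ZG H) :=
    { toFun := fun v i => φ (v i)
      map_add' := by intro v w; ext1 i; simp
      map_smul' := by intro v w; ext1 i; simp }
  have hL : ∀ v, foxMap (fun i => e (x i)) (L v) = φ (foxMap x v) := by
    intro v
    rw [foxMap_apply, foxMap_apply, map_sum]
    refine Finset.sum_congr rfl fun i _ => ?_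
    rw [map_mul, map_sub, hφ, map_one]; rfl
  have hm := hr.map L
  convert hm using 1
  ext v
  rw [Submodule.mem_map, LinearMap.mem_ker]
  constructor
  · intro hv
    refine ⟨fun i => φ.symm (v i), ?_, ?_⟩
    · have : L (fun i => φ.symm (v i)) = v := by ext1 i; simp [L]
      have h2 := hL (fun i => φ.symm (v i))
      rw [this, hv] at h2
      rw [LinearMap.mem_ker]
      exact (map_eq_zero_iff φ φ.injective).1 h2.symm
    · ext1 i; simp [L]
  · rintro ⟨w, hw, rfl⟩
    rw [hL, LinearMap.mem_ker.1 hw, map_zero]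

theorem hc_sub {G : Type u} [Group G] (h : Group.IsHomologicallyCoherent G) (H : Subgroup G) :
    Group.IsHomologicallyCoherent H := by
  intro K hK
  have e : K ≃* K.map H.subtype := K.equivMapOfInjective H.subtype H.subtype_injective
  have h1 : Group.FG (K.map H.subtype) := Group.fg_of_surjective (f := e.toMonoidHom) e.surjective
  exact fp2_equiv e.symm h1 (h _ h1)

theorem vp_equiv {G H : Type u} [Group G] [Group H] (e : G ≃* H) (h : IsVirtuallyPolycyclic G) :
    IsVirtuallyPolycyclic H := IsVirtuallyPolycyclic.of_injective h e.symm.toMonoidHom e.symm.injective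

theorem Four.of_equiv {G H : Type u} [Group G] [Group H] (e : G ≃* H) (h : Four G) : Four H := by
  rcases h with h | ⟨B, t, ⟨⟨h1, h2⟩, b, hb, hb'⟩, hB⟩
  · exact Or.inl (vp_equiv e h)
  · refine Or.inr ⟨B.map e.toMonoidHom, e t, ⟨⟨?_, ?_⟩, e b, ⟨b, hb, rfl⟩, ?_⟩,
      vp_equiv (B.equivMapOfInjective _ e.injective) hB⟩
    · have h3 := congrArg (Subgroup.map e.toMonoidHom) h1
      rw [MonoidHom.map_closure, Subgroup.map_top_of_surjective _ e.surjective] at h3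
      rw [← h3, Set.image_union, Set.image_singleton]
      rfl
    · rintro _ ⟨b, hb, rfl⟩
      exact ⟨t * b * t⁻¹, h2 b hb, by simp⟩
    · rintro ⟨c, hc, hc'⟩
      apply hb'
      have : c = t⁻¹ * b * t := e.injective (by simpa using hc')
      rwa [← this]

theorem RR_of_injective {Q Q' : Type u} [Group Q] [Group Q'] (hQ : RR Q) (j : Q' →* Q)
    (hj : Function.Injective j) : RR Q' := by
  intro G _ hfg hc hNF f hk
  refine hQ G hfg hc hNF (j.comp f) fun H hH hHf => hk H (fun x hx => ?_) hHf
  have := hH hx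
  rw [MonoidHom.mem_ker] at this ⊢
  exact hj (by simpa using this)

/-- apply `RR` to a subgroup -/
theorem RR_sub {Q G : Type u} [Group Q] [Group G] (hQ : RR Q) (hc : Group.IsHomologicallyCoherent G)
    (hNF : NoFree G) (H : Subgroup G) (hH : H.FG) (f : H →* Q)
    (hk : ∀ K : Subgroup G, K ≤ H → (∀ x (hx : x ∈ H), x ∈ K → f ⟨x, hx⟩ = 1) → K.FG → Four K) :
    Four H := by
  refine hQ H ((Group.fg_iff_subgroup_fg H).2 hH) (hc_sub hc H) (hNF.of_injective _ H.subtype_injective) f ?_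
  intro K hK hKf
  have e : K ≃* K.map H.subtype := K.equivMapOfInjective H.subtype H.subtype_injective
  refine Four.of_equiv e.symm (hk _ ?_ ?_ (map_fg _ hKf))
  · rintro _ ⟨y, -, rfl⟩; exact y.2
  · rintro _ hx ⟨y, hy, rfl⟩
    exact hK hy

theorem RR_ext {Q : Type u} [Group Q] (N : Subgroup Q) [N.Normal] (h1 : RR N) (h2 : RR (Q ⧸ N)) :
    RR Q := by
  intro G _ hfg hc hNF f hk
  refine h2 G hfg hc hNF ((QuotientGroup.mk' N).comp f) fun H hH hHf => ?_
  have hm : ∀ x : H, (f.comp H.subtype) x ∈ N := by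
    intro x
    have := hH x.2
    rw [MonoidHom.mem_ker] at this
    exact (QuotientGroup.eq_one_iff _).1 this
  refine RR_sub h1 hc hNF H hHf ((f.comp H.subtype).codRestrict N hm) ?_
  intro K hKH hK hKf
  refine hk K (fun x hx => ?_) hKf
  have := hK x (hKH hx) hx
  exact congrArg Subtype.val this

theorem RR_directed {Q : Type u} [Group Q] {ι : Type v} (S : ι → Subgroup Q)
    (hdir : Directed (· ≤ ·) S) (hcov : ∀ g : Q, ∃ i, g ∈ S i) (h : ∀ i, RR (S i)) : RR Q := by
  intro G _ hfg hc hNF f hk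
  obtain ⟨n, x, hx⟩ := exists_gen_fin hfg
  have : ∃ i, ∀ k, f (x k) ∈ S i := by
    choose c hcc using fun k => hcov (f (x k))
    have : Nonempty ι := ⟨(hcov 1).choose⟩
    obtain ⟨i, hi⟩ := hdir.finite_le c
    exact ⟨i, fun k => hi k (hcc k)⟩
  obtain ⟨i, hi⟩ := this
  have hm : ∀ g, f g ∈ S i := by
    have : (⊤ : Subgroup G) ≤ (S i).comap f := by
      rw [← hx, Subgroup.closure_le]
      rintro _ ⟨k, rfl⟩; exact hi k
    exact fun g => this (Subgroup.mem_top g)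
  refine h i G hfg hc hNF (f.codRestrict (S i) hm) fun H hH hHf => hk H (fun y hy => ?_) hHf
  exact congrArg Subtype.val (hH hy)

theorem RR_zpowers {Q : Type u} [Group Q] (q : Q) (hgen : ∀ x, ∃ n : ℤ, x = q ^ n) : RR Q := by
  by_cases h : IsOfFinOrder q
  · have hf : Finite (Subgroup.zpowers q) := finite_zpowers.2 h
    have : Finite Q := by
      refine Finite.of_surjective (fun x : Subgroup.zpowers q => (x : Q)) fun x => ?_
      obtain ⟨n, rfl⟩ := hgen x
      exact ⟨⟨q ^ n, n, rfl⟩, rfl⟩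
    exact RR_finite Q
  · refine RR_infCyclic Q q hgen fun n hn => ?_
    by_contra h0
    exact h (isOfFinOrder_iff_zpow_eq_one.2 ⟨n, h0, hn⟩)

theorem RR_comm {Q : Type u} [Group Q] (hcomm : ∀ a b : Q, a * b = b * a) : RR Q := by
  classical
  have key : ∀ S : Finset Q, RR (Subgroup.closure (S : Set Q)) := by
    intro S
    induction S using Finset.induction_on with
    | empty =>
      have : Finite (Subgroup.closure ((∅ : Finset Q) : Set Q)) := by
        rw [Finset.coe_empty, Subgroup.closure_empty]; infer_instance
      exact RR_finite _
    | insert a S _ ih =>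
      set A := Subgroup.closure ((insert a S : Finset Q) : Set Q) with hA
      set B := Subgroup.closure (S : Set Q) with hB
      have hn : (B.subgroupOf A).Normal := ⟨fun x hx g => by
        have : g * x * g⁻¹ = x := by
          apply Subtype.ext; simp [hcomm (g : Q) x]
        rwa [this]⟩
      refine RR_ext (B.subgroupOf A) ?_ ?_
      · exact RR_of_injective ih ((A.subtype.comp (B.subgroupOf A).subtype).codRestrict B
          fun x => x.2)
          (fun x y hxy => Subtype.ext (Subtype.ext (congrArg (fun z : B => (z : Q)) hxy)))
      · have ha : a ∈ A := Subgroup.subset_closure (by simp)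
        refine RR_zpowers (QuotientGroup.mk ⟨a, ha⟩ : A ⧸ B.subgroupOf A) fun x => ?_
        obtain ⟨⟨y, hy⟩, rfl⟩ := QuotientGroup.mk_surjective x
        have hy' := hy
        rw [hA, Finset.coe_insert] at hy'
        have : ∃ n : ℤ, a ^ (-n) * y ∈ B := by
          induction hy' using Subgroup.closure_induction with
          | mem z hz =>
            rcases hz with rfl | hz
            · exact ⟨1, by simp [B.one_mem]⟩
            · exact ⟨0, by simpa using Subgroup.subset_closure hz⟩
          | one => exact ⟨0, by simp [B.one_mem]⟩
          | mul u v hu hv h1 h2 =>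
            have e : insert a (S : Set Q) = ((insert a S : Finset Q) : Set Q) := by simp
            rw [e] at hu hv
            obtain ⟨n, hn⟩ := h1 hu
            obtain ⟨m, hm⟩ := h2 hv
            refine ⟨n + m, ?_⟩
            have := B.mul_mem hn hm
            have e2 : a ^ (-(n + m)) * (u * v) = a ^ (-n) * u * (a ^ (-m) * v) := by
              rw [neg_add, zpow_add, mul_assoc, mul_assoc, ← mul_assoc u, hcomm u (a ^ (-m)), mul_assoc]
            rwa [e2]
          | inv u hu h1 =>
            have e : insert a (S : Set Q) = ((insert a S : Finset Q) : Set Q) := by simp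
            rw [e] at hu
            obtain ⟨n, hn⟩ := h1 hu
            refine ⟨-n, ?_⟩
            have := B.inv_mem hn
            rw [mul_inv_rev, hcomm] at this
            simpa using this
        obtain ⟨n, hn⟩ := this
        refine ⟨n, ?_⟩
        rw [← QuotientGroup.mk_zpow, eq_comm, QuotientGroup.eq, Subgroup.mem_subgroupOf]
        simpa using hn
  refine RR_directed (fun S : Finset Q => Subgroup.closure (S : Set Q)) ?_ ?_ key
  · intro S T
    exact ⟨S ∪ T, Subgroup.closure_mono (by simp), Subgroup.closure_mono (by simp)⟩
  · intro g
    exact ⟨{g}, Subgroup.subset_closure (by simp)⟩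

theorem RR_of_EA {Q : Type u} [Group Q] (h : ElementaryAmenable Q) : RR Q := by
  induction h with
  | of_finite G h => exact RR_finite G
  | of_comm G h => exact RR_comm h
  | of_mulEquiv G H e h ih => exact RR_of_injective ih e.symm.toMonoidHom e.symm.injective
  | of_extension G N hN h1 h2 ih1 ih2 => exact RR_ext N ih1 ih2
  | of_directedUnion G ι S hdir hcov h ih => exact RR_directed S hdir hcov ih

theorem four_of_hc {G : Type u} [Group G] (hEA : ElementaryAmenable G) (hfg : Group.FG G)
    (hc : Group.IsHomologicallyCoherent G) : Four G := by
  refine RR_of_EA hEA G hfg hc (NoFree.of_elementaryAmenable hEA) (MonoidHom.id G) fun H hH _ => ?_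
  have : Subsingleton H := by
    refine ⟨fun a b => Subtype.ext ?_⟩
    have h1 : (a : G) = 1 := hH a.2
    have h2 : (b : G) = 1 := hH b.2
    rw [h1, h2]
  refine Or.inl ⟨⊤, inferInstance, IsPolycyclic.of_subsingleton _ ?_⟩
  exact ⟨fun a b => Subtype.ext (Subsingleton.elim _ _)⟩

theorem fp_main {G : Type u} [Group G] (D : Subgroup G) [Group.IsFinitelyPresented D] (hD : D.FG)
    {ι : Type} [Finite ι] (x : ι → G) (hx : ∀ i, ∀ d ∈ D, x i * d * (x i)⁻¹ ∈ D)
    (hgen : Subgroup.closure ((D : Set G) ∪ Set.range x) = ⊤)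
    (W' : Set (Monoid.Coprod D (FreeGroup ι))) (hW' : W'.Finite)
    (hWk : ∀ w ∈ W', Monoid.Coprod.lift D.subtype (FreeGroup.lift x) w = 1)
    (H : ∀ (P : Type u) [Group P] (J : D →* P) (s : ι → P) (ρ : P →* G), (∀ d, ρ (J d) = d) →
      (∀ i, ρ (s i) = x i) → Subgroup.closure (Set.range J ∪ Set.range s) = ⊤ →
      (∀ i d, s i * J d = J ⟨x i * d * (x i)⁻¹, hx i d d.2⟩ * s i) →
      (∀ w ∈ W', Monoid.Coprod.lift J (FreeGroup.lift s) w = 1) → ∀ p, ρ p = 1 → p = 1) :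
    Group.IsFinitelyPresented G := by
  classical
  let π : Monoid.Coprod D (FreeGroup ι) →* G := Monoid.Coprod.lift D.subtype (FreeGroup.lift x)
  let iD : D →* Monoid.Coprod D (FreeGroup ι) := Monoid.Coprod.inl
  let y : ι → Monoid.Coprod D (FreeGroup ι) := fun i => Monoid.Coprod.inr (FreeGroup.of i)
  have hπD : ∀ d, π (iD d) = d := fun d => by simp [π, iD]
  have hπy : ∀ i, π (y i) = x i := fun i => by simp [π, y]
  have hDfg := (Group.fg_iff_subgroup_fg D).2 hD
  obtain ⟨n, e, he⟩ := exists_gen_fin hDfg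
  let r : ι × Fin n → Monoid.Coprod D (FreeGroup ι) := fun p =>
    y p.1 * iD (e p.2) * (y p.1)⁻¹ * (iD ⟨x p.1 * e p.2 * (x p.1)⁻¹, hx p.1 _ (e p.2).2⟩)⁻¹
  let W : Set (Monoid.Coprod D (FreeGroup ι)) := W' ∪ Set.range r
  have hWfin : W.Finite := hW'.union (Set.finite_range r)
  have hWker : ∀ w ∈ W, π w = 1 := by
    rintro w (hw | ⟨p, rfl⟩)
    · exact hWk w hw
    · simp only [r, map_mul, map_inv, hπD, hπy]; group
  let N := Subgroup.normalClosure W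
  have hNker : N ≤ π.ker := Subgroup.normalClosure_le_normal fun w hw => hWker w hw
  let q : Monoid.Coprod D (FreeGroup ι) →* Monoid.Coprod D (FreeGroup ι) ⧸ N := QuotientGroup.mk' N
  let ρ : Monoid.Coprod D (FreeGroup ι) ⧸ N →* G := QuotientGroup.lift N π fun w hw => hNker hw
  have hρ : ∀ c, ρ (q c) = π c := fun c => rfl
  have hq1 : ∀ w ∈ W, q w = 1 := fun w hw => (QuotientGroup.eq_one_iff w).2 (Subgroup.subset_normalClosure hw)
  have hCgen : Subgroup.closure (Set.range iD ∪ Set.range y) = ⊤ := by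
    have h1 := Monoid.Coprod.range_inl_sup_range_inr (G := D) (H := FreeGroup ι)
    rw [eq_top_iff, ← h1, sup_le_iff]
    constructor
    · rintro _ ⟨d, rfl⟩
      exact Subgroup.subset_closure (Or.inl ⟨d, rfl⟩)
    · rintro _ ⟨w, rfl⟩
      induction w using FreeGroup.induction_on with
      | C1 => rw [map_one]; exact Subgroup.one_mem _
      | of i => exact Subgroup.subset_closure (Or.inr ⟨i, rfl⟩)
      | inv_of i h => rw [map_inv]; exact Subgroup.inv_mem _ h
      | mul a b ha hb => rw [map_mul]; exact Subgroup.mul_mem _ ha hb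
  have hs : Function.Surjective π := by
    rw [← MonoidHom.range_eq_top, eq_top_iff, ← hgen, Subgroup.closure_le]
    rintro _ (hd | ⟨i, rfl⟩)
    · exact ⟨iD ⟨_, hd⟩, hπD _⟩
    · exact ⟨y i, hπy i⟩
  have hrel : ∀ i (d : D), q (y i) * q (iD d) =
      q (iD ⟨x i * d * (x i)⁻¹, hx i d d.2⟩) * q (y i) := by
    intro i d
    let θ : D →* D := MonoidHom.mk' (fun d => ⟨x i * d * (x i)⁻¹, hx i d d.2⟩) (by
      intro a b; apply Subtype.ext; simp)
    have : (MulAut.conj (q (y i))).toMonoidHom.comp (q.comp iD) = (q.comp iD).comp θ := by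
      apply MonoidHom.eq_of_eqOn_dense he
      rintro _ ⟨k, rfl⟩
      have h1 := hq1 (r (i, k)) (Or.inr ⟨_, rfl⟩)
      simp only [r, map_mul, map_inv] at h1
      exact mul_inv_eq_one.1 h1
    have h2 := DFunLike.congr_fun this d
    have h3 : q (y i) * q (iD d) * (q (y i))⁻¹ = q (iD ⟨x i * d * (x i)⁻¹, hx i d d.2⟩) := h2
    rw [← h3]; group
  have hqW : ∀ w ∈ W', Monoid.Coprod.lift (q.comp iD) (FreeGroup.lift fun i => q (y i)) w = 1 := by
    have : Monoid.Coprod.lift (q.comp iD) (FreeGroup.lift fun i => q (y i)) = q := by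
      apply Monoid.Coprod.hom_ext
      · ext d; simp [iD]
      · ext i; simp [y]
    rw [this]
    exact fun w hw => hq1 w (Or.inl hw)
  have hinj := H (Monoid.Coprod D (FreeGroup ι) ⧸ N) (q.comp iD) (fun i => q (y i)) ρ (fun d => hπD d) (fun i => hπy i) (by
    have := congrArg (Subgroup.map q) hCgen
    rw [MonoidHom.map_closure, Subgroup.map_top_of_surjective _ (QuotientGroup.mk'_surjective N),
      Set.image_union, ← Set.range_comp, ← Set.range_comp] at this
    exact this) hrel hqW
  refine Group.IsFinitelyPresented.of_surjective π hs ⟨W, hWfin, le_antisymm hNker ?_⟩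
  intro c hc
  exact (QuotientGroup.eq_one_iff c).1 (hinj (q c) hc)

theorem fp_asc {G : Type u} [Group G] (D : Subgroup G) [Group.IsFinitelyPresented D] (hD : D.FG)
    (h : G) (hh : ∀ d ∈ D, h * d * h⁻¹ ∈ D) (hgen : BB D h = ⊤) : Group.IsFinitelyPresented G := by
  classical
  obtain ⟨m0, hm0⟩ : ∃ m0 : ℤ, ∀ n : ℤ, h ^ n ∈ D ↔ ∃ k : ℤ, n = k * m0 := by
    let A : AddSubgroup ℤ :=
      { carrier := {n | h ^ n ∈ D}
        zero_mem' := by simp [D.one_mem]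
        add_mem' := by intro a b ha hb; simp only [Set.mem_ofPred_eq, zpow_add] at *; exact D.mul_mem ha hb
        neg_mem' := by intro a ha; simp only [Set.mem_ofPred_eq, zpow_neg] at *; exact D.inv_mem ha }
    obtain ⟨m0, hm⟩ := Int.subgroup_cyclic A
    refine ⟨m0, fun n => ?_⟩
    have : n ∈ A ↔ n ∈ AddSubgroup.closure {m0} := by rw [hm]
    rw [AddSubgroup.mem_closure_singleton] at this
    refine Iff.trans this ⟨?_, ?_⟩
    · rintro ⟨k, rfl⟩; exact ⟨k, by simp⟩
    · rintro ⟨k, rfl⟩; exact ⟨k, by simp⟩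
  have hm : h ^ m0 ∈ D := (hm0 _).2 ⟨1, by simp⟩
  refine fp_main D hD (ι := Unit) (fun _ => h) (fun _ => hh) (by rw [Set.range_const]; exact hgen)
    {Monoid.Coprod.inr (FreeGroup.of ()) ^ m0 * (Monoid.Coprod.inl ⟨h ^ m0, hm⟩)⁻¹}
    (Set.finite_singleton _) ?_ ?_
  · rintro _ rfl; simp
  · intro P _ J s' ρ hJ hs hcl hrel hW p hp
    obtain ⟨s, rfl⟩ : ∃ s, s' = fun _ => s := ⟨s' (), rfl⟩
    have hw := hW _ rfl
    simp only [map_mul, map_zpow, Monoid.Coprod.lift_apply_inr, FreeGroup.lift_apply_of, map_inv,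
      Monoid.Coprod.lift_apply_inl, mul_inv_eq_one] at hw
    have hrel := hrel ()
    have hs := hs ()
    dsimp only at hrel hs
    have hsp : ∀ (i : ℕ) (d : D), ∃ d' : D, s ^ i * J d = J d' * s ^ i := by
      intro i
      induction i with
      | zero => intro d; exact ⟨d, by simp⟩
      | succ i ih =>
        intro d
        obtain ⟨d', hd'⟩ := ih ⟨h * d * h⁻¹, hh d d.2⟩
        exact ⟨d', by rw [pow_succ, mul_assoc, hrel, ← mul_assoc, hd', mul_assoc]⟩
    have nf : ∀ p : P, ∃ (i k : ℕ) (d : D), p = (s ^ i)⁻¹ * J d * s ^ k := by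
      intro p
      have hp : p ∈ Subgroup.closure (Set.range J ∪ Set.range fun _ : Unit => s) := by rw [hcl]; trivial
      have hJm : ∀ (d' : D) (p : P), (∃ (i k : ℕ) (d : D), p = (s ^ i)⁻¹ * J d * s ^ k) →
          ∃ (i k : ℕ) (d : D), J d' * p = (s ^ i)⁻¹ * J d * s ^ k := by
        rintro d' _ ⟨i, k, d, rfl⟩
        obtain ⟨d'', hd⟩ := hsp i d'
        refine ⟨i, k, d'' * d, ?_⟩
        have : J d' * (s ^ i)⁻¹ = (s ^ i)⁻¹ * J d'' := by
          rw [mul_inv_eq_iff_eq_mul, mul_assoc, ← hd]; group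
        rw [map_mul, ← mul_assoc, ← mul_assoc, this, mul_assoc _ (J d'')]
      induction hp using Subgroup.closure_induction_left with
      | one => exact ⟨0, 0, 1, by simp⟩
      | mul_left a ha b hb ih =>
        rcases ha with ⟨d', rfl⟩ | ⟨_, rfl⟩
        · exact hJm d' _ ih
        · obtain ⟨i, k, d, rfl⟩ := ih
          cases i with
          | zero =>
            refine ⟨0, k + 1, ⟨h * d * h⁻¹, hh d d.2⟩, ?_⟩
            simp only [pow_zero, inv_one, one_mul]
            rw [← mul_assoc, hrel, pow_succ', mul_assoc]
          | succ i =>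
            refine ⟨i, k, d, ?_⟩
            rw [pow_succ]; group
      | inv_mul_cancel a ha b hb ih =>
        rcases ha with ⟨d', rfl⟩ | ⟨_, rfl⟩
        · rw [← map_inv]; exact hJm d'⁻¹ _ ih
        · obtain ⟨i, k, d, rfl⟩ := ih
          refine ⟨i + 1, k, d, ?_⟩
          rw [pow_succ]; group
    obtain ⟨i, k, d, rfl⟩ := nf p
    simp only [map_mul, map_inv, map_pow, hs, hJ] at hp
    have hd : (d : G) = h ^ ((i : ℤ) - k) := by
      have : (d : G) = h ^ i * ((h ^ i)⁻¹ * d * h ^ k) * (h ^ k)⁻¹ := by group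
      rw [this, hp, zpow_sub]; simp
    obtain ⟨c, hc⟩ := (hm0 ((i : ℤ) - k)).1 (hd ▸ d.2)
    have hd2 : d = (⟨h ^ m0, hm⟩ : D) ^ c := by
      apply Subtype.ext
      rw [hd, hc, mul_comm, zpow_mul]; rfl
    rw [hd2, map_zpow, ← hw, ← zpow_mul, mul_comm, ← hc, zpow_sub]
    simp

theorem fp_fin {G : Type u} [Group G] (D : Subgroup G) [D.Normal] [Group.IsFinitelyPresented D] (hD : D.FG)
    (hfin : Finite (G ⧸ D)) : Group.IsFinitelyPresented G := by
  classical
  obtain ⟨n, ⟨e⟩⟩ := Finite.exists_equiv_fin (G ⧸ D)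
  have hnorm : ∀ g : G, ∀ d ∈ D, g * d * g⁻¹ ∈ D := fun g d hd => ‹D.Normal›.conj_mem d hd g
  let x : Fin n → G := fun i => (e.symm i).out
  have hx : ∀ i, ((x i : G) : G ⧸ D) = e.symm i := fun i => Quotient.out_eq' _
  let m : Fin n → Fin n → Fin n := fun i j => e (e.symm i * e.symm j)
  have hm : ∀ i j, x i * x j * (x (m i j))⁻¹ ∈ D := by
    intro i j
    rw [← QuotientGroup.eq_one_iff]
    simp only [QuotientGroup.mk_mul, QuotientGroup.mk_inv, hx, m]; simp
  let o : Fin n := e 1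
  let iv : Fin n → Fin n := fun i => e (e.symm i)⁻¹
  have hcov : ∀ g : G, ∃ i, g * (x i)⁻¹ ∈ D := by
    intro g
    refine ⟨e g, ?_⟩
    rw [← QuotientGroup.eq_one_iff]
    simp only [QuotientGroup.mk_mul, QuotientGroup.mk_inv, hx]; simp
  have ho : ∀ i, x i ∈ D → i = o := by
    intro i hi
    rw [← QuotientGroup.eq_one_iff, hx] at hi
    simp [o, ← hi]
  refine fp_main D hD x (fun i => hnorm (x i)) ?_ (Set.range fun p : Fin n × Fin n =>
    Monoid.Coprod.inr (FreeGroup.of p.1) * Monoid.Coprod.inr (FreeGroup.of p.2) *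
      (Monoid.Coprod.inl ⟨_, hm p.1 p.2⟩ * Monoid.Coprod.inr (FreeGroup.of (m p.1 p.2)))⁻¹)
    (Set.finite_range _) ?_ ?_
  · rw [eq_top_iff]
    intro g _
    obtain ⟨i, hi⟩ := hcov g
    have : g = g * (x i)⁻¹ * x i := by group
    rw [this]
    exact Subgroup.mul_mem _ (Subgroup.subset_closure (Or.inl hi)) (Subgroup.subset_closure (Or.inr ⟨i, rfl⟩))
  · rintro _ ⟨p, rfl⟩
    simp
  · intro P _ J s ρ hJ hs hcl hrel hW p hp
    have hW : ∀ i j, s i * s j = J ⟨_, hm i j⟩ * s (m i j) := by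
      intro i j
      have := hW _ ⟨(i, j), rfl⟩
      simp only [map_mul, map_inv, Monoid.Coprod.lift_apply_inr, FreeGroup.lift_apply_of,
        Monoid.Coprod.lift_apply_inl] at this
      exact mul_inv_eq_one.1 this
    have hso : ∃ d, s o = J d := by
      obtain ⟨d, this⟩ : ∃ d, s o * s o = J d * s (m o o) := ⟨_, hW o o⟩
      have hoo : m o o = o := by simp [m, o]
      rw [hoo] at this
      exact ⟨_, mul_right_cancel this⟩
    obtain ⟨d0, hd0⟩ := hso
    have hinv : ∀ i, ∃ d, (s i)⁻¹ = J d * s (iv i) := by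
      intro i
      obtain ⟨d, this⟩ : ∃ d, s (iv i) * s i = J d * s (m (iv i) i) := ⟨_, hW (iv i) i⟩
      have hoo : m (iv i) i = o := by simp [m, o, iv]
      rw [hoo, hd0, ← map_mul] at this
      refine ⟨(d * d0)⁻¹, ?_⟩
      · rw [eq_comm, ← mul_eq_one_iff_eq_inv, mul_assoc, this, ← map_mul, inv_mul_cancel, map_one]
    have nf : ∀ p : P, ∃ (i : Fin n) (d : D), p = J d * s i := by
      intro p
      have hp : p ∈ Subgroup.closure (Set.range J ∪ Set.range s) := by rw [hcl]; trivial
      have hsm : ∀ (j : Fin n) (p : P), (∃ (i : Fin n) (d : D), p = J d * s i) →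
          ∃ (i : Fin n) (d : D), s j * p = J d * s i := by
        rintro j _ ⟨i, d, rfl⟩
        refine ⟨m j i, ⟨x j * d * (x j)⁻¹, hnorm _ _ d.2⟩ * ⟨_, hm j i⟩, ?_⟩
        rw [map_mul, mul_assoc, ← hW, ← mul_assoc, ← mul_assoc, hrel]
      have hJm : ∀ (d : D) (p : P), (∃ (i : Fin n) (d : D), p = J d * s i) →
          ∃ (i : Fin n) (d' : D), J d * p = J d' * s i := by
        rintro d' _ ⟨i, d, rfl⟩
        exact ⟨i, d' * d, by rw [map_mul, mul_assoc]⟩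
      induction hp using Subgroup.closure_induction_left with
      | one => exact ⟨o, d0⁻¹, by rw [hd0, ← map_mul]; simp⟩
      | mul_left a ha b hb ih =>
        rcases ha with ⟨d', rfl⟩ | ⟨j, rfl⟩
        · exact hJm d' _ ih
        · exact hsm j _ ih
      | inv_mul_cancel a ha b hb ih =>
        rcases ha with ⟨d', rfl⟩ | ⟨j, rfl⟩
        · rw [← map_inv]; exact hJm d'⁻¹ _ ih
        · obtain ⟨d, hd⟩ := hinv j
          rw [hd, mul_assoc]
          exact hJm d _ (hsm _ _ ih)
    obtain ⟨i, d, rfl⟩ := nf p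
    rw [map_mul, hJ, hs] at hp
    have : i = o := ho i (by rw [← inv_eq_of_mul_eq_one_right hp]; exact D.inv_mem d.2)
    subst this
    rw [hd0, ← map_mul]
    have : d * d0 = 1 := by
      apply Subtype.ext
      have h1 := hs o
      rw [hd0, hJ] at h1
      rw [Subgroup.coe_mul, h1, hp]; rfl
    rw [this, map_one]

theorem fp_of_vp {G : Type u} [Group G] (hG : IsVirtuallyPolycyclic G) : Group.IsFinitelyPresented G := by
  have : Group.FG G ∧ Group.IsFinitelyPresented G := by
    refine vp_induction (P := fun G _ => Group.FG G ∧ Group.IsFinitelyPresented G) ?_ ?_ ?_ hG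
    · intro G _ h
      have : Finite G := inferInstance
      exact ⟨inferInstance, inferInstance⟩
    · rintro G _ N _ ⟨h1, h2⟩ hc
      obtain ⟨t, ht⟩ := cyc_gen N hc
      have hN : N.FG := (Group.fg_iff_subgroup_fg N).1 h1
      have hBB : BB N t = ⊤ := by
        rw [eq_top_iff]
        intro g _
        obtain ⟨n, hn⟩ := ht g
        have : g = g * (t ^ n)⁻¹ * t ^ n := by group
        rw [this]
        exact Subgroup.mul_mem _ (le_BB N t hn) (Subgroup.zpow_mem _ (mem_BB N t) n)
      refine ⟨?_, fp_asc N hN t (fun d hd => ‹N.Normal›.conj_mem d hd t) hBB⟩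
      have := BB_fg hN t
      rw [hBB] at this
      exact ⟨this⟩
    · rintro G _ N _ ⟨h1, h2⟩ hf
      have hN : N.FG := (Group.fg_iff_subgroup_fg N).1 h1
      have h3 := fp_fin N hN hf
      refine ⟨?_, h3⟩
      obtain ⟨n, φ, hφ, -⟩ := h3.out
      exact Group.fg_of_surjective hφ
  exact this.2

theorem fp_conv {G : Type u} [Group G] (h : Group.IsFinitelyPresented G) : Group.FinitelyPresented G := by
  obtain ⟨n, s, hs, ⟨e⟩⟩ := Group.IsFinitelyPresented.exists_mulEquiv_presentedGroup (G := G)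
  exact ⟨n, s, hs, ⟨e.symm⟩⟩

theorem fp_sub {G : Type u} [Group G] {B : Subgroup G} {t : G} (hB : IsVirtuallyPolycyclic B)
    (h : cj t B ≤ B) (hgen : BB B t = ⊤) (H : Subgroup G) (hH : Group.FG H) :
    Group.IsFinitelyPresented H := by
  classical
  have hnf : ∀ y : G, ∃ n : ℤ, ∃ k ∈ KK B t, y = k * t ^ n := fun y =>
    asc_nf h (by rw [hgen]; trivial)
  let A : AddSubgroup ℤ :=
    { carrier := {n | ∃ k ∈ KK B t, k * t ^ n ∈ H}
      zero_mem' := ⟨1, one_mem _, by simp [H.one_mem]⟩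
      add_mem' := by
        rintro a b ⟨k, hk, hk'⟩ ⟨l, hl, hl'⟩
        refine ⟨k * (t ^ a * l * (t ^ a)⁻¹), mul_mem hk (KK_normalizes h a hl), ?_⟩
        have := H.mul_mem hk' hl'
        convert this using 1
        rw [zpow_add]; group
      neg_mem' := by
        rintro a ⟨k, hk, hk'⟩
        refine ⟨t ^ (-a) * k⁻¹ * (t ^ (-a))⁻¹, KK_normalizes h _ (inv_mem hk), ?_⟩
        have := H.inv_mem hk'
        convert this using 1
        group }
  obtain ⟨m0, hm0⟩ := Int.subgroup_cyclic A
  have hA : ∀ n, n ∈ A → ∃ c : ℤ, n = c * m0.natAbs := by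
    intro n hn
    rw [hm0, AddSubgroup.mem_closure_singleton] at hn
    obtain ⟨c, rfl⟩ := hn
    rcases Int.natAbs_eq m0 with e | e
    · exact ⟨c, by rw [← e]; simp⟩
    · refine ⟨-c, ?_⟩
      have : (m0.natAbs : ℤ) = - m0 := by omega
      rw [this]; simp
  have hm : ((m0.natAbs : ℕ) : ℤ) ∈ A := by
    rw [hm0, AddSubgroup.mem_closure_singleton]
    rcases Int.natAbs_eq m0 with e | e
    · exact ⟨1, by rw [one_smul]; exact e⟩
    · exact ⟨-1, by rw [neg_smul, one_smul]; omega⟩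
  set n0 := m0.natAbs
  obtain ⟨k, hk, hkH⟩ := hm
  set x := k * t ^ ((n0 : ℕ) : ℤ) with hx
  have hxc : ∀ c : ℤ, ∃ k' ∈ KK B t, x ^ c = k' * t ^ (c * n0) := by
    have key : ∀ c : ℕ, ∃ k' ∈ KK B t, x ^ c = k' * t ^ ((c : ℤ) * n0) := by
      intro c
      induction c with
      | zero => exact ⟨1, one_mem _, by simp⟩
      | succ c ih =>
        obtain ⟨k', hk', e⟩ := ih
        refine ⟨k' * (t ^ ((c : ℤ) * n0) * k * (t ^ ((c : ℤ) * n0))⁻¹),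
          mul_mem hk' (KK_normalizes h _ hk), ?_⟩
        rw [pow_succ, e, hx]
        push_cast
        rw [add_mul, one_mul, zpow_add]; group
    intro c
    rcases Int.eq_nat_or_neg c with ⟨m, rfl | rfl⟩
    · simpa using key m
    · obtain ⟨k', hk', e⟩ := key m
      refine ⟨t ^ (-(m : ℤ) * n0) * k'⁻¹ * (t ^ (-(m : ℤ) * n0))⁻¹, KK_normalizes h _ (inv_mem hk'), ?_⟩
      rw [zpow_neg, zpow_natCast, e]; group
  have hdec : ∀ y ∈ H, ∃ c : ℤ, y * x ^ c ∈ KK B t := by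
    intro y hy
    obtain ⟨n, l, hl, e⟩ := hnf y
    obtain ⟨c, rfl⟩ := hA n ⟨l, hl, e ▸ hy⟩
    obtain ⟨k', hk', e'⟩ := hxc (-c)
    refine ⟨-c, ?_⟩
    have : y * x ^ (-c) = l * (t ^ (c * (n0 : ℤ)) * k' * (t ^ (c * (n0 : ℤ)))⁻¹) := by
      rw [e, e']; group
    rw [this]
    exact mul_mem hl (KK_normalizes h _ hk')
  obtain ⟨r, y, hy⟩ := exists_gen_fin hH
  choose c hc using fun j => hdec (y j) (y j).2
  have hfg : (Subgroup.closure (insert k (Set.range fun j => (y j : G) * x ^ c j))).FG :=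
    (Subgroup.fg_iff _).2 ⟨_, rfl, (Set.finite_range _).insert k⟩
  obtain ⟨i, hi⟩ := KK_fg_le h hfg (by
    rw [Subgroup.closure_le]
    rintro _ (rfl | ⟨j, rfl⟩)
    · exact hk
    · exact hc j)
  rw [Subgroup.closure_le] at hi
  set M := cj (t⁻¹ ^ i) B with hM
  have hkM : k ∈ M := hi (Set.mem_insert _ _)
  have hMt : ∀ n : ℕ, cj (t ^ n) M ≤ M := by
    intro n
    rw [hM, cj_cj]
    have : t ^ n * t⁻¹ ^ i = t⁻¹ ^ i * t ^ n := by
      exact ((Commute.refl t).inv_right.pow_pow n i)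
    rw [this, ← cj_cj]
    exact cj_mono _ (cj_pow_le h n)
  have hD : IsVirtuallyPolycyclic (H ⊓ M : Subgroup G) := vp_mono inf_le_right (vp_cj _ hB)
  have hD' : IsVirtuallyPolycyclic (M.subgroupOf H) := by
    refine IsVirtuallyPolycyclic.of_injective hD ((H.subtype.comp (M.subgroupOf H).subtype).codRestrict _
      fun x => ⟨x.1.2, x.2⟩) (fun x y hxy => Subtype.ext (Subtype.ext ?_))
    exact congrArg (fun z : (H ⊓ M : Subgroup G) => (z : G)) hxy
  have := fp_of_vp hD'
  refine fp_asc (M.subgroupOf H) (vp_fg hD') ⟨x, hkH⟩ ?_ ?_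
  · intro d hd
    rw [Subgroup.mem_subgroupOf] at hd ⊢
    have h1 : t ^ n0 * (d : G) * (t ^ n0)⁻¹ ∈ M := hMt n0 (cj_mem hd)
    have := M.mul_mem (M.mul_mem hkM h1) (M.inv_mem hkM)
    convert this using 1
    simp only [Subgroup.coe_mul, Subgroup.coe_inv, hx, zpow_natCast]; group
  · rw [eq_top_iff, ← hy, Subgroup.closure_le]
    rintro _ ⟨j, rfl⟩
    have h1 : y j * (⟨x, hkH⟩ : H) ^ c j ∈ M.subgroupOf H := by
      rw [Subgroup.mem_subgroupOf]
      exact hi (Set.mem_insert_of_mem _ ⟨j, rfl⟩)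
    have h2 := Subgroup.mul_mem _ (le_BB (M.subgroupOf H) (⟨x, hkH⟩ : H) h1)
      (Subgroup.zpow_mem _ (mem_BB (M.subgroupOf H) (⟨x, hkH⟩ : H)) (- c j))
    have h3 : y j * (⟨x, hkH⟩ : H) ^ c j * (⟨x, hkH⟩ : H) ^ (- c j) = y j := by group
    rw [h3] at h2
    exact h2

theorem coherent_of_four {G : Type u} [Group G] (h : Four G) : Group.IsCoherent G := by
  intro H hH
  apply fp_conv
  rcases h with h | ⟨B, t, h, hB⟩
  · exact fp_of_vp (h.of_injective H.subtype H.subtype_injective)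
  · obtain ⟨h1, -, h3⟩ := four_asc h
    exact fp_sub hB h1 h3 H hH

section grp
variable {G : Type u} [Group G]

/-- elements of the group ring supported in `T` -/
noncomputable def spt (T : Set G) : AddSubgroup (ZG G) := AddSubgroup.closure (gel '' T)

theorem gel_mem_spt {T : Set G} {g : G} (h : g ∈ T) : gel g ∈ spt T :=
  AddSubgroup.subset_closure ⟨g, h, rfl⟩

theorem spt_induct {T : Set G} {p : ZG G → Prop} (h1 : ∀ g ∈ T, p (gel g)) (h0 : p 0)
    (hadd : ∀ x y, p x → p y → p (x + y)) (hneg : ∀ x, p x → p (-x)) {a : ZG G} (ha : a ∈ spt T) :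
    p a := by
  unfold spt at ha
  induction ha using AddSubgroup.closure_induction with
  | mem x hx => obtain ⟨g, hg, rfl⟩ := hx; exact h1 g hg
  | zero => exact h0
  | add x y _ _ hx hy => exact hadd x y hx hy
  | neg x _ hx => exact hneg x hx

theorem spt_mono {T U : Set G} (h : T ⊆ U) : spt T ≤ spt U :=
  AddSubgroup.closure_mono (Set.image_mono h)

theorem spt_mul {T U W : Set G} (h : ∀ x ∈ T, ∀ y ∈ U, x * y ∈ W) {a b : ZG G} (ha : a ∈ spt T)
    (hb : b ∈ spt U) : a * b ∈ spt W := by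
  refine spt_induct (p := fun a => a * b ∈ spt W) ?_ ?_ ?_ ?_ ha
  · intro x hx
    refine spt_induct (p := fun b => gel x * b ∈ spt W) ?_ ?_ ?_ ?_ hb
    · intro y hy; rw [← gel_mul]; exact gel_mem_spt (h x hx y hy)
    · rw [mul_zero]; exact zero_mem _
    · intro y z hy hz; rw [mul_add]; exact add_mem hy hz
    · intro y hy; rw [mul_neg]; exact neg_mem hy
  · rw [zero_mul]; exact zero_mem _
  · intro y z hy hz; rw [add_mul]; exact add_mem hy hz
  · intro y hy; rw [neg_mul]; exact neg_mem hy

theorem spt_gel_mul {g : G} {U W : Set G} (h : ∀ y ∈ U, g * y ∈ W) {b : ZG G} (hb : b ∈ spt U) :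
    gel g * b ∈ spt W :=
  spt_mul (T := {g}) (by rintro _ rfl y hy; exact h y hy) (gel_mem_spt rfl) hb

open Classical in
/-- restriction of the support to `T` -/
noncomputable def rst (T : Set G) : ZG G →+ ZG G := zlift fun g => if g ∈ T then gel g else 0

theorem rst_mem {T : Set G} {g : G} (h : g ∈ T) : rst T (gel g) = gel g := by
  rw [rst, zlift_gel, if_pos h]

theorem rst_notMem {T : Set G} {g : G} (h : g ∉ T) : rst T (gel g) = 0 := by
  rw [rst, zlift_gel, if_neg h]

theorem rst_spt {T U : Set G} {a : ZG G} (ha : a ∈ spt U) : rst T a ∈ spt (T ∩ U) := by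
  refine spt_induct (p := fun a => rst T a ∈ spt (T ∩ U)) ?_ ?_ ?_ ?_ ha
  · intro g hg
    by_cases h : g ∈ T
    · rw [rst_mem h]; exact gel_mem_spt ⟨h, hg⟩
    · rw [rst_notMem h]; exact zero_mem _
  · rw [map_zero]; exact zero_mem _
  · intro x y hx hy; rw [map_add]; exact add_mem hx hy
  · intro x hx; rw [map_neg]; exact neg_mem hx

theorem rst_id {T : Set G} {a : ZG G} (ha : a ∈ spt T) : rst T a = a := by
  refine spt_induct (p := fun a => rst T a = a) ?_ ?_ ?_ ?_ ha
  · intro g hg; exact rst_mem hg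
  · rw [map_zero]
  · intro x y hx hy; rw [map_add, hx, hy]
  · intro x hx; rw [map_neg, hx]

theorem rst_disj {T U : Set G} (hd : ∀ u ∈ U, u ∉ T) {a : ZG G} (ha : a ∈ spt U) : rst T a = 0 := by
  refine spt_induct (p := fun a => rst T a = 0) ?_ ?_ ?_ ?_ ha
  · intro g hg; exact rst_notMem (hd g hg)
  · rw [map_zero]
  · intro x y hx hy; rw [map_add, hx, hy, add_zero]
  · intro x hx; rw [map_neg, hx, neg_zero]

noncomputable instance modB (B : Subgroup G) : Module (ZG B) (ZG G) := Module.compHom _ (zinc B)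

theorem modB_smul (B : Subgroup G) (r : ZG B) (a : ZG G) : r • a = zinc B r * a := rfl

instance modB_tower (B : Subgroup G) : IsScalarTower (ZG B) (ZG G) (ZG G) :=
  ⟨fun r a b => by simp only [modB_smul, smul_eq_mul, mul_assoc]⟩

theorem zinc_spt (B : Subgroup G) (r : ZG B) : zinc B r ∈ spt (B : Set G) := by
  induction r using ZG.induct with
  | h1 g => rw [zinc_gel]; exact gel_mem_spt g.2
  | hadd x y hx hy => rw [map_add]; exact add_mem hx hy
  | hneg x hx => rw [map_neg]; exact neg_mem hx

theorem spt_zinc (B : Subgroup G) {a : ZG G} (ha : a ∈ spt (B : Set G)) : ∃ r, zinc B r = a := by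
  refine spt_induct (p := fun a => ∃ r, zinc B r = a) ?_ ?_ ?_ ?_ ha
  · intro g hg; exact ⟨gel ⟨g, hg⟩, zinc_gel _ _⟩
  · exact ⟨0, map_zero _⟩
  · rintro _ _ ⟨x, rfl⟩ ⟨y, rfl⟩; exact ⟨x + y, map_add _ _ _⟩
  · rintro _ ⟨x, rfl⟩; exact ⟨-x, map_neg _ _⟩

/-- `spt T` as a `ℤB`-module -/
noncomputable def sptM (B : Subgroup G) (T : Set G) (hT : ∀ b ∈ B, ∀ u ∈ T, b * u ∈ T) :
    Submodule (ZG B) (ZG G) :=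
  { spt T with
    smul_mem' := fun r a ha => spt_mul (T := (B : Set G)) hT (zinc_spt B r) ha }

theorem mem_sptM {B : Subgroup G} {T : Set G} {hT : ∀ b ∈ B, ∀ u ∈ T, b * u ∈ T} {a : ZG G} :
    a ∈ sptM B T hT ↔ a ∈ spt T := Iff.rfl

theorem sptM_fg {B : Subgroup G} {T : Set G} {hT : ∀ b ∈ B, ∀ u ∈ T, b * u ∈ T} {F : Set G}
    (hF : F.Finite) (hFT : F ⊆ T) (h : ∀ u ∈ T, ∃ b ∈ B, ∃ f ∈ F, u = b * f) : (sptM B T hT).FG := by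
  refine (Submodule.fg_def).2 ⟨gel '' F, hF.image _, le_antisymm ?_ ?_⟩
  · rw [Submodule.span_le]
    rintro _ ⟨f, hf, rfl⟩
    exact gel_mem_spt (hFT hf)
  · intro a ha
    refine spt_induct (p := fun a => a ∈ Submodule.span (ZG B) (gel '' F)) ?_ ?_ ?_ ?_ (mem_sptM.1 ha)
    · intro u hu
      obtain ⟨b, hb, f, hf, rfl⟩ := h u hu
      have : gel (b * f) = (gel (⟨b, hb⟩ : B)) • (gel f : ZG G) := by
        rw [modB_smul, zinc_gel, gel_mul]
      rw [this]
      exact Submodule.smul_mem _ _ (Submodule.subset_span ⟨f, hf, rfl⟩)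
    · exact zero_mem _
    · intro x y; exact add_mem
    · intro x; exact neg_mem

theorem fg_span_inf {R S M : Type*} [Ring R] [Ring S] [AddCommGroup M] [Module R M] [Module S M]
    [Module R S] [IsScalarTower R S M] (P : Submodule R M) (hP : IsNoetherian R P)
    (Q : Submodule S M) : (Submodule.span S {v | v ∈ Q ∧ v ∈ P}).FG := by
  have h := isNoetherian_submodule.1 hP ((Q.restrictScalars R) ⊓ P) inf_le_right
  obtain ⟨s, hs, he⟩ := Submodule.fg_def.1 h
  refine Submodule.fg_def.2 ⟨s, hs, le_antisymm (Submodule.span_mono ?_) ?_⟩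
  · intro v hv
    have : v ∈ Q.restrictScalars R ⊓ P := he ▸ Submodule.subset_span hv
    exact this
  · rw [Submodule.span_le]
    intro v hv
    have : v ∈ Submodule.span R s := by rw [he]; exact hv
    exact Submodule.span_le_restrictScalars R S s this

/-- heights -/
def HT (B : Subgroup G) (t : G) (n : ℕ) : Set G := {u | ∃ b ∈ B, ∃ k < n, u = b * t ^ k}

def HS (B : Subgroup G) (t : G) : Set G := {u | ∃ b ∈ B, ∃ k : ℕ, u = b * t ^ k}

variable {B : Subgroup G} {t : G}

theorem HT_mono {m n : ℕ} (h : m ≤ n) : HT B t m ⊆ HT B t n := by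
  rintro _ ⟨b, hb, k, hk, rfl⟩; exact ⟨b, hb, k, hk.trans_le h, rfl⟩

theorem HT_HS (n : ℕ) : HT B t n ⊆ HS B t := by
  rintro _ ⟨b, hb, k, hk, rfl⟩; exact ⟨b, hb, k, rfl⟩

theorem HT_B (n : ℕ) : ∀ b ∈ B, ∀ u ∈ HT B t n, b * u ∈ HT B t n := by
  rintro b hb _ ⟨b', hb', k, hk, rfl⟩; exact ⟨b * b', B.mul_mem hb hb', k, hk, by rw [mul_assoc]⟩

theorem spt_HS {a : ZG G} (ha : a ∈ spt (HS B t)) : ∃ n, a ∈ spt (HT B t n) := by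
  refine spt_induct (p := fun a => ∃ n, a ∈ spt (HT B t n)) ?_ ?_ ?_ ?_ ha
  · rintro _ ⟨b, hb, k, rfl⟩; exact ⟨k + 1, gel_mem_spt ⟨b, hb, k, by omega, rfl⟩⟩
  · exact ⟨0, zero_mem _⟩
  · rintro x y ⟨n, hx⟩ ⟨m, hy⟩
    exact ⟨max n m, add_mem (spt_mono (HT_mono (le_max_left _ _)) hx) (spt_mono (HT_mono (le_max_right _ _)) hy)⟩
  · rintro x ⟨n, hx⟩; exact ⟨n, neg_mem hx⟩

/-- the module of elements of height `< n` -/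
noncomputable def HM (B : Subgroup G) (t : G) (n : ℕ) : Submodule (ZG B) (ZG G) := sptM B (HT B t n) (HT_B n)

theorem mem_HM {n : ℕ} {a : ZG G} : a ∈ HM B t n ↔ a ∈ spt (HT B t n) := Iff.rfl

theorem HM_fg (n : ℕ) : (HM B t n).FG := by
  refine sptM_fg (F := (fun k => t ^ k) '' (Set.Iio n)) ((Set.finite_Iio n).image _) ?_ ?_
  · rintro _ ⟨k, hk, rfl⟩; exact ⟨1, B.one_mem, k, hk, by simp⟩
  · rintro _ ⟨b, hb, k, hk, rfl⟩
    exact ⟨b, hb, _, ⟨k, hk, rfl⟩, rfl⟩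

theorem HM_noeth [IsNoetherianRing (ZG B)] (n : ℕ) : IsNoetherian (ZG B) (HM B t n) :=
  isNoetherian_of_fg_of_noetherian _ (HM_fg n)

theorem tpow (h : ∀ b ∈ B, t * b * t⁻¹ ∈ B) (k : ℕ) {b : G} (hb : b ∈ B) : t ^ k * b * (t ^ k)⁻¹ ∈ B := by
  induction k with
  | zero => simpa using hb
  | succ k ih =>
    have := h _ ih
    convert this using 1
    rw [pow_succ']; group

theorem HS_mul (h : ∀ b ∈ B, t * b * t⁻¹ ∈ B) : ∀ x ∈ HS B t, ∀ y ∈ HS B t, x * y ∈ HS B t := by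
  rintro _ ⟨b, hb, k, rfl⟩ _ ⟨c, hc, l, rfl⟩
  refine ⟨b * (t ^ k * c * (t ^ k)⁻¹), B.mul_mem hb (tpow h k hc), k + l, ?_⟩
  rw [pow_add]; group

theorem t_HT (h : ∀ b ∈ B, t * b * t⁻¹ ∈ B) (i n : ℕ) : ∀ y ∈ HT B t n, t ^ i * y ∈ HT B t (n + i) := by
  rintro _ ⟨c, hc, l, hl, rfl⟩
  refine ⟨t ^ i * c * (t ^ i)⁻¹, tpow h i hc, i + l, by omega, ?_⟩
  rw [pow_add]; group

theorem t_HS (i : ℕ) : t ^ i ∈ HS B t := ⟨1, B.one_mem, i, by simp⟩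

theorem shift_grp (h : ∀ b ∈ B, t * b * t⁻¹ ∈ B) (hgen : BB B t = ⊤) (g : G) :
    ∃ i : ℕ, t ^ i * g ∈ HS B t := by
  have hg : g ∈ BB B t := by rw [hgen]; trivial
  unfold BB at hg
  have hB : ∀ b ∈ B, ∀ g, (∃ i : ℕ, t ^ i * g ∈ HS B t) → ∃ i : ℕ, t ^ i * (b * g) ∈ HS B t := by
    rintro b hb g ⟨i, hi⟩
    refine ⟨i, ?_⟩
    have := HS_mul h (t ^ i * b * (t ^ i)⁻¹) ⟨_, tpow h i hb, 0, by simp⟩ _ hi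
    convert this using 1
    group
  induction hg using Subgroup.closure_induction_left with
  | one => exact ⟨0, by simpa using t_HS 0⟩
  | mul_left x hx y hy ih =>
    rcases hx with hx | rfl
    · exact hB x hx y ih
    · obtain ⟨i, hi⟩ := ih
      refine ⟨i, ?_⟩
      have := HS_mul h _ (t_HS 1) _ hi
      convert this using 1
      rw [← mul_assoc, ← mul_assoc, ← pow_succ, ← pow_add, add_comm]
  | inv_mul_cancel x hx y hy ih =>
    rcases hx with hx | rfl
    · exact hB _ (B.inv_mem hx) y ih
    · obtain ⟨i, hi⟩ := ih
      exact ⟨i + 1, by rw [pow_succ]; simpa [mul_assoc] using hi⟩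

theorem shift_ring (h : ∀ b ∈ B, t * b * t⁻¹ ∈ B) (hgen : BB B t = ⊤) (a : ZG G) :
    ∃ i : ℕ, ∀ j ≥ i, gel (t ^ j) * a ∈ spt (HS B t) := by
  induction a using ZG.induct with
  | h1 g =>
    obtain ⟨i, hi⟩ := shift_grp h hgen g
    refine ⟨i, fun j hj => ?_⟩
    rw [← gel_mul]
    apply gel_mem_spt
    have := HS_mul h _ (t_HS (j - i)) _ hi
    rwa [← mul_assoc, ← pow_add, Nat.sub_add_cancel hj] at this
  | hadd x y hx hy =>
    obtain ⟨i, hi⟩ := hx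
    obtain ⟨k, hk⟩ := hy
    refine ⟨max i k, fun j hj => ?_⟩
    rw [mul_add]
    exact add_mem (hi j (by omega)) (hk j (by omega))
  | hneg x hx =>
    obtain ⟨i, hi⟩ := hx
    exact ⟨i, fun j hj => by rw [mul_neg]; exact neg_mem (hi j hj)⟩

theorem shift_fin (h : ∀ b ∈ B, t * b * t⁻¹ ∈ B) (hgen : BB B t = ⊤) {k : ℕ} (a : Fin k → ZG G) :
    ∃ i n : ℕ, ∀ j, gel (t ^ i) * a j ∈ spt (HT B t n) := by
  choose i hi using fun j => shift_ring h hgen (a j)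
  let I := Finset.univ.sup i
  have h1 : ∀ j, gel (t ^ I) * a j ∈ spt (HS B t) := fun j => hi j I (Finset.le_sup (Finset.mem_univ j))
  choose n hn using fun j => spt_HS (h1 j)
  exact ⟨I, Finset.univ.sup n, fun j => spt_mono (HT_mono (Finset.le_sup (f := n) (Finset.mem_univ j))) (hn j)⟩

end grp

section hall
variable {G : Type u} [Group G]

theorem hall_fin (N : Subgroup G) (h : IsNoetherianRing (ZG N)) (hf : Finite (G ⧸ N)) :
    IsNoetherianRing (ZG G) := by
  have hu : ∀ b ∈ N, ∀ u ∈ (Set.univ : Set G), b * u ∈ (Set.univ : Set G) := fun _ _ _ _ => Set.mem_univ _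
  have hfg : (sptM N (Set.univ : Set G) hu).FG := by
    refine sptM_fg (F := Set.range fun q : G ⧸ N => (q.out)⁻¹) (Set.finite_range _) (Set.subset_univ _) ?_
    intro u _
    refine ⟨u * (QuotientGroup.mk u⁻¹ : G ⧸ N).out, ?_, _, ⟨QuotientGroup.mk u⁻¹, rfl⟩, by group⟩
    have : (QuotientGroup.mk u⁻¹ : G ⧸ N) = QuotientGroup.mk (QuotientGroup.mk u⁻¹ : G ⧸ N).out :=
      (QuotientGroup.out_eq' _).symm
    have h2 := QuotientGroup.eq.1 this
    simpa using h2
  have htop : sptM N (Set.univ : Set G) hu = ⊤ := by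
    rw [eq_top_iff]
    intro a ha
    clear ha
    refine mem_sptM.2 ?_
    induction a using ZG.induct with
    | h1 g => exact gel_mem_spt (Set.mem_univ g)
    | hadd x y hx hy => exact add_mem hx hy
    | hneg x hx => exact neg_mem hx
  rw [htop] at hfg
  have : Module.Finite (ZG N) (ZG G) := ⟨hfg⟩
  have h1 : IsNoetherian (ZG N) (ZG G) := isNoetherian_of_isNoetherianRing_of_finite _ _
  exact isNoetherian_of_tower (ZG N) h1

theorem hall_cyc (N : Subgroup G) [hN : N.Normal] (h : IsNoetherianRing (ZG N))
    (t : G) (hgen : BB N t = ⊤) : IsNoetherianRing (ZG G) := by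
  have ht : ∀ b ∈ N, t * b * t⁻¹ ∈ N := fun b hb => hN.conj_mem b hb t
  refine ⟨fun I => ?_⟩
  -- leading coefficients
  let Λ : ℕ → Submodule (ZG N) (ZG N) := fun n =>
    { carrier := {c | ∃ a ∈ I, a - gel (t ^ n) * zinc N c ∈ spt (HT N t n)}
      zero_mem' := ⟨0, zero_mem _, by simp⟩
      add_mem' := by
        rintro c c' ⟨a, ha, hc⟩ ⟨a', ha', hc'⟩
        refine ⟨a + a', add_mem ha ha', ?_⟩
        have := add_mem hc hc'
        convert this using 1
        rw [map_add, mul_add]; abel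
      smul_mem' := by
        rintro r c ⟨a, ha, hc⟩
        refine ⟨gel (t ^ n) * zinc N r * gel (t ^ n)⁻¹ * a, I.smul_mem _ ha, ?_⟩
        have h1 : gel (t ^ n) * zinc N r * gel (t ^ n)⁻¹ ∈ spt (N : Set G) := by
          have h2 : gel (t ^ n) * zinc N r ∈ spt {y | y * (t ^ n)⁻¹ ∈ N} :=
            spt_gel_mul (fun y hy => hN.conj_mem y hy _) (zinc_spt N r)
          refine spt_mul (U := {(t ^ n)⁻¹}) ?_ h2 (gel_mem_spt rfl)
          rintro x hx _ rfl; exact hx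
        have := spt_mul (T := (N : Set G)) (HT_B (B := N) (t := t) n) h1 hc
        convert this using 1
        rw [mul_sub, smul_eq_mul, map_mul]
        congr 1
        simp only [mul_assoc]
        rw [← mul_assoc (gel (t ^ n)⁻¹) (gel (t ^ n)), gel_inv_mul, one_mul] }
  have hΛ : ∀ {n c}, c ∈ Λ n ↔ ∃ a ∈ I, a - gel (t ^ n) * zinc N c ∈ spt (HT N t n) := Iff.rfl
  have hmono : Monotone Λ := by
    apply monotone_nat_of_le_succ
    rintro n c ⟨a, ha, hc⟩
    refine ⟨gel (t ^ 1) * a, I.smul_mem _ ha, ?_⟩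
    have := spt_gel_mul (t_HT ht 1 n) hc
    rwa [mul_sub, ← mul_assoc, ← gel_mul, ← pow_add, add_comm 1 n] at this
  obtain ⟨m, hm⟩ := monotone_stabilizes_iff_noetherian.2 h ⟨Λ, hmono⟩
  have hm : ∀ n, m ≤ n → Λ m = Λ n := hm
  let J := Submodule.span (ZG G) {v | v ∈ I ∧ v ∈ HM N t (m + 1)}
  have hJ : J.FG := fg_span_inf (HM N t (m + 1)) (HM_noeth _) I
  have key : ∀ n, ∀ a ∈ I, a ∈ spt (HT N t n) → a ∈ J := by
    intro n
    induction n with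
    | zero => intro a ha h; exact Submodule.subset_span ⟨ha, spt_mono (HT_mono (by omega)) h⟩
    | succ n ih =>
      intro a ha h
      by_cases hn : n < m + 1
      · exact Submodule.subset_span ⟨ha, spt_mono (HT_mono (by omega)) h⟩
      have hlead : ∃ c, a - gel (t ^ n) * zinc N c ∈ spt (HT N t n) := by
        refine spt_induct (p := fun a => ∃ c, a - gel (t ^ n) * zinc N c ∈ spt (HT N t n)) ?_ ?_ ?_ ?_ h
        · rintro _ ⟨b, hb, k, hk, rfl⟩
          by_cases hkn : k < n
          · refine ⟨0, ?_⟩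
            rw [map_zero, mul_zero, sub_zero]
            exact gel_mem_spt ⟨b, hb, k, hkn, rfl⟩
          · have : k = n := by omega
            subst this
            have hb' : (t ^ k)⁻¹ * b * t ^ k ∈ N := by simpa using hN.conj_mem b hb (t ^ k)⁻¹
            refine ⟨gel ⟨_, hb'⟩, ?_⟩
            rw [zinc_gel, ← gel_mul]
            have : t ^ k * ((t ^ k)⁻¹ * b * t ^ k) = b * t ^ k := by group
            rw [this, sub_self]
            exact zero_mem _
        · exact ⟨0, by simp⟩
        · rintro x y ⟨c, hc⟩ ⟨d, hd⟩
          refine ⟨c + d, ?_⟩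
          have := add_mem hc hd
          convert this using 1
          rw [map_add, mul_add]; abel
        · rintro x ⟨c, hc⟩
          refine ⟨-c, ?_⟩
          have := neg_mem hc
          convert this using 1
          rw [map_neg, mul_neg]; abel
      obtain ⟨c, hc⟩ := hlead
      have hc1 : c ∈ Λ n := ⟨a, ha, hc⟩
      rw [← hm n (by omega)] at hc1
      obtain ⟨a', ha', hc'⟩ := hc1
      have ha's : a' ∈ spt (HT N t (m + 1)) := by
        have h2 : gel (t ^ m) * zinc N c ∈ spt (HT N t (m + 1)) := by
          refine spt_gel_mul ?_ (zinc_spt N c)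
          intro b hb
          have := t_HT ht m 1 b ⟨b, hb, 0, by omega, by simp⟩
          rwa [add_comm] at this
        have := add_mem (spt_mono (HT_mono (Nat.le_succ m)) hc') h2
        simpa using this
      have h3 : a - gel (t ^ (n - m)) * a' ∈ spt (HT N t n) := by
        have h4 := spt_gel_mul (t_HT ht (n - m) m) hc'
        rw [Nat.add_sub_cancel' (by omega)] at h4
        have := sub_mem hc h4
        convert this using 1
        rw [mul_sub, ← mul_assoc, ← gel_mul, ← pow_add, Nat.sub_add_cancel (by omega)]
        abel
      have h5 := ih _ (sub_mem ha (I.smul_mem (gel (t ^ (n - m))) ha')) h3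
      have h6 : gel (t ^ (n - m)) * a' ∈ J := J.smul_mem _ (Submodule.subset_span ⟨ha', ha's⟩)
      simpa using add_mem h5 h6
  have : I = J := by
    apply le_antisymm
    · intro a ha
      obtain ⟨i, hi⟩ := shift_ring ht hgen a
      obtain ⟨n, hn⟩ := spt_HS (hi i le_rfl)
      have h1 := key n _ (I.smul_mem (gel (t ^ i)) ha) hn
      have h2 := J.smul_mem (gel (t ^ i)⁻¹) h1
      rwa [smul_eq_mul, smul_eq_mul, ← mul_assoc, gel_inv_mul, one_mul] at h2
    · exact Submodule.span_le.2 fun v hv => hv.1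
  rw [this]
  exact hJ

end hall

theorem hall {G : Type u} [Group G] (hG : IsVirtuallyPolycyclic G) : IsNoetherianRing (ZG G) := by
  refine vp_induction (P := fun G _ => IsNoetherianRing (ZG G)) ?_ ?_ ?_ hG
  · intro G _ hs
    let φ : ℤ →+* ZG G := Int.castRingHom _
    have hφ : Function.Surjective φ := by
      intro a
      induction a using ZG.induct with
      | h1 g => exact ⟨1, by rw [map_one, Subsingleton.elim g 1, gel_one]⟩
      | hadd x y hx hy =>
        obtain ⟨m, rfl⟩ := hx
        obtain ⟨n, rfl⟩ := hy
        exact ⟨m + n, map_add _ _ _⟩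
      | hneg x hx =>
        obtain ⟨m, rfl⟩ := hx
        exact ⟨-m, map_neg _ _⟩
    exact isNoetherianRing_of_surjective ℤ (ZG G) φ hφ
  · intro G _ N _ h hc
    obtain ⟨t, ht⟩ := cyc_gen N hc
    refine hall_cyc N h t ?_
    rw [eq_top_iff]
    intro g _
    obtain ⟨n, hn⟩ := ht g
    have : g = g * (t ^ n)⁻¹ * t ^ n := by group
    rw [this]
    exact Subgroup.mul_mem _ (le_BB N t hn) (Subgroup.zpow_mem _ (mem_BB N t) n)
  · intro G _ N _ h hf
    exact hall_fin N h hf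

section asc
variable {G : Type u} [Group G] {B : Subgroup G} {t : G}

/-- `cj t B` inside `B` -/
abbrev PB (B : Subgroup G) (t : G) : Subgroup B := (cj t B).subgroupOf B

def DD (B : Subgroup G) (t : G) (q : B ⧸ PB B t) : Set G :=
  {u | ∃ (b : B) (n : ℕ), u = (b : G) * t ^ (n + 1) ∧ (QuotientGroup.mk b : B ⧸ PB B t) = q}

noncomputable def dt (B : Subgroup G) (t : G) (q : B ⧸ PB B t) : G := ((q.out : B) : G) * t

theorem asc_t (h1 : cj t B ≤ B) : ∀ b ∈ B, t * b * t⁻¹ ∈ B := fun _ hb => h1 (cj_mem hb)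

theorem pow_notMem (h1 : cj t B ≤ B) (h2 : ¬ B ≤ cj t B) (n : ℕ) : t ^ (n + 1) ∉ B := by
  intro hn
  apply h2
  intro b hb
  rw [mem_cj]
  have h3 := tpow (asc_t h1) n (B.mul_mem (B.mul_mem (B.inv_mem hn) hb) hn)
  convert h3 using 1
  rw [pow_succ]
  group

theorem asc_uniq (h1 : cj t B ≤ B) (h2 : ¬ B ≤ cj t B) {b c : G} (hb : b ∈ B) (hc : c ∈ B) {i j : ℕ}
    (h : b * t ^ i = c * t ^ j) : i = j ∧ b = c := by
  have key : ∀ {b c : G}, b ∈ B → c ∈ B → ∀ {i j : ℕ}, b * t ^ i = c * t ^ j → ¬ i < j := by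
    intro b c hb hc i j h hij
    obtain ⟨n, rfl⟩ := Nat.exists_eq_add_of_lt hij
    apply pow_notMem h1 h2 n
    have : t ^ (n + 1) = c⁻¹ * b := by
      rw [show i + n + 1 = (n + 1) + i by omega, pow_add, ← mul_assoc] at h
      have := mul_right_cancel h
      rw [this]; group
    rw [this]
    exact B.mul_mem (B.inv_mem hc) hb
  have hij : i = j := by
    have := key hb hc h
    have := key hc hb h.symm
    omega
  subst hij
  exact ⟨rfl, mul_right_cancel h⟩

theorem DD_disj (h1 : cj t B ≤ B) (h2 : ¬ B ≤ cj t B) {q q' : B ⧸ PB B t} (hq : q ≠ q') :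
    ∀ u ∈ DD B t q, u ∉ DD B t q' := by
  rintro _ ⟨b, n, rfl, rfl⟩ ⟨c, m, h, rfl⟩
  apply hq
  rw [Subtype.ext (asc_uniq h1 h2 b.2 c.2 h).2]

theorem DD_B (h1 : cj t B ≤ B) (h2 : ¬ B ≤ cj t B) {q : B ⧸ PB B t} :
    ∀ u ∈ DD B t q, u ∉ B := by
  rintro _ ⟨b, n, rfl, rfl⟩ h
  have := (asc_uniq h1 h2 b.2 h (i := n + 1) (j := 0) (by simp)).1
  omega

theorem DD_mul (h1 : cj t B ≤ B) {q : B ⧸ PB B t} :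
    ∀ u ∈ DD B t q, ∀ y ∈ HS B t, u * y ∈ DD B t q := by
  rintro _ ⟨b, n, rfl, rfl⟩ _ ⟨c, hc, m, rfl⟩
  have h3 : t ^ (n + 1) * c * (t ^ (n + 1))⁻¹ ∈ cj t B := by
    rw [mem_cj]
    have := tpow (asc_t h1) n hc
    convert this using 1
    rw [pow_succ']; group
  refine ⟨b * ⟨_, h1 h3⟩, n + m, ?_, ?_⟩
  · rw [show n + m + 1 = (n + 1) + m by omega, pow_add t (n + 1) m]
    simp only [Subgroup.coe_mul]
    group
  · rw [QuotientGroup.eq]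
    rw [Subgroup.mem_subgroupOf]
    have := (cj t B).inv_mem h3
    convert this using 1
    simp [mul_assoc]

theorem DD_HS (q : B ⧸ PB B t) : DD B t q ⊆ HS B t := by
  rintro _ ⟨b, n, rfl, rfl⟩
  exact ⟨b, b.2, n + 1, rfl⟩

theorem dt_inv (h1 : cj t B ≤ B) (h2 : ¬ B ≤ cj t B) (q : B ⧸ PB B t) (n : ℕ) :
    ∀ u ∈ DD B t q ∩ HT B t (n + 1), (dt B t q)⁻¹ * u ∈ HT B t n := by
  rintro u ⟨⟨b, m, rfl, hq⟩, c, hc, k, hk, he⟩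
  have h3 := (asc_uniq h1 h2 b.2 hc he).1
  have h4 : (QuotientGroup.mk q.out : B ⧸ PB B t) = QuotientGroup.mk b := by
    rw [hq]; exact QuotientGroup.out_eq' q
  rw [QuotientGroup.eq, Subgroup.mem_subgroupOf, mem_cj] at h4
  refine ⟨_, h4, m, by omega, ?_⟩
  simp only [dt, Subgroup.coe_mul, Subgroup.coe_inv]
  rw [pow_succ']; group

theorem dt_HT (h1 : cj t B ≤ B) (q : B ⧸ PB B t) (n : ℕ) :
    ∀ u ∈ HT B t n, dt B t q * u ∈ HT B t (n + 1) := by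
  intro u hu
  have := HT_B (n + 1) _ q.out.2 _ (t_HT (asc_t h1) 1 n u hu)
  rw [pow_one, ← mul_assoc] at this
  exact this

theorem decomp (h1 : cj t B ≤ B) (h2 : ¬ B ≤ cj t B) {a : ZG G} (ha : a ∈ spt (HS B t)) :
    ∃ F : Finset (B ⧸ PB B t), ∀ F', F ⊆ F' →
      a = rst (B : Set G) a + ∑ q ∈ F', rst (DD B t q) a := by
  classical
  refine spt_induct (p := fun a => ∃ F : Finset (B ⧸ PB B t), ∀ F', F ⊆ F' →
      a = rst (B : Set G) a + ∑ q ∈ F', rst (DD B t q) a) ?_ ?_ ?_ ?_ ha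
  · rintro _ ⟨b, hb, k, rfl⟩
    rcases k with _ | k
    · refine ⟨∅, fun F' _ => ?_⟩
      have hb' : b * t ^ 0 ∈ (B : Set G) := by simpa using hb
      rw [rst_mem hb', Finset.sum_eq_zero, add_zero]
      intro q _
      exact rst_notMem fun h => DD_B h1 h2 _ h hb'
    · refine ⟨{QuotientGroup.mk ⟨b, hb⟩}, fun F' hF => ?_⟩
      have hm : b * t ^ (k + 1) ∈ DD B t (QuotientGroup.mk ⟨b, hb⟩) := ⟨⟨b, hb⟩, k, rfl, rfl⟩
      rw [rst_notMem (DD_B h1 h2 _ hm), Finset.sum_eq_single (QuotientGroup.mk ⟨b, hb⟩), rst_mem hm, zero_add]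
      · intro q _ hq
        exact rst_notMem (DD_disj h1 h2 hq.symm _ hm)
      · intro h
        exact absurd (hF (Finset.mem_singleton_self _)) h
  · exact ⟨∅, fun F' _ => by simp⟩
  · rintro x y ⟨F, hF⟩ ⟨F2, hF2⟩
    refine ⟨F ∪ F2, fun F' h => ?_⟩
    have e1 := hF F' (Finset.union_subset_left h)
    have e2 := hF2 F' (Finset.union_subset_right h)
    simp only [map_add, Finset.sum_add_distrib]
    nth_rewrite 1 [e1]
    nth_rewrite 1 [e2]
    abel
  · rintro x ⟨F, hF⟩
    refine ⟨F, fun F' h => ?_⟩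
    have e1 := hF F' h
    simp only [map_neg, Finset.sum_neg_distrib]
    nth_rewrite 1 [e1]
    abel

theorem rst_mul (h1 : cj t B ≤ B) (h2 : ¬ B ≤ cj t B) (q : B ⧸ PB B t) {a w : ZG G}
    (ha : a ∈ spt (HS B t)) (hw : w ∈ spt (HS B t)) :
    rst (DD B t q) (a * w) = rst (DD B t q) a * w + rst (DD B t q) (rst (B : Set G) a * w) := by
  refine spt_induct (p := fun a => rst (DD B t q) (a * w) = rst (DD B t q) a * w +
    rst (DD B t q) (rst (B : Set G) a * w)) ?_ ?_ ?_ ?_ ha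
  · rintro _ ⟨b, hb, k, rfl⟩
    rcases k with _ | k
    · have hb' : b * t ^ 0 ∈ (B : Set G) := by simpa using hb
      rw [rst_mem hb', rst_notMem fun h => DD_B h1 h2 _ h hb', zero_mul, zero_add]
    · have hm : b * t ^ (k + 1) ∈ DD B t (QuotientGroup.mk ⟨b, hb⟩) := ⟨⟨b, hb⟩, k, rfl, rfl⟩
      rw [rst_notMem (T := (B : Set G)) (DD_B h1 h2 _ hm), zero_mul, map_zero, add_zero]
      have hw2 : gel (b * t ^ (k + 1)) * w ∈ spt (DD B t (QuotientGroup.mk ⟨b, hb⟩)) :=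
        spt_gel_mul (DD_mul h1 _ hm) hw
      by_cases hq : (QuotientGroup.mk ⟨b, hb⟩ : B ⧸ PB B t) = q
      · rw [hq] at hm hw2
        rw [rst_mem hm, rst_id hw2]
      · rw [rst_notMem (DD_disj h1 h2 hq _ hm), rst_disj (DD_disj h1 h2 hq) hw2, zero_mul]
  · simp
  · intro x y hx hy
    simp only [add_mul, map_add] at *
    rw [hx, hy]; abel
  · intro x hx
    simp only [neg_mul, map_neg] at *
    rw [hx]; abel

noncomputable abbrev ev {k : ℕ} (s : Fin k → ZG G) : (Fin k → ZG G) →ₗ[ZG G] ZG G :=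
  Fintype.linearCombination (ZG G) s

theorem ev_apply {k : ℕ} (s a : Fin k → ZG G) : ev s a = ∑ j, a j * s j := by
  simp [ev, Fintype.linearCombination_apply]

theorem asc_bd (h1 : cj t B ≤ B) (h2 : ¬ B ≤ cj t B) [IsNoetherianRing (ZG B)] {k d : ℕ}
    (s : Fin k → ZG G) (hs : ∀ j, s j ∈ spt (HT B t (d + 1))) :
    ∃ e, ∀ n (a : Fin k → ZG G), (∀ j, a j ∈ spt (HT B t n)) → ev s a = 0 →
      a ∈ Submodule.span (ZG G) {v | ev s v = 0 ∧ ∀ j, v j ∈ spt (HT B t e)} := by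
  classical
  have hsH : ∀ j, s j ∈ spt (HS B t) := fun j => spt_mono (HT_HS _) (hs j)
  let M : ℕ → Submodule (ZG B) (HM B t d) := fun e =>
    ((Submodule.pi Set.univ (fun _ : Fin k => HM B t e)).map
      ((ev s).restrictScalars (ZG B))).comap (HM B t d).subtype
  have hM : ∀ e (x : HM B t d), x ∈ M e ↔ ∃ b : Fin k → ZG G, (∀ j, b j ∈ spt (HT B t e)) ∧ ev s b = x := by
    intro e x
    simp only [M, Submodule.mem_comap, Submodule.mem_map, Submodule.mem_pi, Set.mem_univ, true_imp_iff]
    rfl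
  have hmono : Monotone M := by
    intro e f hef x hx
    obtain ⟨b, hb, hbx⟩ := (hM e x).1 hx
    exact (hM f x).2 ⟨b, fun j => spt_mono (HT_mono hef) (hb j), hbx⟩
  obtain ⟨e0, he0⟩ := monotone_stabilizes_iff_noetherian.2 (HM_noeth (B := B) (t := t) d) ⟨M, hmono⟩
  have he0 : ∀ n, e0 ≤ n → M e0 = M n := he0
  have hle : ∀ n, M n ≤ M e0 := fun n => by
    rw [he0 (max e0 n) (le_max_left _ _)]; exact hmono (le_max_right _ _)
  refine ⟨e0 + 1, fun n => ?_⟩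
  induction n with
  | zero =>
    intro a ha hev
    exact Submodule.subset_span ⟨hev, fun j => spt_mono (HT_mono (by omega)) (ha j)⟩
  | succ n ih =>
    intro a ha hev
    have haH : ∀ j, a j ∈ spt (HS B t) := fun j => spt_mono (HT_HS _) (ha j)
    choose F hF using fun j => decomp h1 h2 (haH j)
    let F' := Finset.univ.biUnion F
    have hF' : ∀ j, a j = rst (B : Set G) (a j) + ∑ q ∈ F', rst (DD B t q) (a j) := fun j =>
      hF j F' (Finset.subset_biUnion_of_mem F (Finset.mem_univ j))
    let A : (B ⧸ PB B t) → Fin k → ZG G := fun q j => rst (DD B t q) (a j)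
    let a0 : Fin k → ZG G := fun j => rst (B : Set G) (a j)
    have haeq : a = a0 + ∑ q ∈ F', A q := by
      funext j
      rw [Pi.add_apply, Finset.sum_apply]
      exact hF' j
    have ha0 : ∀ j, a0 j ∈ spt (B : Set G) := fun j =>
      spt_mono Set.inter_subset_left (rst_spt (haH j))
    have heva0 : ev s a0 ∈ spt (HT B t (d + 1)) := by
      rw [ev_apply]
      exact sum_mem fun j _ => spt_mul (HT_B (d + 1)) (ha0 j) (hs j)
    have hevA : ∀ q, ev s (A q) = - rst (DD B t q) (ev s a0) := by
      intro q
      have h3 : rst (DD B t q) (ev s a) = ev s (A q) + rst (DD B t q) (ev s a0) := by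
        simp only [ev_apply, map_sum, ← Finset.sum_add_distrib]
        exact Finset.sum_congr rfl fun j _ => rst_mul h1 h2 q (haH j) (hsH j)
      rw [hev, map_zero] at h3
      exact eq_neg_of_add_eq_zero_left h3.symm
    let aq : (B ⧸ PB B t) → Fin k → ZG G := fun q => gel (dt B t q)⁻¹ • A q
    have haq : ∀ q j, aq q j ∈ spt (HT B t n) := fun q j =>
      spt_gel_mul (dt_inv h1 h2 q n) (rst_spt (ha j))
    have hx : ∀ q, ev s (aq q) ∈ spt (HT B t d) := by
      intro q
      rw [map_smul, hevA]
      exact spt_gel_mul (dt_inv h1 h2 q d) (neg_mem (rst_spt heva0))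
    have hb : ∀ q, ∃ b : Fin k → ZG G, (∀ j, b j ∈ spt (HT B t e0)) ∧ ev s b = ev s (aq q) := by
      intro q
      have h3 : (⟨ev s (aq q), hx q⟩ : HM B t d) ∈ M n := (hM _ _).2 ⟨aq q, haq q, rfl⟩
      exact (hM _ _).1 (hle n h3)
    choose b hbs hbe using hb
    have hc : ∀ q, aq q - b q ∈ Submodule.span (ZG G)
        {v | ev s v = 0 ∧ ∀ j, v j ∈ spt (HT B t (e0 + 1))} := by
      intro q
      have hk : ev s (aq q - b q) = 0 := by rw [map_sub, hbe, sub_self]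
      by_cases hne : e0 ≤ n
      · exact ih _ (fun j => sub_mem (haq q j) (spt_mono (HT_mono hne) (hbs q j))) hk
      · exact Submodule.subset_span ⟨hk, fun j => sub_mem (spt_mono (HT_mono (by omega)) (haq q j))
          (spt_mono (HT_mono (by omega)) (hbs q j))⟩
    let a1 : Fin k → ZG G := a0 + ∑ q ∈ F', gel (dt B t q) • b q
    have hA : ∀ q, gel (dt B t q) • aq q = A q := by
      intro q
      simp only [aq, smul_smul, gel_mul_inv, one_smul]
    have haa : a = a1 + ∑ q ∈ F', gel (dt B t q) • (aq q - b q) := by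
      simp only [smul_sub, hA, Finset.sum_sub_distrib, a1]
      rw [haeq]; abel
    have hsum : ∑ q ∈ F', gel (dt B t q) • (aq q - b q) ∈ Submodule.span (ZG G)
        {v | ev s v = 0 ∧ ∀ j, v j ∈ spt (HT B t (e0 + 1))} :=
      sum_mem fun q _ => Submodule.smul_mem _ _ (hc q)
    have ha1 : a1 ∈ Submodule.span (ZG G)
        {v | ev s v = 0 ∧ ∀ j, v j ∈ spt (HT B t (e0 + 1))} := by
      refine Submodule.subset_span ⟨?_, fun j => ?_⟩
      · have h3 : a1 = a - ∑ q ∈ F', gel (dt B t q) • (aq q - b q) := by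
          rw [eq_sub_iff_add_eq]; exact haa.symm
        rw [h3, map_sub, hev, map_sum, Finset.sum_eq_zero, sub_zero]
        intro q _
        rw [map_smul, map_sub, hbe, sub_self, smul_zero]
      · simp only [a1, Pi.add_apply, Finset.sum_apply]
        refine add_mem (spt_mono ?_ (ha0 j)) (sum_mem fun q _ => spt_gel_mul (dt_HT h1 q e0) (hbs q j))
        intro x hx
        exact ⟨x, hx, 0, by omega, by simp⟩
    rw [haa]
    exact add_mem ha1 hsum

theorem asc_coherent (h1 : cj t B ≤ B) (h2 : ¬ B ≤ cj t B) (hgen : BB B t = ⊤)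
    [IsNoetherianRing (ZG B)] : Ring.IsCoherent (ZG G) := by
  intro I hI
  have ht := asc_t h1
  obtain ⟨k, s0, hs0⟩ := Submodule.fg_iff_exists_fin_generating_family.1 hI
  obtain ⟨i, n, hn⟩ := shift_fin ht hgen s0
  let s : Fin k → ZG G := fun j => gel (t ^ i) * s0 j
  have hs : ∀ j, s j ∈ spt (HT B t (n + 1)) := fun j => spt_mono (HT_mono (by omega)) (hn j)
  have hrange : LinearMap.range (ev s) = I := by
    rw [Fintype.range_linearCombination, ← hs0]
    apply le_antisymm
    · rw [Submodule.span_le]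
      rintro _ ⟨j, rfl⟩
      exact Submodule.smul_mem _ (gel (t ^ i)) (Submodule.subset_span ⟨j, rfl⟩)
    · rw [Submodule.span_le]
      rintro _ ⟨j, rfl⟩
      have : s0 j = gel (t ^ i)⁻¹ • s j := by
        simp only [s, smul_eq_mul]
        rw [← mul_assoc, gel_inv_mul, one_mul]
      rw [this]
      exact Submodule.smul_mem _ _ (Submodule.subset_span ⟨j, rfl⟩)
  obtain ⟨e, he⟩ := asc_bd h1 h2 s hs
  let P : Submodule (ZG B) (Fin k → ZG G) := Submodule.pi Set.univ (fun _ => HM B t e)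
  have hP : IsNoetherian (ZG B) P :=
    isNoetherian_of_fg_of_noetherian _ (Submodule.fg_pi fun _ => HM_fg e)
  have hset : {v : Fin k → ZG G | ev s v = 0 ∧ ∀ j, v j ∈ spt (HT B t e)} =
      {v | v ∈ LinearMap.ker (ev s) ∧ v ∈ P} := by
    ext v
    simp only [P, Set.mem_ofPred_eq, LinearMap.mem_ker, Submodule.mem_pi, Set.mem_univ, true_imp_iff]
    rfl
  have hker : LinearMap.ker (ev s) =
      Submodule.span (ZG G) {v | v ∈ LinearMap.ker (ev s) ∧ v ∈ P} := by
    apply le_antisymm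
    · intro a ha
      obtain ⟨l, m, hm⟩ := shift_fin ht hgen a
      have h3 := he m (gel (t ^ l) • a) hm (by rw [map_smul, LinearMap.mem_ker.1 ha, smul_zero])
      rw [hset] at h3
      have h4 := Submodule.smul_mem _ (gel (t ^ l)⁻¹) h3
      rwa [smul_smul, gel_inv_mul, one_smul] at h4
    · exact Submodule.span_le.2 fun v hv => hv.1
  have hkfg : (LinearMap.ker (ev s)).FG := by
    rw [hker]
    exact fg_span_inf P hP _
  subst hrange
  refine Module.finitePresentation_of_surjective (ev s).rangeRestrict
    (LinearMap.surjective_rangeRestrict _) ?_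
  rwa [LinearMap.ker_rangeRestrict]

end asc

theorem ringCoherent_of_four {G : Type u} [Group G] (h : Four G) :
    Ring.IsCoherent (MonoidAlgebra ℤ G) := by
  rcases h with h | ⟨B, t, h, hB⟩
  · have := hall h
    intro I hI
    have : IsNoetherianRing (MonoidAlgebra ℤ G) := this
    have : Module.Finite (MonoidAlgebra ℤ G) I := Module.Finite.iff_fg.2 hI
    exact Module.finitePresentation_of_finite _ _
  · obtain ⟨h1, h2, h3⟩ := four_asc h
    have := hall hB
    exact asc_coherent h1 h2 h3

/-- For a finitely generated elementary amenable group `G` the following are equivalent: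
(1) `G` is coherent; (2) `G` is homologically coherent; (3) the integral group ring `ℤG` is
coherent; (4) `G` is virtually polycyclic, or `G` is a properly ascending HNN extension with
virtually polycyclic vertex group. -/
theorem coherence_tfae_of_elementaryAmenable (G : Type u) [Group G]
    (hEA : ElementaryAmenable G) (hfg : Group.FG G) :
    [Group.IsCoherent G,
     Group.IsHomologicallyCoherent G,
     Ring.IsCoherent (MonoidAlgebra ℤ G),
     IsVirtuallyPolycyclic G ∨ ∃ (B : Subgroup G) (t : G),
       IsProperlyAscendingHNN G B t ∧ IsVirtuallyPolycyclic B].TFAE := by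
  tfae_have 1 → 2 := hcoherent_of_coherent
  tfae_have 3 → 2 := hcoherent_of_ringCoherent
  tfae_have 2 → 4 := four_of_hc hEA hfg
  tfae_have 4 → 1 := coherent_of_four
  tfae_have 4 → 3 := ringCoherent_of_four
  tfae_finish
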